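/- For every prime p, every S-ring over the group G = C_3 × C_3 × C_p is schurian; in particular, C_3 × C_3 × C_p is a Schur group. -/

import Mathlib

open scoped Pointwise

/-- The element `\underline{X} = Σ_{x∈X} x` of the integral group ring `ℤG`. -/
noncomputable def grpSum {G : Type*} [Group G] [Fintype G] (X : Set G) :
    MonoidAlgebra ℤ G :=
  ∑ x : G, X.indicator (fun g => MonoidAlgebra.single g (1 : ℤ)) x

/-- A Schur ring (S-ring) over a finite group `G`, described by its partition
into basic sets: (S1) `{1}` is a basic set, (S2) the class of basic sets is
closed under inverses, (S3) the ℤ-span of the sums `\underline{X}` is closed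
under multiplication (i.e. is a subring of `ℤG`). -/
structure SchurRing (G : Type*) [Group G] [Fintype G] where
  basicSets : Set (Set G)
  nonempty_mem : ∀ X ∈ basicSets, X.Nonempty
  cover : ∀ g : G, ∃ X ∈ basicSets, g ∈ X
  disjoint' : ∀ X ∈ basicSets, ∀ Y ∈ basicSets, X ≠ Y → X ∩ Y = ∅
  one_mem : {(1 : G)} ∈ basicSets
  inv_mem : ∀ X ∈ basicSets, X⁻¹ ∈ basicSets
  mul_mem : ∀ X ∈ basicSets, ∀ Y ∈ basicSets,
    grpSum X * grpSum Y ∈ Submodule.span ℤ (grpSum '' basicSets)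

namespace SchurRing

variable {G : Type*} [Group G] [Fintype G]

/-- An `𝒜`-set: a union of basic sets. -/
def IsASet (A : SchurRing G) (S : Set G) : Prop :=
  ∃ T ⊆ A.basicSets, S = ⋃₀ T

/-- An `𝒜`-subgroup: a subgroup that is an `𝒜`-set. -/
def IsASubgroup (A : SchurRing G) (H : Subgroup G) : Prop :=
  A.IsASet (H : Set G)

/-- `𝒜` is schurian: its basic sets are the orbits of the stabilizer of `1`
in some group `K` with `G_right ≤ K ≤ Sym(G)`. -/
def IsSchurian (A : SchurRing G) : Prop :=
  ∃ K : Subgroup (Equiv.Perm G), (∀ g : G, Equiv.mulRight g ∈ K) ∧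
    A.basicSets = Set.range fun x : G =>
      MulAction.orbit (MulAction.stabilizer K (1 : G)) x

/-- `𝒜` is cyclotomic: its basic sets are the orbits of a subgroup of `Aut(G)`. -/
def IsCyclotomic (A : SchurRing G) : Prop :=
  ∃ M : Subgroup (MulAut G),
    A.basicSets = Set.range fun x : G => MulAction.orbit M x

/-- `𝒜` is trivial: its basic sets are `{1}` and `G ∖ {1}`. -/
def IsTrivial (A : SchurRing G) : Prop :=
  A.basicSets ⊆ {{(1 : G)}, {(1 : G)}ᶜ}

/-- `𝒜 = 𝒜_H ⊗ 𝒜_K`: an internal tensor product decomposition of `𝒜`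
with respect to the internal direct product `G = H × K`. -/
def IsTensorDecomp (A : SchurRing G) (H K : Subgroup G) : Prop :=
  A.IsASubgroup H ∧ A.IsASubgroup K ∧ H ⊓ K = ⊥ ∧ H ⊔ K = ⊤ ∧
  ∀ X ∈ A.basicSets, ∃ X₁ ∈ A.basicSets, ∃ X₂ ∈ A.basicSets,
    X₁ ⊆ (H : Set G) ∧ X₂ ⊆ (K : Set G) ∧ X = X₁ * X₂

/-- `𝒜` is the `U/L`-wreath product: `U`, `L` are `𝒜`-subgroups, `L ⊴ G`,
`L ≤ U`, and `L ≤ rad(X)` for every basic set `X` outside `U`. -/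
def IsWreathSection (A : SchurRing G) (U L : Subgroup G) : Prop :=
  A.IsASubgroup U ∧ A.IsASubgroup L ∧ L ≤ U ∧ L.Normal ∧
  ∀ X ∈ A.basicSets, ¬ X ⊆ (U : Set G) →
    ∀ g ∈ L, (g * ·) '' X = X ∧ (· * g) '' X = X

end SchurRing

/-- A finite group is a Schur group if every S-ring over it is schurian. -/
def IsSchurGroup (G : Type*) [Group G] [Fintype G] : Prop :=
  ∀ A : SchurRing G, A.IsSchurian

/-- A Cayley isomorphism between S-rings: a group isomorphism mapping the
basic sets of `𝒜` onto the basic sets of `𝒜'`. -/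
def IsCayleyIso {G G' : Type*} [Group G] [Fintype G] [Group G'] [Fintype G']
    (A : SchurRing G) (A' : SchurRing G') (f : G ≃* G') : Prop :=
  (fun X : Set G => ⇑f '' X) '' A.basicSets = A'.basicSets

/-- A Schur ring over a commutative group, presented by the equivalence relation
of lying in the same basic set together with its structure constants. -/
structure SRel (G : Type*) [CommGroup G] where
  r : G → G → Prop
  equiv : Equivalence r
  one : ∀ x, r 1 x → x = 1
  inv : ∀ x y, r x y → r x⁻¹ y⁻¹
  count : ∀ a b x y, r x y →
    Nat.card {g : G // r a g ∧ r b (x / g)} = Nat.card {g : G // r a g ∧ r b (y / g)}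

namespace SRel

variable {G : Type*} [CommGroup G] (A : SRel G)

/-- Functions constant on the basic sets. -/
def IsClassFn {R : Type*} (u : G → R) : Prop := ∀ x y, A.r x y → u x = u y

/-- Unions of basic sets. -/
def Sat (S : Set G) : Prop := ∀ x y, A.r x y → x ∈ S → y ∈ S

/-- Local schurity: point stabilisers in the automorphism group of the
associated Cayley scheme act transitively on basic sets. -/
def LocSchur : Prop := ∀ x y, A.r x y → ∃ f : G → G, f 1 = 1 ∧ f x = y ∧
  ∀ g h, A.r (g / h) (f g / f h)

variable {A}

lemma refl (x : G) : A.r x x := A.equiv.refl x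
lemma symm {x y : G} (h : A.r x y) : A.r y x := A.equiv.symm h
lemma trans {x y z : G} (h : A.r x y) (h' : A.r y z) : A.r x z := A.equiv.trans h h'

lemma eq_one {x : G} (h : A.r x 1) : x = 1 := A.one x (symm h)

lemma r_iff_right {x y z : G} (h : A.r y z) : A.r x y ↔ A.r x z :=
  ⟨fun h' => trans h' h, fun h' => trans h' (symm h)⟩

lemma r_iff_left {x y z : G} (h : A.r y z) : A.r y x ↔ A.r z x :=
  ⟨fun h' => trans (symm h) h', fun h' => trans h h'⟩

lemma inv_iff {x y : G} : A.r x⁻¹ y⁻¹ ↔ A.r x y :=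
  ⟨fun h => by simpa using A.inv _ _ h, A.inv _ _⟩

lemma Sat.iff {S : Set G} (hS : A.Sat S) {x y : G} (h : A.r x y) : x ∈ S ↔ y ∈ S :=
  ⟨hS x y h, hS y x (symm h)⟩

lemma isClassFn_indicator {R : Type*} [Zero R] [One R] {S : Set G} (hS : A.Sat S) :
    A.IsClassFn (S.indicator (1 : G → R)) := by
  intro x y h
  by_cases hx : x ∈ S
  · simp [hx, (hS.iff h).1 hx]
  · simp [hx, mt (hS.iff h).2 hx]

lemma sat_class (a : G) : A.Sat {x | A.r a x} := fun _ _ h hx => trans hx h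

lemma Sat.inter {S T : Set G} (hS : A.Sat S) (hT : A.Sat T) : A.Sat (S ∩ T) :=
  fun x y h hx => ⟨hS x y h hx.1, hT x y h hx.2⟩

lemma Sat.compl {S : Set G} (hS : A.Sat S) : A.Sat Sᶜ :=
  fun x y h hx hy => hx (hS y x (symm h) hy)

lemma Sat.inv {S : Set G} (hS : A.Sat S) : A.Sat S⁻¹ :=
  fun x y h hx => hS _ _ (A.inv x y h) hx

lemma sat_one : A.Sat ({1} : Set G) := by
  rintro x y h rfl
  exact A.one y h

open Classical in
/-- Convolution of class functions is a class function. -/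
lemma IsClassFn.conv [Fintype G] {R : Type*} [CommSemiring R] {u v : G → R}
    (hu : A.IsClassFn u) (hv : A.IsClassFn v) :
    A.IsClassFn (fun x => ∑ g, u g * v (x / g)) := by
  let s : Setoid G := ⟨A.r, A.equiv⟩
  have key : ∀ x, ∑ g, u g * v (x / g) = ∑ ij : Quotient s × Quotient s,
      (Nat.card {g : G // A.r ij.1.out g ∧ A.r ij.2.out (x / g)} : R) *
        (u ij.1.out * v ij.2.out) := by
    intro x
    rw [← Finset.sum_fiberwise (s := Finset.univ)
      (g := fun g => ((⟦g⟧, ⟦x / g⟧) : Quotient s × Quotient s))]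
    refine Finset.sum_congr rfl fun ij _ => ?_
    have h1 : ∀ g ∈ Finset.univ.filter
        (fun g => ((⟦g⟧, ⟦x / g⟧) : Quotient s × Quotient s) = ij),
        u g * v (x / g) = u ij.1.out * v ij.2.out := by
      intro g hg
      obtain rfl := (Finset.mem_filter.1 hg).2
      congr 1
      · exact (hu _ _ (Quotient.mk_out (s := s) g)).symm
      · exact (hv _ _ (Quotient.mk_out (s := s) (x / g))).symm
    rw [Finset.sum_congr rfl h1, Finset.sum_const, nsmul_eq_mul, Nat.card_eq_fintype_card,
      Fintype.card_subtype]
    congr 3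
    ext g
    simp only [Finset.mem_filter, Finset.mem_univ, true_and]
    obtain ⟨i, j⟩ := ij
    rw [Prod.mk.injEq]
    have h2 : ∀ (i : Quotient s) (y : G), ⟦y⟧ = i ↔ A.r i.out y := by
      intro i y
      conv_lhs => rw [← Quotient.out_eq i]
      exact ⟨fun h => A.equiv.symm (Quotient.exact h), fun h => Quotient.sound (A.equiv.symm h)⟩
    rw [h2, h2]
  intro x y h
  simp only [key]
  refine Finset.sum_congr rfl fun ij _ => ?_
  rw [A.count _ _ x y h]

open Classical in
lemma count_eq_sum [Fintype G] {R : Type*} [CommSemiring R] (p q : G → Prop) (x : G) :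
    (Nat.card {g : G // p g ∧ q (x / g)} : R) =
      ∑ g, (if p g then 1 else 0) * (if q (x / g) then 1 else 0) := by
  rw [Nat.card_eq_fintype_card, Fintype.card_subtype, Finset.card_filter, Nat.cast_sum]
  refine Finset.sum_congr rfl fun g _ => ?_
  by_cases h1 : p g <;> by_cases h2 : q (x / g) <;> simp [h1, h2]

lemma Sat.count [Finite G] {S T : Set G} (hS : A.Sat S) (hT : A.Sat T) {x y : G} (h : A.r x y) :
    Nat.card {g : G // g ∈ S ∧ x / g ∈ T} = Nat.card {g : G // g ∈ S ∧ y / g ∈ T} := by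
  classical
  have := Fintype.ofFinite G
  have h1 := (isClassFn_indicator (R := ℕ) hS).conv (isClassFn_indicator (R := ℕ) hT) x y h
  have h2 := count_eq_sum (R := ℕ) (· ∈ S) (· ∈ T) x
  have h3 := count_eq_sum (R := ℕ) (· ∈ S) (· ∈ T) y
  simp only [Set.indicator_apply, Pi.one_apply] at h1
  simp only [Nat.cast_id] at h2 h3
  rw [h2, h3]
  exact h1

lemma Sat.mul [Finite G] {S T : Set G} (hS : A.Sat S) (hT : A.Sat T) : A.Sat (S * T) := by
  intro x y h hx
  have h1 := hS.count hT h
  obtain ⟨s, hs, t, ht, rfl⟩ := hx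
  have : Nonempty {g : G // g ∈ S ∧ s * t / g ∈ T} := ⟨⟨s, hs, by simpa using ht⟩⟩
  have h2 : 0 < Nat.card {g : G // g ∈ S ∧ y / g ∈ T} := by
    rw [← h1]; exact Nat.card_pos
  obtain ⟨⟨g, hg⟩⟩ := (Nat.card_pos_iff.1 h2).1
  exact ⟨g, hg.1, y / g, hg.2, by simp⟩

/-- Build a Schur ring from an equivalence relation whose class functions over a ring of
characteristic zero are closed under convolution. -/
def ofConv [Fintype G] (R : Type*) [CommSemiring R] [CharZero R] (r : G → G → Prop)
    (equiv : Equivalence r)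
    (one : ∀ x, r 1 x → x = 1) (inv : ∀ x y, r x y → r x⁻¹ y⁻¹)
    (conv : ∀ u v : G → R, (∀ x y, r x y → u x = u y) → (∀ x y, r x y → v x = v y) →
      ∀ x y, r x y → ∑ g, u g * v (x / g) = ∑ g, u g * v (y / g)) : SRel G where
  r := r
  equiv := equiv
  one := one
  inv := inv
  count a b x y h := by
    classical
    have hc : ∀ c x y, r x y → (if r c x then (1 : R) else 0) = if r c y then 1 else 0 := by
      intro c x y h
      have : r c x ↔ r c y := ⟨fun h' => equiv.trans h' h, fun h' => equiv.trans h' (equiv.symm h)⟩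
      simp [this]
    have h1 := conv _ _ (hc a) (hc b) x y h
    rw [← count_eq_sum, ← count_eq_sum] at h1
    exact_mod_cast h1

/-- The element of the group algebra with given coefficients. -/
noncomputable def toAlg [Fintype G] {R : Type*} [CommSemiring R] (u : G → R) : MonoidAlgebra R G :=
  ∑ x, MonoidAlgebra.single x (u x)

omit [CommGroup G] in
lemma coeff_toAlg [Fintype G] {R : Type*} [CommSemiring R] (u : G → R) (x : G) :
    (toAlg u).coeff x = u x := by
  classical
  simp [toAlg, MonoidAlgebra.coeff_sum, Finsupp.finsetSum_apply, Finsupp.single_apply]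

lemma toAlg_coeff [Fintype G] {R : Type*} [CommSemiring R] (f : MonoidAlgebra R G) :
    toAlg f.coeff = f := by
  ext x
  rw [coeff_toAlg]

lemma coeff_toAlg_mul [Fintype G] {R : Type*} [CommSemiring R] (u v : G → R) (x : G) :
    (toAlg u * toAlg v).coeff x = ∑ g, u g * v (x / g) := by
  classical
  have h : toAlg u * toAlg v = ∑ g, ∑ h, MonoidAlgebra.single (g * h) (u g * v h) := by
    simp [toAlg, Finset.sum_mul_sum, MonoidAlgebra.single_mul_single]
  simp only [h, MonoidAlgebra.coeff_sum, Finsupp.finsetSum_apply, MonoidAlgebra.coeff_single,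
    Finsupp.single_apply]
  refine Finset.sum_congr rfl fun g _ => ?_
  have h1 : ∀ h, g * h = x ↔ h = x / g := fun h => by rw [eq_div_iff_mul_eq', mul_comm g]
  simp [h1]

lemma IsClassFn.alg_mul [Fintype G] {R : Type*} [CommSemiring R] {f g : MonoidAlgebra R G}
    (hf : A.IsClassFn f.coeff) (hg : A.IsClassFn g.coeff) : A.IsClassFn (f * g).coeff := by
  have h := hf.conv hg
  simp_rw [← coeff_toAlg_mul, toAlg_coeff] at h
  exact h

lemma IsClassFn.alg_pow [Fintype G] {R : Type*} [CommSemiring R] {f : MonoidAlgebra R G}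
    (hf : A.IsClassFn f.coeff) (n : ℕ) : A.IsClassFn (f ^ n).coeff := by
  induction n with
  | zero =>
    classical
    intro x y h
    have : (1 : G) = x ↔ 1 = y :=
      ⟨fun h' => by subst h'; exact (A.one y h).symm, fun h' => by subst h'; exact (eq_one h).symm⟩
    simp [MonoidAlgebra.one_def, Finsupp.single_apply, this]
  | succ n ih => rw [pow_succ]; exact ih.alg_mul hf

/-- A power of a class function over `ZMod q`, computed by the Frobenius map. -/
lemma IsClassFn.frobenius [Fintype G] [DecidableEq G] {q : ℕ} [hq : Fact q.Prime]
    {u : G → ZMod q} (hu : A.IsClassFn u) :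
    A.IsClassFn (fun z => ∑ x, if x ^ q = z then u x else 0) := by
  have h : A.IsClassFn (toAlg u).coeff := fun x y h => by simpa [coeff_toAlg] using hu x y h
  have := charP_of_injective_algebraMap
    (FaithfulSMul.algebraMap_injective (ZMod q) (MonoidAlgebra (ZMod q) G)) q
  have h1 := h.alg_pow q
  have h2 : ∀ z, (toAlg u ^ q).coeff z = ∑ x, if x ^ q = z then u x else 0 := by
    intro z
    simp [toAlg, sum_pow_char, MonoidAlgebra.single_pow, MonoidAlgebra.coeff_sum,
      Finsupp.finsetSum_apply, Finsupp.single_apply, ZMod.pow_card]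
  intro x y hxy
  simpa [h2] using h1 x y hxy

end SRel

namespace SchurRing

variable {G : Type*} [CommGroup G] [Fintype G] (A : SchurRing G)

lemma mem_unique {X Y : Set G} (hX : X ∈ A.basicSets) (hY : Y ∈ A.basicSets) {x : G}
    (hx : x ∈ X) (hy : x ∈ Y) : X = Y := by
  by_contra h
  have := A.disjoint' X hX Y hY h
  exact (this ▸ (⟨hx, hy⟩ : x ∈ X ∩ Y) : x ∈ (∅ : Set G))

lemma coeff_grpSum {X : Set G} (x : G) :
    (grpSum X).coeff x = X.indicator (fun _ => (1 : ℤ)) x := by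
  classical
  rw [← SRel.coeff_toAlg (X.indicator (fun _ => (1 : ℤ)))]
  congr 2
  refine Finset.sum_congr rfl fun g _ => ?_
  by_cases h : g ∈ X <;> simp [h]

lemma coeff_eq_of_mem_span {f : MonoidAlgebra ℤ G}
    (hf : f ∈ Submodule.span ℤ (grpSum '' A.basicSets)) {Z : Set G} (hZ : Z ∈ A.basicSets)
    {x y : G} (hx : x ∈ Z) (hy : y ∈ Z) : f.coeff x = f.coeff y := by
  induction hf using Submodule.span_induction with
  | mem f hf =>
    obtain ⟨X, hX, rfl⟩ := hf
    have : x ∈ X ↔ y ∈ X := ⟨fun h => A.mem_unique hX hZ h hx ▸ hy,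
      fun h => A.mem_unique hX hZ h hy ▸ hx⟩
    rw [coeff_grpSum, coeff_grpSum]
    by_cases h : x ∈ X
    · simp [h, this.1 h]
    · simp [h, mt this.2 h]
  | zero => simp
  | add f g _ _ h1 h2 => simp [h1, h2]
  | smul c f _ h => rw [MonoidAlgebra.coeff_smul_apply, MonoidAlgebra.coeff_smul_apply, h]

/-- The relation of lying in the same basic set. -/
def toSRel : SRel G where
  r x y := ∃ X ∈ A.basicSets, x ∈ X ∧ y ∈ X
  equiv :=
    ⟨fun x => by obtain ⟨X, hX, hx⟩ := A.cover x; exact ⟨X, hX, hx, hx⟩,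
      fun ⟨X, hX, h1, h2⟩ => ⟨X, hX, h2, h1⟩,
      fun ⟨X, hX, h1, h2⟩ ⟨Y, hY, h3, h4⟩ => ⟨X, hX, h1, A.mem_unique hY hX h3 h2 ▸ h4⟩⟩
  one := by
    rintro x ⟨X, hX, h1, h2⟩
    have := A.mem_unique hX A.one_mem h1 rfl
    subst this
    exact h2
  inv := by
    rintro x y ⟨X, hX, h1, h2⟩
    exact ⟨X⁻¹, A.inv_mem X hX, by simpa using h1, by simpa using h2⟩
  count := by
    classical
    rintro a b x y ⟨Z, hZ, hx, hy⟩
    obtain ⟨X, hX, ha⟩ := A.cover a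
    obtain ⟨Y, hY, hb⟩ := A.cover b
    have h1 : ∀ g, (∃ X ∈ A.basicSets, a ∈ X ∧ g ∈ X) ↔ g ∈ X := fun g =>
      ⟨fun ⟨X', hX', h, h'⟩ => A.mem_unique hX' hX h ha ▸ h', fun h => ⟨X, hX, ha, h⟩⟩
    have h2 : ∀ g, (∃ X ∈ A.basicSets, b ∈ X ∧ g ∈ X) ↔ g ∈ Y := fun g =>
      ⟨fun ⟨X', hX', h, h'⟩ => A.mem_unique hX' hY h hb ▸ h', fun h => ⟨Y, hY, hb, h⟩⟩
    simp only [h1, h2]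
    have h3 : ∀ x, (Nat.card {g : G // g ∈ X ∧ x / g ∈ Y} : ℤ) =
        (grpSum X * grpSum Y).coeff x := by
      intro x
      rw [SRel.count_eq_sum (R := ℤ) (· ∈ X) (· ∈ Y), ← SRel.toAlg_coeff (grpSum X),
        ← SRel.toAlg_coeff (grpSum Y), SRel.coeff_toAlg_mul]
      simp [coeff_grpSum, Set.indicator_apply]
    have h4 := A.coeff_eq_of_mem_span (A.mul_mem X hX Y hY) hZ hx hy
    rw [← h3, ← h3] at h4
    exact_mod_cast h4

lemma isSchurian_of_locSchur (h : A.toSRel.LocSchur) : A.IsSchurian := by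
  let K : Subgroup (Equiv.Perm G) :=
    { carrier := {f | ∀ g h, A.toSRel.r (g / h) (f g / f h)}
      one_mem' := fun g h => SRel.refl _
      mul_mem' := fun {a b} ha hb g h => SRel.trans (hb g h) (ha _ _)
      inv_mem' := fun {a} ha g h => by
        have := ha (a⁻¹ g) (a⁻¹ h)
        rw [show a (a⁻¹ g) = g from a.apply_symm_apply g,
          show a (a⁻¹ h) = h from a.apply_symm_apply h] at this
        exact SRel.symm this }
  have key : ∀ x, MulAction.orbit (MulAction.stabilizer K (1 : G)) x = {y | A.toSRel.r x y} := by
    intro x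
    ext y
    constructor
    · rintro ⟨⟨⟨f, hf⟩, hs⟩, rfl⟩
      have h1 : f 1 = 1 := hs
      have := hf x 1
      rw [h1, div_one, div_one] at this
      exact this
    · intro hxy
      obtain ⟨f, h1, hx, hf⟩ := h x y hxy
      have hinj : Function.Injective f := by
        intro a b hab
        have := hf a b
        rw [hab, div_self'] at this
        exact div_eq_one.1 (SRel.eq_one this)
      let e := Equiv.ofBijective f (Finite.injective_iff_bijective.1 hinj)
      exact ⟨⟨⟨e, hf⟩, h1⟩, hx⟩
  refine ⟨K, fun g a b => ?_, ?_⟩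
  · simp [SRel.refl]
  · ext X
    simp only [key, Set.mem_range]
    constructor
    · intro hX
      obtain ⟨x, hx⟩ := A.nonempty_mem X hX
      refine ⟨x, Set.ext fun y => ⟨?_, fun hy => ⟨X, hX, hx, hy⟩⟩⟩
      rintro ⟨Y, hY, h1, h2⟩
      exact A.mem_unique hY hX h1 hx ▸ h2
    · rintro ⟨x, rfl⟩
      obtain ⟨X, hX, hx⟩ := A.cover x
      convert hX
      ext y
      refine ⟨?_, fun hy => ⟨X, hX, hx, hy⟩⟩
      rintro ⟨Y, hY, h1, h2⟩
      exact A.mem_unique hY hX h1 hx ▸ h2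

end SchurRing

namespace SRel

variable {G : Type*} [CommGroup G] {A : SRel G}

variable (A) in
/-- Restriction of a Schur ring to a saturated subgroup. -/
def res (U : Subgroup G) (hU : A.Sat U) : SRel U where
  r x y := A.r x y
  equiv := ⟨fun x => A.equiv.refl x, fun h => A.equiv.symm h, fun h h' => A.equiv.trans h h'⟩
  one x h := Subtype.ext (A.one x h)
  inv x y h := A.inv x y h
  count a b x y h := by
    have key : ∀ z : U, Nat.card {g : U // A.r a g ∧ A.r b ↑(z / g)} =
        Nat.card {g : G // A.r a g ∧ A.r b (z / g)} := fun z =>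
      Nat.card_congr
        { toFun := fun g => ⟨g.1, by simpa using g.2⟩
          invFun := fun g => ⟨⟨g.1, hU _ _ g.2.1 a.2⟩, by simpa using g.2⟩
          left_inv := fun g => rfl
          right_inv := fun g => rfl }
    rw [key, key]
    exact A.count _ _ _ _ h

lemma exists_mul_of_mul_left [Finite G] {L : Subgroup G} (hL : A.Sat L) {x y l : G} (hl : l ∈ L)
    (h : A.r (x * l) y) : ∃ m ∈ L, A.r x (y * m) := by
  obtain ⟨z, hz, m, hm, rfl⟩ := (sat_class (A := A) x).mul hL _ _ h ⟨x, refl x, l, hl, rfl⟩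
  exact ⟨m⁻¹, inv_mem hm, by simpa using hz⟩

lemma mk_rel_mk [Finite G] {L : Subgroup G} (hL : A.Sat L) (x y : G) :
    (∃ x' y' : G, (x' : G ⧸ L) = x ∧ (y' : G ⧸ L) = y ∧ A.r x' y') ↔ ∃ l ∈ L, A.r x (y * l) := by
  constructor
  · rintro ⟨x', y', hx, hy, h⟩
    have h1 : x⁻¹ * x' ∈ L := QuotientGroup.eq.1 hx.symm
    have h2 : y⁻¹ * y' ∈ L := QuotientGroup.eq.1 hy.symm
    obtain ⟨m, hm, h3⟩ := exists_mul_of_mul_left (x := x) hL h1 (by simpa using h)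
    exact ⟨_, mul_mem h2 hm, by simpa [← mul_assoc] using h3⟩
  · rintro ⟨l, hl, h⟩
    exact ⟨x, y * l, rfl, by simpa using hl, h⟩

lemma sum_comp_mk {R : Type*} [CommSemiring R] (L : Subgroup G) [Fintype G] [Fintype (G ⧸ L)]
    (F : G ⧸ L → R) :
    ∑ g : G, F g = (Nat.card L : R) * ∑ q, F q := by
  classical
  have h : ∀ q : G ⧸ L, (Finset.univ.filter fun g : G => (g : G ⧸ L) = q).card = Nat.card L := by
    intro q
    obtain ⟨x, rfl⟩ := QuotientGroup.mk_surjective q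
    rw [← Fintype.card_subtype, ← Nat.card_eq_fintype_card]
    refine Nat.card_congr ⟨fun g => ⟨x⁻¹ * g.1, QuotientGroup.eq.1 g.2.symm⟩,
      fun l => ⟨x * l.1, by simp⟩, fun g => ?_, fun l => ?_⟩ <;> ext <;> simp
  rw [← Finset.sum_fiberwise (s := Finset.univ) (g := fun g : G => (g : G ⧸ L)), Finset.mul_sum]
  refine Finset.sum_congr rfl fun q _ => ?_
  rw [Finset.sum_congr rfl (g := fun _ => F q), Finset.sum_const, h, nsmul_eq_mul]
  intro g hg
  rw [(Finset.mem_filter.1 hg).2]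

variable (A) in
/-- Quotient of a Schur ring by a saturated subgroup. -/
noncomputable def quo [Finite G] (L : Subgroup G) (hL : A.Sat L) : SRel (G ⧸ L) :=
  haveI := Fintype.ofFinite G
  haveI := Fintype.ofFinite (G ⧸ L)
  ofConv ℚ (fun a b => ∃ x y : G, (x : G ⧸ L) = a ∧ (y : G ⧸ L) = b ∧ A.r x y)
    ⟨fun a => by
      obtain ⟨x, rfl⟩ := QuotientGroup.mk_surjective a
      exact ⟨x, x, rfl, rfl, refl x⟩, fun ⟨x, y, hx, hy, h⟩ => ⟨y, x, hy, hx, symm h⟩, by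
      intro a b c h h'
      obtain ⟨x, rfl⟩ := QuotientGroup.mk_surjective a
      obtain ⟨y, rfl⟩ := QuotientGroup.mk_surjective b
      obtain ⟨z, rfl⟩ := QuotientGroup.mk_surjective c
      rw [mk_rel_mk hL] at h h' ⊢
      obtain ⟨l, hl, h⟩ := h
      obtain ⟨m, hm, h'⟩ := h'
      obtain ⟨k, hk, h3⟩ := exists_mul_of_mul_left (x := y * l) (y := z * m) (l := l⁻¹) hL
        (inv_mem hl) (by simpa using h')
      exact ⟨m * k, mul_mem hm hk, by simpa [← mul_assoc] using trans h h3⟩⟩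
    (by
      rintro a ⟨x, y, hx, rfl, h⟩
      rw [QuotientGroup.eq_one_iff] at hx ⊢
      exact hL _ _ h hx)
    (by
      rintro a b ⟨x, y, rfl, rfl, h⟩
      exact ⟨x⁻¹, y⁻¹, rfl, rfl, A.inv _ _ h⟩)
    (by
      intro u v hu hv a b ⟨x, y, hx, hy, h⟩
      subst hx hy
      have hu' : A.IsClassFn (fun x : G => u x) := fun x y h => hu _ _ ⟨x, y, rfl, rfl, h⟩
      have hv' : A.IsClassFn (fun x : G => v x) := fun x y h => hv _ _ ⟨x, y, rfl, rfl, h⟩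
      have h1 := hu'.conv hv' x y h
      simp only [QuotientGroup.mk_div] at h1
      rw [sum_comp_mk L fun q => u q * v (x / q), sum_comp_mk L fun q => u q * v (y / q)] at h1
      exact mul_left_cancel₀ (Nat.cast_ne_zero.2 Nat.card_pos.ne') h1)

lemma quo_r [Finite G] {L : Subgroup G} (hL : A.Sat L) (x y : G) :
    (A.quo L hL).r x y ↔ ∃ l ∈ L, A.r x (y * l) := mk_rel_mk hL x y

/-- Automorphisms of the Cayley scheme of a Schur ring. -/
def IsAut (A : SRel G) (f : G → G) : Prop := ∀ g h, A.r (g / h) (f g / f h)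

lemma IsAut.inj {f : G → G} (hf : A.IsAut f) {a b : G} (h : f a = f b) : a = b := by
  have := hf a b
  rw [h, div_self'] at this
  exact div_eq_one.1 (eq_one this)

/-- A map acting on a section `U / L` of order at most three, fixing the identity and
inverting a non-trivial element, is the inversion. -/
lemma mul_mem_of_inverts {U L : Subgroup G}
    (h3 : ∀ u ∈ U, ∀ v ∈ U, u ∈ L ∨ v ∈ L ∨ v / u ∈ L ∨ v * u ∈ L) {F : G → G}
    (hFU : ∀ u ∈ U, F u ∈ U) (hF : ∀ u ∈ U, ∀ v ∈ U, u / v ∈ L ↔ F u / F v ∈ L)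
    (h1 : F 1 ∈ L) {u₀ : G} (hu : u₀ ∈ U) (hu₀ : u₀ ∉ L) (hinv : u₀ * F u₀ ∈ L)
    {u : G} (huU : u ∈ U) : u * F u ∈ L := by
  have key : ∀ v ∈ U, v ∈ L ↔ F v ∈ L := by
    intro v hv
    have := hF v hv 1 U.one_mem
    rw [div_one] at this
    rw [this]
    exact Subgroup.mul_mem_cancel_right L (inv_mem h1) |>.trans (by rfl) |> fun h => by
      simpa [div_eq_mul_inv] using h
  rcases h3 u huU u₀ hu with h | h | h | h
  · exact mul_mem h ((key u huU).1 h)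
  · exact absurd h hu₀
  · have h' := (hF u₀ hu u huU).1 h
    have : u * F u = (u₀ * F u₀) / (u₀ / u) / (F u₀ / F u) := by
      simp only [div_eq_mul_inv, mul_inv, inv_inv]
      have e1 : u₀ * F u₀ * (u₀⁻¹ * u) * ((F u₀)⁻¹ * F u) =
        (u₀ * u₀⁻¹) * (F u₀ * (F u₀)⁻¹) * (u * F u) := by ac_rfl
      simp [e1]
    rw [this]
    exact div_mem (div_mem hinv h) h'
  · rcases h3 (F u) (hFU u huU) (F u₀) (hFU u₀ hu) with h' | h' | h' | h'
    · exact mul_mem ((key u huU).2 h') h'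
    · exact absurd ((key u₀ hu).2 h') hu₀
    · have h' := (hF u₀ hu u huU).2 h'
      have h4 := (hF u₀ hu u huU).1 h'
      have : u * F u = (u₀ * F u₀) / (u₀ / u) / (F u₀ / F u) := by
        simp only [div_eq_mul_inv, mul_inv, inv_inv]
        have e1 : u₀ * F u₀ * (u₀⁻¹ * u) * ((F u₀)⁻¹ * F u) =
          (u₀ * u₀⁻¹) * (F u₀ * (F u₀)⁻¹) * (u * F u) := by ac_rfl
        simp [e1]
      rw [this]
      exact div_mem (div_mem hinv h') h4
    · have : u * F u = (u₀ * u) * (F u₀ * F u) / (u₀ * F u₀) := by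
        rw [eq_div_iff_mul_eq']; ac_rfl
      rw [this]
      exact div_mem (mul_mem h h') hinv
end SRel

namespace SRel

variable {G : Type*} [CommGroup G] {A : SRel G}

/-- An automorphism of the quotient lifts to every coset of `U`. -/
lemma exists_local_lift [Finite G] {L U : Subgroup G} (hL : A.Sat L) (hU : A.Sat U) (hLU : L ≤ U)
    (h3 : ∀ u ∈ U, ∀ v ∈ U, u ∈ L ∨ v ∈ L ∨ v / u ∈ L ∨ v * u ∈ L)
    (hres : (A.res U hU).LocSchur) {φ : G ⧸ L → G ⧸ L}
    (hφ : (A.quo L hL).IsAut φ) {s h : G} (hsh : (h : G ⧸ L) = φ s) :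
    ∃ E : G → G, E s = h ∧ (∀ g, g / s ∈ U → (E g : G ⧸ L) = φ g) ∧
      ∀ g k, g / s ∈ U → k / s ∈ U → A.r (g / k) (E g / E k) := by
  by_cases hid : ∀ u ∈ U, φ (s * u : G) = (h * u : G)
  · refine ⟨fun g => h * (g / s), by simp, fun g hg => ?_, fun g k _ _ => ?_⟩
    · rw [← hid _ hg]; simp
    · simp only [mul_div_mul_left_eq_div, div_div_div_cancel_right]
      exact refl _
  push Not at hid
  obtain ⟨u₀, hu₀, hne⟩ := hid
  let F : G → G := fun u => Quotient.out (φ (s * u : G)) / h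
  have hF : ∀ u, ((F u : G) : G ⧸ L) = φ (s * u : G) / φ s := fun u => by
    simp only [F, QuotientGroup.mk_div, QuotientGroup.out_eq', hsh]
  have hFr : ∀ u v, (A.quo L hL).r ((u / v : G)) ((F u / F v : G)) := fun u v => by
    have := hφ (s * u : G) (s * v : G)
    rw [QuotientGroup.mk_div, QuotientGroup.mk_div, hF, hF]
    simpa using this
  have hFL : ∀ u v, u / v ∈ L ↔ F u / F v ∈ L := fun u v => by
    rw [← QuotientGroup.eq_one_iff, ← QuotientGroup.eq_one_iff]
    constructor
    · intro h'; exact (A.quo L hL).one _ (h' ▸ hFr u v)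
    · intro h'; exact eq_one (h' ▸ hFr u v)
  have hF1 : F 1 ∈ L := by rw [← QuotientGroup.eq_one_iff, hF]; simp
  have hFU : ∀ u ∈ U, F u ∈ U := by
    intro u hu
    have h1 := hFr u 1
    rw [quo_r] at h1
    obtain ⟨l, hl, h1⟩ := h1
    have h2 := hU _ _ h1 (by simpa using hu)
    have : F u = F u / F 1 * l * F 1 / l := by
      rw [mul_right_comm, div_mul_cancel, mul_div_cancel_right]
    rw [this]
    exact div_mem (mul_mem h2 (hLU hF1)) (hLU hl)
  have hu₀L : u₀ ∉ L := by
    intro h'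
    apply hne
    have : (u₀ : G ⧸ L) = 1 := (QuotientGroup.eq_one_iff _).2 h'
    rw [QuotientGroup.mk_mul, QuotientGroup.mk_mul, this, mul_one, mul_one, hsh]
  have hinv₀ : u₀ * F u₀ ∈ L := by
    rcases h3 _ hu₀ _ (hFU _ hu₀) with h' | h' | h' | h'
    · exact absurd h' hu₀L
    · have := (hFL u₀ 1).2 (div_mem h' hF1)
      exact absurd (by simpa using this) hu₀L
    · exfalso
      apply hne
      rw [← QuotientGroup.eq_one_iff, QuotientGroup.mk_div, hF, div_eq_one, div_eq_iff_eq_mul'] at h'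
      rw [h', QuotientGroup.mk_mul, hsh]
    · rwa [mul_comm] at h'
  have hFinv : ∀ u ∈ U, u * F u ∈ L := fun u hu =>
    mul_mem_of_inverts h3 hFU (fun u _ v _ => hFL u v) hF1 hu₀ hu₀L hinv₀ hu
  have hr := hFr u₀ 1
  rw [quo_r] at hr
  obtain ⟨l, hl, hr⟩ := hr
  rw [div_one] at hr
  obtain ⟨f, hf1, hfu, hf⟩ := hres ⟨u₀, hu₀⟩ ⟨_, hU _ _ hr hu₀⟩ hr
  classical
  let f' : G → G := fun u => if hu : u ∈ U then f ⟨u, hu⟩ else 1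
  have hf' : ∀ u ∈ U, ∀ v ∈ U, A.r (u / v) (f' u / f' v) := by
    intro u hu v hv
    simp only [f', hu, hv, dif_pos]
    exact hf ⟨u, hu⟩ ⟨v, hv⟩
  have hf'1 : f' 1 = 1 := by
    simp only [f', U.one_mem, dif_pos]
    exact congrArg Subtype.val hf1
  have hf'u : f' u₀ = F u₀ / F 1 * l := by
    simp only [f', hu₀, dif_pos]
    rw [hfu]
  have hfinv : ∀ u ∈ U, u * f' u ∈ L := by
    intro u hu
    refine mul_mem_of_inverts h3 (F := f') ?_ (fun u hu v hv => hL.iff (hf' u hu v hv)) ?_ hu₀ hu₀L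
      ?_ hu
    · intro u hu
      simp only [f', hu, dif_pos, SetLike.coe_mem]
    · rw [hf'1]; exact L.one_mem
    · rw [hf'u, ← mul_assoc, ← mul_div_assoc]
      exact mul_mem (div_mem hinv₀ hF1) hl
  refine ⟨fun g => h * f' (g / s), by simp [hf'1], fun g hg => ?_, fun g k hg hk => ?_⟩
  · have h1 : ((f' (g / s) : G) : G ⧸ L) = ((F (g / s) : G) : G ⧸ L) := by
      have e1 := (QuotientGroup.eq_one_iff _).2 (hfinv _ hg)
      have e2 := (QuotientGroup.eq_one_iff _).2 (hFinv _ hg)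
      rw [QuotientGroup.mk_mul] at e1 e2
      exact mul_left_cancel (e1.trans e2.symm)
    rw [QuotientGroup.mk_mul, h1, hF, hsh]
    simp
  · have := hf' _ hg _ hk
    rw [div_div_div_cancel_right] at this
    simpa using this

lemma exists_glue [Finite G] {L U : Subgroup G} (hL : A.Sat L) (hU : A.Sat U) (hLU : L ≤ U)
    (hrad : ∀ x, x ∉ U → ∀ l ∈ L, A.r x (x * l))
    (h3 : ∀ u ∈ U, ∀ v ∈ U, u ∈ L ∨ v ∈ L ∨ v / u ∈ L ∨ v * u ∈ L)
    (hres : (A.res U hU).LocSchur) {φ : G ⧸ L → G ⧸ L}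
    (hφ : (A.quo L hL).IsAut φ) {E₀ : G → G} (hE₀ : ∀ g ∈ U, (E₀ g : G ⧸ L) = φ g)
    (hE₀' : ∀ g ∈ U, ∀ k ∈ U, A.r (g / k) (E₀ g / E₀ k)) {x y : G} (hxy : (y : G ⧸ L) = φ x) :
    ∃ f, A.IsAut f ∧ (∀ g ∈ U, f g = E₀ g) ∧ (x ∉ U → f x = y) := by
  classical
  let s : G ⧸ U → G := fun q => if q = x then x else q.out
  let h : G ⧸ U → G := fun q => if q = x then y else (φ (s q)).out
  have hs : ∀ q, (s q : G ⧸ U) = q := by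
    intro q
    by_cases hq : q = x
    · simp [s, hq]
    · simp [s, hq]
  have hsh : ∀ q, (h q : G ⧸ L) = φ (s q) := by
    intro q
    by_cases hq : q = x
    · simp [s, h, hq, hxy]
    · simp [h, hq]
  choose E hEs hE hE' using fun q => exists_local_lift hL hU hLU h3 hres hφ (hsh q)
  have hgs : ∀ g : G, g / s g ∈ U := by
    intro g
    rw [← QuotientGroup.eq_one_iff, QuotientGroup.mk_div, hs, div_self']
  let f : G → G := fun g => if g ∈ U then E₀ g else E g g
  have hfφ : ∀ g, (f g : G ⧸ L) = φ g := by
    intro g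
    by_cases hg : g ∈ U
    · simp only [f, if_pos hg]; exact hE₀ g hg
    · simp only [f, if_neg hg]; exact hE _ _ (hgs g)
  refine ⟨f, fun g k => ?_, fun g hg => by simp [f, hg], fun hx => ?_⟩
  · by_cases hgk : g / k ∈ U
    · by_cases hg : g ∈ U
      · have hk : k ∈ U := ((Subgroup.div_mem_comm_iff U).1 hgk : k / g ∈ U) |> fun h => by
          simpa using mul_mem h hg
        simp only [f, if_pos hg, if_pos hk]
        exact hE₀' g hg k hk
      · have hk : k ∉ U := fun hk => hg (by simpa using mul_mem hgk hk)
        simp only [f, if_neg hg, if_neg hk]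
        have : (k : G ⧸ U) = g := by
          rw [← div_eq_one, ← QuotientGroup.mk_div, QuotientGroup.eq_one_iff]
          exact (Subgroup.div_mem_comm_iff U).1 hgk
        rw [this]
        exact hE' _ _ _ (hgs g) (this ▸ hgs k)
    · have h1 := hφ g k
      rw [← hfφ, ← hfφ, ← QuotientGroup.mk_div, ← QuotientGroup.mk_div, quo_r] at h1
      obtain ⟨l, hl, h1⟩ := h1
      refine trans h1 (symm (hrad _ (fun h' => hgk ?_) l hl))
      exact hU _ _ (symm h1) (mul_mem h' (hLU hl))
  · simp only [f, if_neg hx]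
    have := hEs (x : G ⧸ U)
    simpa [s, h] using this

/-- Gluing automorphisms of a generalised wreath product with a section of order at most three. -/
theorem locSchur_of_wreath [Finite G] (L U : Subgroup G) (hL : A.Sat L) (hU : A.Sat U)
    (hLU : L ≤ U) (hrad : ∀ x, x ∉ U → ∀ l ∈ L, A.r x (x * l))
    (h3 : ∀ u ∈ U, ∀ v ∈ U, u ∈ L ∨ v ∈ L ∨ v / u ∈ L ∨ v * u ∈ L)
    (hres : (A.res U hU).LocSchur) (hquo : (A.quo L hL).LocSchur) : A.LocSchur := by
  intro x y hxy
  by_cases hx : x ∈ U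
  · obtain ⟨f, hf1, hfx, hf⟩ := hres ⟨x, hx⟩ ⟨y, hU _ _ hxy hx⟩ hxy
    classical
    let f' : G → G := fun u => if hu : u ∈ U then f ⟨u, hu⟩ else 1
    have hf' : ∀ u ∈ U, ∀ v ∈ U, A.r (u / v) (f' u / f' v) := by
      intro u hu v hv
      simp only [f', hu, hv, dif_pos]
      exact hf ⟨u, hu⟩ ⟨v, hv⟩
    have hf'U : ∀ u ∈ U, f' u ∈ U := fun u hu => by simp [f', hu]
    have hf'1 : f' 1 = 1 := by
      simp only [f', U.one_mem, dif_pos]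
      exact congrArg Subtype.val hf1
    have hf'x : f' x = y := by simp [f', hx, hfx]
    have hφ : ∃ φ : G ⧸ L → G ⧸ L, (A.quo L hL).IsAut φ ∧ φ 1 = 1 ∧
        ∀ u ∈ U, (f' u : G ⧸ L) = φ u := by
      by_cases hid : ∀ u ∈ U, (f' u : G ⧸ L) = u
      · exact ⟨id, fun g h => refl _, rfl, hid⟩
      push Not at hid
      obtain ⟨u₀, hu₀, hne⟩ := hid
      have hu₀L : u₀ ∉ L := fun h => by
        have h1 := (hL.iff (hf' u₀ hu₀ 1 U.one_mem)).1 (by simpa using h)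
        rw [hf'1, div_one] at h1
        exact hne (((QuotientGroup.eq_one_iff _).2 h1).trans ((QuotientGroup.eq_one_iff _).2 h).symm)
      have hinv₀ : u₀ * f' u₀ ∈ L := by
        rcases h3 u₀ hu₀ _ (hf'U _ hu₀) with h | h | h | h
        · exact absurd h hu₀L
        · have h1 := (hL.iff (hf' u₀ hu₀ 1 U.one_mem)).2 (by simpa [hf'1] using h)
          exact absurd (by simpa using h1) hu₀L
        · rw [← QuotientGroup.eq_one_iff, QuotientGroup.mk_div, div_eq_one] at h
          exact absurd h hne
        · rwa [mul_comm]
      have hfinv : ∀ u ∈ U, u * f' u ∈ L := fun u hu =>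
        mul_mem_of_inverts h3 hf'U (fun u hu v hv => hL.iff (hf' u hu v hv))
          (by rw [hf'1]; exact L.one_mem) hu₀ hu₀L hinv₀ hu
      have hr : (A.quo L hL).r (u₀ : G) (f' u₀ : G) := by
        rw [quo_r]
        have := hf' u₀ hu₀ 1 U.one_mem
        rw [hf'1, div_one, div_one] at this
        exact ⟨1, L.one_mem, by simpa using this⟩
      obtain ⟨φ, hφ1, hφu, hφ⟩ := hquo _ _ hr
      refine ⟨φ, hφ, hφ1, fun u hu => ?_⟩
      have hΦ : ∀ u v : G, u / v ∈ L ↔ (φ u).out / (φ v).out ∈ L := by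
        intro u v
        have h := hφ u v
        rw [← QuotientGroup.eq_one_iff, ← QuotientGroup.eq_one_iff, QuotientGroup.mk_div,
          QuotientGroup.mk_div, QuotientGroup.out_eq', QuotientGroup.out_eq', div_eq_one, div_eq_one]
        exact ⟨fun h => by rw [h], fun h => IsAut.inj hφ h⟩
      have hΦinv := mul_mem_of_inverts h3 (F := fun u => (φ (u : G)).out) (fun u hu => by
          have h := hφ u 1
          rw [hφ1, div_one, div_one, ← QuotientGroup.out_eq' (φ u), quo_r] at h
          obtain ⟨l, hl, h⟩ := h
          have := hU _ _ h hu
          simpa using div_mem this (hLU hl)) (fun u _ v _ => hΦ u v)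
        (by
          rw [← QuotientGroup.eq_one_iff, QuotientGroup.out_eq']
          exact hφ1) hu₀ hu₀L
        (by
          rw [← QuotientGroup.eq_one_iff, QuotientGroup.mk_mul, QuotientGroup.out_eq', hφu,
            ← QuotientGroup.mk_mul, QuotientGroup.eq_one_iff]
          exact hinv₀) hu
      have e1 := (QuotientGroup.eq_one_iff _).2 (hfinv _ hu)
      have e2 := (QuotientGroup.eq_one_iff _).2 hΦinv
      rw [QuotientGroup.mk_mul] at e1 e2
      rw [QuotientGroup.out_eq'] at e2
      exact mul_left_cancel (e1.trans e2.symm)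
    obtain ⟨φ, hφ, hφ1, hφf⟩ := hφ
    obtain ⟨f₁, hf₁, hfU, -⟩ := exists_glue hL hU hLU hrad h3 hres hφ hφf hf' (x := x) (y := y)
      (by rw [← hφf x hx, hf'x])
    exact ⟨f₁, by rw [hfU 1 U.one_mem, hf'1], by rw [hfU x hx, hf'x], hf₁⟩
  · have hr : (A.quo L hL).r (x : G) (y : G) := by
      rw [quo_r]
      exact ⟨1, L.one_mem, by simpa using hxy⟩
    obtain ⟨φ, hφ1, hφx, hφ⟩ := hquo _ _ hr
    obtain ⟨E₀, hE1, hE, hE'⟩ := exists_local_lift (s := 1) (h := 1) hL hU hLU h3 hres hφ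
      (by simpa using hφ1.symm)
    obtain ⟨f, hf, hfU, hfx⟩ := exists_glue (E₀ := E₀) hL hU hLU hrad h3 hres hφ
      (fun g hg => hE g (by simpa using hg)) (fun g hg k hk => hE' g k (by simpa using hg)
      (by simpa using hk)) hφx.symm
    exact ⟨f, by rw [hfU 1 U.one_mem, hE1], hfx hx, hf⟩

/-- A Schur ring all of whose non-identity elements lie in one basic set. -/
lemma locSchur_of_trivial (h : ∀ x y : G, x ≠ 1 → y ≠ 1 → A.r x y) : A.LocSchur := by
  classical
  intro x y hxy
  by_cases hx : x = 1
  · exact ⟨id, rfl, by subst hx; exact (A.one _ hxy).symm, fun g h => refl _⟩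
  have hy : y ≠ 1 := fun hy => hx (by subst hy; exact eq_one hxy)
  refine ⟨Equiv.swap x y, Equiv.swap_apply_of_ne_of_ne (Ne.symm hx) (Ne.symm hy), by simp,
    fun g k => ?_⟩
  by_cases hgk : g = k
  · subst hgk; simpa using refl _
  · exact h _ _ (by rwa [Ne, div_eq_one]) (by rwa [Ne, div_eq_one, EmbeddingLike.apply_eq_iff_eq])

end SRel

namespace SRel

variable {G : Type*} [CommGroup G] {A : SRel G}

lemma pow_prime_rel [Finite G] {q : ℕ} (hq : q.Prime) (hc : (Nat.card G).Coprime q) {x y : G}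
    (h : A.r x y) : A.r (x ^ q) (y ^ q) := by
  classical
  have := Fintype.ofFinite G
  have : Fact q.Prime := ⟨hq⟩
  have hinj : Function.Injective fun g : G => g ^ q := (powCoprime hc).injective
  have key : ∀ a b : G, A.r (a ^ q) (b ^ q) → A.r a b := by
    intro a b hab
    have h1 := (isClassFn_indicator (R := ZMod q) (sat_class (A := A) a)).frobenius _ _ hab
    have h2 : ∀ c z : G, (if z ^ q = c ^ q then
        ({x | A.r a x} : Set G).indicator (1 : G → ZMod q) z else 0) =
        if z = c then ({x | A.r a x} : Set G).indicator (1 : G → ZMod q) z else 0 := by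
      intro c z
      have : z ^ q = c ^ q ↔ z = c := hinj.eq_iff
      simp [this]
    simp only [h2, Finset.sum_ite_eq', Finset.mem_univ, if_true] at h1
    by_contra hn
    simp [refl, hn] at h1
  let S := {z : G × G // A.r z.1 z.2}
  let e : G ≃ G := powCoprime hc
  have he : ∀ g, (e.symm g) ^ q = g := fun g => e.apply_symm_apply g
  let F : S → S := fun z => ⟨(e.symm z.1.1, e.symm z.1.2), key _ _ (by
    rw [he, he]; exact z.2)⟩
  have hF : Function.Injective F := by
    rintro ⟨⟨a, b⟩, h⟩ ⟨⟨c, d⟩, h'⟩ heq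
    have heq := Prod.ext_iff.1 (congrArg Subtype.val heq)
    exact Subtype.ext (Prod.ext (e.symm.injective heq.1) (e.symm.injective heq.2))
  obtain ⟨⟨⟨a, b⟩, hab⟩, hz⟩ := (Finite.injective_iff_surjective.1 hF) ⟨(x, y), h⟩
  have hz := Prod.ext_iff.1 (congrArg Subtype.val hz)
  have hz1 : e.symm a = x := hz.1
  have hz2 : e.symm b = y := hz.2
  rw [← hz1, ← hz2, he, he]
  exact hab

/-- Schur's theorem on multipliers. -/
lemma pow_rel [Finite G] {m : ℕ} (hc : (Nat.card G).Coprime m) {x y : G}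
    (h : A.r x y) : A.r (x ^ m) (y ^ m) := by
  induction m using Nat.recOnMul generalizing x y with
  | zero => simpa using refl _
  | one => simpa using h
  | prime q hq => exact pow_prime_rel hq hc h
  | mul a b ha hb =>
    rw [pow_mul, pow_mul]
    exact hb (Nat.Coprime.coprime_mul_left_right hc) (ha (Nat.Coprime.coprime_mul_right_right hc) h)

/-- The stabiliser of a set under translations. -/
def radical (S : Set G) : Subgroup G where
  carrier := {g | ∀ x, x * g ∈ S ↔ x ∈ S}
  one_mem' := by simp
  mul_mem' {a b} ha hb x := by rw [← mul_assoc, hb, ha]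
  inv_mem' {a} ha x := by simpa using (ha (x * a⁻¹)).symm

lemma mem_radical {S : Set G} {g : G} : g ∈ radical S ↔ ∀ x, x * g ∈ S ↔ x ∈ S := Iff.rfl

lemma mem_radical_of_forall [Finite G] {S : Set G} {g : G} (h : ∀ x ∈ S, x * g ∈ S) :
    g ∈ radical S := by
  have h1 : (· * g) '' S = S := Set.eq_of_subset_of_ncard_le (by rintro _ ⟨x, hx, rfl⟩; exact h x hx)
    (by rw [Set.ncard_image_of_injective _ (mul_left_injective g)]) S.toFinite
  intro x
  refine ⟨fun hx => ?_, h x⟩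
  rw [← h1] at hx
  obtain ⟨y, hy, hyx⟩ := hx
  exact mul_right_cancel hyx ▸ hy

lemma Sat.radical [Finite G] {S : Set G} (hS : A.Sat S) : A.Sat (radical S) := by
  have key : ∀ x, x ∈ SRel.radical S ↔ Nat.card {g // g ∈ S ∧ x / g ∈ S⁻¹} = S.ncard := by
    intro x
    have h1 : Nat.card {g // g ∈ S ∧ x / g ∈ S⁻¹} = (S ∩ (· * x) '' S).ncard := by
      rw [← Nat.card_coe_set_eq]
      congr 1
      simp [div_eq_mul_inv]
      rfl
    rw [h1]
    constructor
    · intro hx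
      congr 1
      rw [Set.inter_eq_left]
      intro s hs
      exact ⟨s * x⁻¹, ((inv_mem hx : x⁻¹ ∈ SRel.radical S) s).2 hs, by simp⟩
    · intro h
      have h2 : S ∩ (· * x) '' S = S :=
        Set.eq_of_subset_of_ncard_le Set.inter_subset_left h.ge S.toFinite
      have : x⁻¹ ∈ SRel.radical S := mem_radical_of_forall fun s hs => by
        obtain ⟨t, ht, rfl⟩ := (Set.inter_eq_left.1 h2) hs
        simpa using ht
      simpa using inv_mem this
  intro x y h hx
  rw [SetLike.mem_coe, key] at hx ⊢
  rw [← hx]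
  exact (hS.count hS.inv h).symm

lemma sat_sup [Finite G] {H K : Subgroup G} (hH : A.Sat H) (hK : A.Sat K) :
    A.Sat (H ⊔ K : Subgroup G) := by
  rw [Subgroup.mul_normal]
  exact hH.mul hK

lemma sat_sInf {s : Set (Subgroup G)} (h : ∀ H ∈ s, A.Sat (H : Set G)) :
    A.Sat (sInf s : Subgroup G) := by
  intro x y hxy hx
  rw [SetLike.mem_coe, Subgroup.mem_sInf] at hx ⊢
  exact fun H hH => h H hH x y hxy (hx H hH)

lemma div_or_mul_mem_of_relIndex_le_three [Finite G] {L U : Subgroup G}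
    (h : L.relIndex U ≤ 3) :
    ∀ u ∈ U, ∀ v ∈ U, u ∈ L ∨ v ∈ L ∨ v / u ∈ L ∨ v * u ∈ L := by
  intro u hu v hv
  by_contra! hn
  obtain ⟨h1, h2, h3, h4⟩ := hn
  let c : Fin 4 → U := ![1, ⟨u, hu⟩, ⟨v, hv⟩, ⟨u, hu⟩ * ⟨v, hv⟩]
  have hf : Function.Injective fun i => (c i : U ⧸ L.subgroupOf U) := by
    intro i j hij
    have e1 : (c j / c i : G) ∈ L := by
      have := QuotientGroup.eq.1 hij
      rwa [Subgroup.mem_subgroupOf, inv_mul_eq_div] at this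
    have h3' : u / v ∉ L := fun h => h3 (L.div_mem_comm_iff.1 h)
    have h4' : u * v ∉ L := fun h => h4 (mul_comm u v ▸ h)
    have h4'' : v⁻¹ * u⁻¹ ∉ L := fun h => h4' (by simpa using inv_mem h)
    by_contra hne
    fin_cases i <;> fin_cases j <;>
      simp [c, h1, h2, h3, h3', h4', h4''] at e1 hne
  have := Nat.card_le_card_of_injective _ hf
  rw [Nat.card_fin] at this
  have h5 : Nat.card (U ⧸ L.subgroupOf U) = L.relIndex U := rfl
  omega

end SRel

/-- `G` is the direct product of an elementary abelian `3`-group `H` of order at most `9` and a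
group `P` of prime order `p ≠ 3`. -/
structure IsSplit {G : Type*} [CommGroup G] (H P : Subgroup G) (p : ℕ) : Prop where
  prime : p.Prime
  ne_three : p ≠ 3
  card_P : Nat.card P = p
  pow_H : ∀ h ∈ H, h ^ 3 = 1
  card_H : Nat.card H ∣ 9
  exists_mul : ∀ g, ∃ h ∈ H, ∃ q ∈ P, h * q = g

namespace IsSplit

variable {G : Type*} [CommGroup G] {H P : Subgroup G} {p : ℕ}

lemma pow_P (hs : IsSplit H P p) {q : G} (hq : q ∈ P) : q ^ p = 1 := by
  have : (⟨q, hq⟩ : P) ^ p = 1 := by rw [← hs.card_P]; exact pow_card_eq_one'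
  exact congrArg Subtype.val this

lemma coprime (hs : IsSplit H P p) : Nat.Coprime 3 p :=
  (Nat.coprime_primes Nat.prime_three hs.prime).2 hs.ne_three.symm

lemma eq_one (hs : IsSplit H P p) {g : G} (h : g ∈ H) (h' : g ∈ P) : g = 1 := by
  have := pow_gcd_eq_one.2 ⟨hs.pow_H g h, hs.pow_P h'⟩
  rwa [hs.coprime, pow_one] at this

lemma ext (hs : IsSplit H P p) {a b q r : G} (ha : a ∈ H) (hb : b ∈ H) (hq : q ∈ P) (hr : r ∈ P)
    (h : a * q = b * r) : a = b ∧ q = r := by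
  have h1 : a / b = r / q := by rw [div_eq_div_iff_mul_eq_mul, h, mul_comm]
  have h2 := hs.eq_one (div_mem ha hb) (h1 ▸ div_mem hr hq)
  rw [h2] at h1
  exact ⟨div_eq_one.1 h2, (div_eq_one.1 h1.symm).symm⟩

lemma mul_mem_H (hs : IsSplit H P p) {a q : G} (ha : a ∈ H) (hq : q ∈ P) : a * q ∈ H ↔ q = 1 := by
  refine ⟨fun h => hs.eq_one ?_ hq, fun h => by simpa [h] using ha⟩
  simpa using mul_mem (inv_mem ha) h

/-- The product decomposition as an equivalence. -/
noncomputable def equiv (hs : IsSplit H P p) : H × P ≃ G :=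
  Equiv.ofBijective (fun x => (x.1 * x.2 : G)) ⟨by
    rintro ⟨a, q⟩ ⟨b, r⟩ h
    have := hs.ext a.2 b.2 q.2 r.2 h
    exact Prod.ext (Subtype.ext this.1) (Subtype.ext this.2), by
    intro g
    obtain ⟨h, hh, q, hq, rfl⟩ := hs.exists_mul g
    exact ⟨(⟨h, hh⟩, ⟨q, hq⟩), rfl⟩⟩

lemma sum_eq [Fintype G] [Fintype H] [Fintype P] (hs : IsSplit H P p) {R : Type*}
    [AddCommMonoid R] (F : G → R) : ∑ g, F g = ∑ a : H, ∑ q : P, F (a * q) := by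
  rw [← Fintype.sum_prod_type', ← Equiv.sum_comp hs.equiv]
  rfl

lemma card_eq (hs : IsSplit H P p) : Nat.card G = Nat.card H * p := by
  rw [← Nat.card_congr hs.equiv, Nat.card_prod, hs.card_P]

lemma coprime_card (hs : IsSplit H P p) {m : ℕ} (h3 : Nat.Coprime 3 m) (hp : Nat.Coprime p m) :
    (Nat.card G).Coprime m := by
  rw [hs.card_eq]
  refine Nat.Coprime.mul_left (Nat.Coprime.coprime_dvd_left hs.card_H ?_) hp
  exact (Nat.Coprime.pow_left 2 h3 : Nat.Coprime (3 ^ 2) m)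

lemma exists_multiplier (hs : IsSplit H P p) {i k : ℕ} (hi : Nat.Coprime 3 i)
    (hk : Nat.Coprime p k) : ∃ m, (Nat.card G).Coprime m ∧ (∀ h ∈ H, h ^ m = h ^ i) ∧
      ∀ q ∈ P, q ^ m = q ^ k := by
  obtain ⟨m, h1, h2⟩ := Nat.chineseRemainder hs.coprime i k
  refine ⟨m, hs.coprime_card ?_ ?_, fun h hh => ?_, fun q hq => ?_⟩
  · rw [Nat.coprime_comm, Nat.Coprime, h1.gcd_eq]; exact hi.symm
  · rw [Nat.coprime_comm, Nat.Coprime, h2.gcd_eq]; exact hk.symm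
  · exact pow_eq_pow_iff_modEq.2 (h1.of_dvd (orderOf_dvd_of_pow_eq_one (hs.pow_H h hh)))
  · exact pow_eq_pow_iff_modEq.2 (h2.of_dvd (orderOf_dvd_of_pow_eq_one (hs.pow_P hq)))

lemma exists_pow (hs : IsSplit H P p) {q r : G} (hq : q ∈ P) (hr : r ∈ P) (hq1 : q ≠ 1)
    (hr1 : r ≠ 1) : ∃ k, Nat.Coprime p k ∧ q ^ k = r := by
  have : Fact p.Prime := ⟨hs.prime⟩
  have h1 : (⟨r, hr⟩ : P) ∈ Submonoid.powers (⟨q, hq⟩ : P) :=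
    mem_powers_of_prime_card hs.card_P (fun h => hq1 (congrArg Subtype.val h))
  obtain ⟨k, hk⟩ := h1
  have hk : q ^ k = r := congrArg Subtype.val hk
  refine ⟨k, (Nat.Prime.coprime_iff_not_dvd hs.prime).2 fun h => hr1 ?_, hk⟩
  obtain ⟨j, rfl⟩ := h
  rw [← hk, pow_mul, hs.pow_P hq, one_pow]

lemma pow_ne_one (hs : IsSplit H P p) {q : G} {k : ℕ} (hk : Nat.Coprime p k) (hq : q ∈ P)
    (hq1 : q ≠ 1) : q ^ k ≠ 1 := fun h => hq1 (by
  have := pow_gcd_eq_one.2 ⟨hs.pow_P hq, h⟩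
  rwa [hk, pow_one] at this)

variable [Finite G] {A : SRel G}

lemma pow_rel (hs : IsSplit H P p) {k : ℕ} (hk : Nat.Coprime p k) {a b q r : G} (ha : a ∈ H)
    (hb : b ∈ H) (hq : q ∈ P) (hr : r ∈ P) (h : A.r (a * q) (b * r)) :
    A.r (a * q ^ k) (b * r ^ k) := by
  obtain ⟨m, hm, h1, h2⟩ := hs.exists_multiplier (i := 1) (by simp) hk
  have := SRel.pow_rel hm h
  simpa only [mul_pow, h1 a ha, h1 b hb, h2 q hq, h2 r hr, pow_one] using this

lemma inv_rel (hs : IsSplit H P p) {a b q r : G} (ha : a ∈ H)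
    (hb : b ∈ H) (hq : q ∈ P) (hr : r ∈ P) (h : A.r (a * q) (b * r)) :
    A.r (a⁻¹ * q) (b⁻¹ * r) := by
  obtain ⟨m, hm, h1, h2⟩ := hs.exists_multiplier (i := 2) (k := 1) (by norm_num) (by simp)
  have := SRel.pow_rel hm h
  have h3 : ∀ h ∈ H, h ^ 2 = h⁻¹ := fun h hh => by
    rw [eq_inv_iff_mul_eq_one, ← pow_succ, hs.pow_H h hh]
  simpa only [mul_pow, h1 a ha, h1 b hb, h2 q hq, h2 r hr, pow_one, h3 a ha, h3 b hb] using this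

omit [Finite G] in
lemma pow_p (hs : IsSplit H P p) : (∀ a ∈ H, a ^ p = a) ∨ ∀ a ∈ H, a ^ p = a⁻¹ := by
  have h3 : p % 3 = 1 ∨ p % 3 = 2 := by
    have : ¬ 3 ∣ p := (Nat.Prime.coprime_iff_not_dvd Nat.prime_three).1 hs.coprime
    omega
  have hpow : ∀ a ∈ H, a ^ p = a ^ (p % 3) := fun a ha => by
    conv_lhs => rw [← Nat.mod_add_div p 3, pow_add, pow_mul, hs.pow_H a ha, one_pow, mul_one]
  refine h3.imp (fun h3 a ha => ?_) (fun h3 a ha => ?_)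
  · rw [hpow a ha, h3, pow_one]
  · rw [hpow a ha, h3, eq_inv_iff_mul_eq_one, ← pow_succ, hs.pow_H a ha]

omit [Finite G] in
lemma pow_p_mem_H (hs : IsSplit H P p) (z : G) : z ^ p ∈ H := by
  obtain ⟨h, hh, q, hq, rfl⟩ := hs.exists_mul z
  rw [mul_pow, hs.pow_P hq, mul_one]
  exact pow_mem hh _

omit [Finite G] in
lemma sum_frobenius [Fintype G] [DecidableEq G] [Fintype P] (hs : IsSplit H P p) {R : Type*}
    [AddCommMonoid R] (u : G → R) {a : G} (ha : a ∈ H) :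
    (∑ z, if z ^ p = a ^ p then u z else 0) = ∑ r : P, u (a * r) := by
  have hiff : ∀ z, z ^ p = a ^ p ↔ ∃ r : P, a * r = z := by
    intro z
    constructor
    · intro h
      obtain ⟨b, hb, q, hq, rfl⟩ := hs.exists_mul z
      have h2 : (b / a) ^ p = 1 := by
        rw [div_pow, ← h, mul_pow, hs.pow_P hq, mul_one, div_self']
      have h4 := pow_gcd_eq_one.2 ⟨hs.pow_H _ (div_mem hb ha), h2⟩
      rw [hs.coprime, pow_one, div_eq_one] at h4
      exact ⟨⟨q, hq⟩, by rw [h4]⟩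
    · rintro ⟨r, rfl⟩
      rw [mul_pow, hs.pow_P r.2, mul_one]
  rw [← Finset.sum_filter]
  have : Finset.univ.filter (fun z : G => z ^ p = a ^ p) =
      Finset.univ.map ⟨fun r : P => a * r, fun r s h => Subtype.ext (mul_left_cancel h)⟩ := by
    ext z
    simp only [Finset.mem_filter, Finset.mem_univ, true_and, hiff, Finset.mem_map]
    rfl
  rw [this, Finset.sum_map]
  rfl

lemma sum_P_eq [Fintype P] (hs : IsSplit H P p) {u : G → ZMod p} (hu : A.IsClassFn u) {a b : G}
    (ha : a ∈ H) (hb : b ∈ H) (hab : A.r a b) : ∑ r : P, u (a * r) = ∑ r : P, u (b * r) := by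
  classical
  have := Fintype.ofFinite G
  have : Fact p.Prime := ⟨hs.prime⟩
  rw [← hs.sum_frobenius u ha, ← hs.sum_frobenius u hb]
  refine hu.frobenius _ _ ?_
  rcases hs.pow_p with h3 | h3
  · rwa [h3 a ha, h3 b hb]
  · rw [h3 a ha, h3 b hb]
    exact A.inv a b hab

/-- A basic set of an element of `H` which leaves `H` is invariant under `P` at that element. -/
lemma rel_mul_of_not_subset (hs : IsSplit H P p) {a x : G} (ha : a ∈ H) (hax : A.r a x)
    (hx : x ∉ H) {q : G} (hq : q ∈ P) : A.r a (a * q) := by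
  classical
  have := Fintype.ofFinite G
  have : Fact p.Prime := ⟨hs.prime⟩
  let u : G → ZMod p := ({x | A.r a x} : Set G).indicator 1
  have hfr : A.IsClassFn (fun y => ∑ z, if z ^ p = y then u z else 0) :=
    (SRel.isClassFn_indicator (SRel.sat_class a)).frobenius
  have hzero : (∑ z, if z ^ p = a ^ p then u z else 0) = 0 := by
    have h0 : ∀ y, y ∉ H → (∑ z, if z ^ p = y then u z else 0) = 0 := fun y hy =>
      Finset.sum_eq_zero fun z _ => if_neg fun h : z ^ p = y => hy (h ▸ hs.pow_p_mem_H z)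
    rcases hs.pow_p with h3 | h3
    · rw [h3 a ha]; exact (hfr a x hax).trans (h0 x hx)
    · rw [h3 a ha]
      exact (hfr _ _ (A.inv a x hax)).trans (h0 _ fun h => hx (by simpa using inv_mem h))
  have hcount : (∑ z, if z ^ p = a ^ p then u z else 0) =
      ((Finset.univ.filter fun r : P => A.r a (a * r)).card : ZMod p) := by
    rw [hs.sum_frobenius u ha, Finset.card_filter, Nat.cast_sum]
    refine Finset.sum_congr rfl fun r _ => ?_
    simp only [u, Set.indicator_apply, Set.mem_ofPred_eq, Pi.one_apply, Nat.cast_ite,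
      Nat.cast_one, Nat.cast_zero]
  rw [hzero] at hcount
  have hdvd := (ZMod.natCast_eq_zero_iff _ _).1 hcount.symm
  have hle : (Finset.univ.filter fun r : P => A.r a (a * r)).card ≤ p := by
    refine (Finset.card_le_univ _).trans ?_
    rw [← Nat.card_eq_fintype_card, hs.card_P]
  have hpos : 0 < (Finset.univ.filter fun r : P => A.r a (a * r)).card :=
    Finset.card_pos.2 ⟨1, by simp [SRel.refl]⟩
  have heq := le_antisymm hle (Nat.le_of_dvd hpos hdvd)
  have huniv := Finset.eq_univ_of_card _ (heq.trans (by
    rw [← Nat.card_eq_fintype_card, hs.card_P]))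
  have := Finset.mem_univ (⟨q, hq⟩ : P)
  rw [← huniv] at this
  simpa using this

end IsSplit

namespace SRel
variable {G : Type*} [CommGroup G]

/-- The largest saturated subset of a subgroup. -/
def satCore [Finite G] (A : SRel G) (H : Subgroup G) : Subgroup G where
  carrier := {a | ∀ y, A.r a y → y ∈ H}
  one_mem' y h := by rw [A.one y h]; exact H.one_mem
  inv_mem' {a} ha y h := by
    have := ha y⁻¹ (by simpa using A.inv _ _ h)
    simpa using inv_mem this
  mul_mem' {a b} ha hb y h := by
    obtain ⟨s, hs, t, ht, rfl⟩ := (sat_class (A := A) a).mul (sat_class (A := A) b) _ _ h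
      ⟨a, refl a, b, refl b, rfl⟩
    exact mul_mem (ha s hs) (hb t ht)

/-- The smallest saturated subgroup containing a given one. -/
def satHull (A : SRel G) (P : Subgroup G) : Subgroup G :=
  sInf {K | P ≤ K ∧ A.Sat (K : Set G)}

variable {A : SRel G}

lemma sat_satHull (P : Subgroup G) : A.Sat (A.satHull P) := sat_sInf fun _ hK => hK.2

lemma le_satHull (P : Subgroup G) : P ≤ A.satHull P := le_sInf fun _ hK => hK.1

lemma satHull_le {P K : Subgroup G} (h : P ≤ K) (hK : A.Sat K) : A.satHull P ≤ K :=
  sInf_le ⟨h, hK⟩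

variable [Finite G]

lemma sat_satCore (H : Subgroup G) : A.Sat (A.satCore H) :=
  fun _ _ h hx z hz => hx z (trans h hz)

lemma satCore_le (H : Subgroup G) : A.satCore H ≤ H := fun a ha => ha a (refl a)

/-- If `P` stabilises the basic set of `x`, so does the saturated hull of `P`. -/
lemma rel_mul_of_mem_satHull {P : Subgroup G} {x : G}
    (h : ∀ y, A.r x y → ∀ q ∈ P, A.r x (y * q)) {q : G} (hq : q ∈ A.satHull P) :
    A.r x (x * q) := by
  have h1 : A.satHull P ≤ radical {y | A.r x y} := by
    refine satHull_le (fun q hq => mem_radical_of_forall fun y hy => h y hy q hq) ?_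
    exact (sat_class x).radical
  exact ((mem_radical.1 (h1 hq)) x).2 (refl x)

end SRel

namespace IsSplit
open SRel
variable {G : Type*} [CommGroup G] {H P : Subgroup G} {p : ℕ} [Finite G] {A : SRel G}

omit [Finite G] in
lemma index_dvd (hs : IsSplit H P p) {K : Subgroup G} (hK : P ≤ K) : K.index ∣ 9 := by
  refine (Subgroup.index_dvd_of_le hK).trans ?_
  have h1 := P.card_mul_index
  rw [hs.card_P, hs.card_eq, mul_comm] at h1
  rw [Nat.eq_of_mul_eq_mul_right hs.prime.pos h1]
  exact hs.card_H

omit [Finite G] in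
lemma ne_bot (hs : IsSplit H P p) {K : Subgroup G} (hK : P ≤ K) : K ≠ ⊥ := by
  rintro rfl
  have := hs.card_P
  rw [le_bot_iff.1 hK, Subgroup.card_bot] at this
  exact hs.prime.one_lt.ne this

/-- Outside the core of `H`, elements of `H` have `P`-invariant basic sets. -/
lemma rel_mul (hs : IsSplit H P p) {a : G} (ha : a ∈ H) (ha' : a ∉ A.satCore H) {q : G}
    (hq : q ∈ P) : A.r a (a * q) := by
  have : ¬ ∀ y, A.r a y → y ∈ H := ha'
  push Not at this
  obtain ⟨y, hy, hyH⟩ := this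
  exact hs.rel_mul_of_not_subset ha hy hyH hq

lemma rel_mul' (hs : IsSplit H P p) {x : G} (hx : ∀ a ∈ A.satCore H, ∀ q ∈ P, x ≠ a * q) {q : G}
    (hq : q ∈ P) : A.r x (x * q) := by
  obtain ⟨a, ha, r, hr, rfl⟩ := hs.exists_mul x
  have ha' : a ∉ A.satCore H := fun h => hx a h r hr rfl
  rw [mul_assoc]
  exact SRel.trans (SRel.symm (hs.rel_mul ha ha' hr)) (hs.rel_mul ha ha' (mul_mem hr hq))

lemma locSchur_of_ne_top (hs : IsSplit H P p)
    (ihU : ∀ (U : Subgroup G) (hU : A.Sat U), U ≠ ⊤ → (A.res U hU).LocSchur)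
    (ihL : ∀ (L : Subgroup G) (hL : A.Sat L), L ≠ ⊥ → (A.quo L hL).LocSchur)
    (hne : A.satCore H ⊔ A.satHull P ≠ ⊤) : A.LocSchur := by
  have hPU : A.satHull P ≤ A.satCore H ⊔ A.satHull P := le_sup_right
  refine locSchur_of_wreath (A.satHull P) (A.satCore H ⊔ A.satHull P) (sat_satHull P)
    (sat_sup (sat_satCore H) (sat_satHull P)) hPU (fun x hx l hl => ?_)
    (div_or_mul_mem_of_relIndex_le_three ?_) (ihU _ _ hne) (ihL _ _ (hs.ne_bot (le_satHull P)))
  · refine rel_mul_of_mem_satHull (fun y hy q hq => SRel.trans hy (hs.rel_mul' ?_ hq)) hl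
    rintro a ha q hq rfl
    refine hx (sat_sup (sat_satCore H) (sat_satHull P) _ _ (SRel.symm hy) ?_)
    exact Subgroup.mul_mem_sup ha (le_satHull P hq)
  · have h1 := Subgroup.relIndex_mul_index hPU
    have h2 := hs.index_dvd (le_satHull (A := A) P)
    rw [← h1] at h2
    have h3 : (A.satCore H ⊔ A.satHull P).index ≠ 1 := fun h => hne (Subgroup.index_eq_one.1 h)
    have h4 : (A.satCore H ⊔ A.satHull P).index ∣ 9 := (Dvd.intro_left _ rfl).trans h2
    have h5 := Nat.le_of_dvd (by norm_num) h2
    have h6 : (A.satCore H ⊔ A.satHull P).index ≠ 0 := fun h => by simp [h] at h4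
    by_contra! h7
    have h8 : (A.satCore H ⊔ A.satHull P).index ≠ 2 := fun h => by rw [h] at h4; omega
    nlinarith [Nat.mul_le_mul h7 (show 3 ≤ (A.satCore H ⊔ A.satHull P).index by omega)]

/-- If the saturated hulls generate `G`, basic sets outside the core of `H` meet
the product of the core by `P`. -/
lemma exists_rel_core (hs : IsSplit H P p) (htop : A.satCore H ⊔ A.satHull P = ⊤) {x : G}
    (hx : x ∉ A.satCore H) : ∃ a ∈ A.satCore H, ∃ q ∈ P, q ≠ 1 ∧ A.r x (a * q) := by
  by_contra! hn
  have hxP : ∀ y, A.r x y → ∀ a ∈ A.satCore H, ∀ q ∈ P, y ≠ a * q := by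
    rintro y hy a ha q hq rfl
    by_cases hq1 : q = 1
    · subst hq1
      exact hx (sat_satCore H _ _ (SRel.symm hy) (by simpa using ha))
    · exact hn a ha q hq hq1 hy
  let S : Set G := {y | A.r x y} * (A.satCore H : Set G)
  have hS : A.Sat S := (sat_class x).mul (sat_satCore H)
  have h1 : A.satCore H ≤ radical S := fun a ha => mem_radical_of_forall (by
    rintro _ ⟨y, hy, b, hb, rfl⟩
    exact ⟨y, hy, b * a, mul_mem hb ha, by simp [mul_assoc]⟩)
  have h2 : A.satHull P ≤ radical S := satHull_le (fun q hq => mem_radical_of_forall (by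
    rintro _ ⟨y, hy, b, hb, rfl⟩
    exact ⟨y * q, SRel.trans hy (hs.rel_mul' (hxP y hy) hq), b, hb, mul_right_comm _ _ _⟩))
    hS.radical
  have h3 : (⊤ : Subgroup G) ≤ radical S := htop ▸ sup_le h1 h2
  have h4 : x ∈ S := ⟨x, SRel.refl x, 1, one_mem _, mul_one x⟩
  have h5 : (1 : G) ∈ S := by
    have := ((mem_radical.1 (h3 (Subgroup.mem_top x⁻¹))) x).2 h4
    simpa using this
  obtain ⟨y, hy, a, ha, hya⟩ := h5
  have : y = a⁻¹ := eq_inv_of_mul_eq_one_left hya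
  exact hx (sat_satCore H _ _ (SRel.symm hy) (this ▸ inv_mem ha))

end IsSplit

namespace SRel
variable {G : Type*} [CommGroup G] {A : SRel G}

/-- Schur rings which are tensor products inherit local schurity. -/
theorem locSchur_of_tensor [Finite G] (N K : Subgroup G) (hN : A.Sat N) (hK : A.Sat K)
    (hdisj : ∀ x ∈ N, x ∈ K → x = 1) (hmul : ∀ g, ∃ n ∈ N, ∃ k ∈ K, n * k = g)
    (hr : ∀ n ∈ N, ∀ n' ∈ N, ∀ k ∈ K, ∀ k' ∈ K, A.r n n' → A.r k k' → A.r (n * k) (n' * k'))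
    (hresN : (A.res N hN).LocSchur) (hresK : (A.res K hK).LocSchur) : A.LocSchur := by
  have huniq : ∀ n ∈ N, ∀ n' ∈ N, ∀ k ∈ K, ∀ k' ∈ K, n * k = n' * k' → n = n' ∧ k = k' := by
    intro n hn n' hn' k hk k' hk' h
    have h1 : n / n' = k' / k := by rw [div_eq_div_iff_mul_eq_mul, h, mul_comm]
    have h2 := hdisj _ (div_mem hn hn') (h1 ▸ div_mem hk' hk)
    rw [h2] at h1
    exact ⟨div_eq_one.1 h2, (div_eq_one.1 h1.symm).symm⟩
  choose n hn k hk hnk using hmul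
  intro x y hxy
  rw [← hnk x, ← hnk y] at hxy
  have h1 : A.r (n x) (n y) := by
    obtain ⟨m, hm, l, hl, h⟩ := ((sat_class (A := A) (n x)).mul hK) _ _ hxy
      ⟨_, SRel.refl _, _, hk x, rfl⟩
    rw [← (huniq _ (hN _ _ hm (hn x)) _ (hn y) _ hl _ (hk y) h).1]
    exact hm
  have h2 : A.r (k x) (k y) := by
    obtain ⟨m, hm, l, hl, h⟩ := (hN.mul (sat_class (A := A) (k x))) _ _ hxy
      ⟨_, hn x, _, SRel.refl _, rfl⟩
    rw [← (huniq _ hm _ (hn y) _ (hK _ _ hl (hk x)) _ (hk y) h).2]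
    exact hl
  obtain ⟨f, hf1, hfx, hf⟩ := hresN ⟨n x, hn x⟩ ⟨n y, hn y⟩ h1
  obtain ⟨e, he1, hex, he⟩ := hresK ⟨k x, hk x⟩ ⟨k y, hk y⟩ h2
  refine ⟨fun g => f ⟨n g, hn g⟩ * e ⟨k g, hk g⟩, ?_, ?_, fun g h => ?_⟩
  · have h3 := huniq _ (hn 1) 1 N.one_mem _ (hk 1) 1 K.one_mem (by rw [hnk, one_mul])
    have h4 : (⟨n 1, hn 1⟩ : N) = 1 := Subtype.ext h3.1
    have h5 : (⟨k 1, hk 1⟩ : K) = 1 := Subtype.ext h3.2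
    simp [h4, h5, hf1, he1]
  · simp only [hfx, hex, hnk]
  · rw [← hnk g, ← hnk h, mul_div_mul_comm, hnk, hnk, mul_div_mul_comm]
    exact hr _ (div_mem (hn g) (hn h)) _ (div_mem (f _).2 (f _).2) _ (div_mem (hk g) (hk h)) _
      (div_mem (e _).2 (e _).2) (hf ⟨n g, hn g⟩ ⟨n h, hn h⟩)
      (he ⟨k g, hk g⟩ ⟨k h, hk h⟩)

lemma eq_one_or_of_card_le_three [Finite G] {N : Subgroup G} (h : Nat.card N ≤ 3) {c n : G}
    (hc : c ∈ N) (hn : n ∈ N) (hc1 : c ≠ 1) : n = 1 ∨ n = c ∨ n = c⁻¹ := by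
  rcases div_or_mul_mem_of_relIndex_le_three (L := ⊥) (U := N) (by simpa using h) n hn c hc with
    h | h | h | h
  · exact Or.inl (Subgroup.mem_bot.1 h)
  · exact absurd (Subgroup.mem_bot.1 h) hc1
  · exact Or.inr (Or.inl (div_eq_one.1 (Subgroup.mem_bot.1 h)).symm)
  · exact Or.inr (Or.inr (eq_inv_of_mul_eq_one_right (Subgroup.mem_bot.1 h)))

end SRel

namespace IsSplit
open SRel
variable {G : Type*} [CommGroup G] {H P : Subgroup G} {p : ℕ} [Finite G] {A : SRel G}

omit [Finite G] in
lemma exists_mem_P (hs : IsSplit H P p) : ∃ q ∈ P, q ≠ 1 := by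
  have h : P ≠ ⊥ := hs.ne_bot le_rfl
  exact (Subgroup.ne_bot_iff_exists_ne_one.1 h).elim fun q hq =>
    ⟨q, q.2, fun h => hq (Subtype.ext h)⟩

omit [Finite G] in
lemma card_mem (hs : IsSplit H P p) {N : Subgroup G} (hN : N ≤ H) :
    Nat.card N ∈ ({1, 3, 9} : Finset ℕ) := by
  have h : Nat.card N ∣ 9 := (Subgroup.card_dvd_of_le hN).trans hs.card_H
  have := Nat.mem_divisors.2 ⟨h, by norm_num⟩
  exact this

omit [Finite G] in
lemma card_eq_three [Finite H] (hs : IsSplit H P p) {N : Subgroup G} (hN : N ≤ H) (h : N ≠ H)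
    (h' : N ≠ ⊥) : Nat.card N = 3 := by
  have h1 := hs.card_mem hN
  have h2 := hs.card_mem (le_refl H)
  have h3 : Nat.card N ≠ 1 := fun h => h' (Subgroup.card_eq_one.1 h)
  have h4 : Nat.card N ≠ 9 := fun h4 => h (Subgroup.eq_of_le_of_card_ge hN (by
    rw [h4]; exact Nat.le_of_dvd (by norm_num) hs.card_H))
  simp only [Finset.mem_insert, Finset.mem_singleton] at h1
  tauto

omit [Finite G] in
lemma relIndex_le_three (hs : IsSplit H P p) {N : Subgroup G} (hN : N ≤ H) (h' : N ≠ ⊥) :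
    N.relIndex H ≤ 3 := by
  have h1 := hs.card_mem hN
  have h3 : Nat.card N ≠ 1 := fun h => h' (Subgroup.card_eq_one.1 h)
  have h4 := Subgroup.relIndex_mul_relIndex ⊥ N H bot_le hN
  rw [Subgroup.relIndex_bot_left, Subgroup.relIndex_bot_left] at h4
  have h5 := Nat.le_of_dvd (by norm_num) hs.card_H
  simp only [Finset.mem_insert, Finset.mem_singleton] at h1
  have h6 : 3 ≤ Nat.card N := by omega
  nlinarith

lemma rel_pow_one (hs : IsSplit H P p) {a q r : G} (ha : a ∈ H) {b : G} (hb : b ∈ H) (hq : q ∈ P)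
    (hr : r ∈ P) (hq1 : q ≠ 1) (hr1 : r ≠ 1) (h : A.r a (b * q)) : A.r a (b * r) := by
  obtain ⟨k, hk, rfl⟩ := hs.exists_pow hq hr hq1 hr1
  have := hs.pow_rel hk (q := 1) ha hb (one_mem _) hq (by simpa using h)
  simpa using this

/-- If the core `N` of `H` is proper, the quotient by `N` is trivial. -/
lemma exists_rel_mul_core (hs : IsSplit H P p) (htop : A.satCore H ⊔ A.satHull P = ⊤)
    (hne : A.satCore H ≠ H) {x y : G} (hx : x ∉ A.satCore H) (hy : y ∉ A.satCore H) :
    ∃ l ∈ A.satCore H, A.r x (y * l) := by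
  obtain ⟨a, ha, haN⟩ := SetLike.exists_of_lt (lt_of_le_of_ne (satCore_le (A := A) H) hne)
  obtain ⟨h₀, hh₀, q₀, hq₀, hq₀1, h0⟩ := hs.exists_rel_core htop haN
  have key : ∀ x, x ∉ A.satCore H → ∃ m ∈ A.satCore H, A.r a (x * m) := by
    intro x hx
    obtain ⟨h, hh, q, hq, hq1, h1⟩ := hs.exists_rel_core htop hx
    have h2 := hs.rel_pow_one ha (satCore_le H hh₀) hq₀ hq hq₀1 hq1 h0
    have h3 : h * q = h₀ * q * (h / h₀) := by rw [mul_right_comm, mul_div_cancel]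
    obtain ⟨m, hm, h4⟩ := exists_mul_of_mul_left (sat_satCore H) (div_mem hh hh₀)
      (SRel.symm (h3 ▸ h1))
    exact ⟨m, hm, SRel.trans h2 h4⟩
  obtain ⟨m, hm, h1⟩ := key x hx
  obtain ⟨m', hm', h2⟩ := key y hy
  obtain ⟨m'', hm'', h3⟩ := exists_mul_of_mul_left (sat_satCore H) hm
    (SRel.trans (SRel.symm h1) h2)
  exact ⟨m' * m'', mul_mem hm' hm'', by rwa [← mul_assoc]⟩

/-- The core of `H` either stabilises all basic sets outside it, or meets every
translate of a basic set outside it at most once. -/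
lemma core_periodic_or (hs : IsSplit H P p) (htop : A.satCore H ⊔ A.satHull P = ⊤)
    (hne : A.satCore H ≠ H) (hbot : A.satCore H ≠ ⊥) {a : G} (haN : a ∉ A.satCore H)
    (haq : ∀ q ∈ P, q ≠ 1 → A.r a q) :
    (∀ x, x ∉ A.satCore H → ∀ l ∈ A.satCore H, A.r x (x * l)) ∨
      ∀ x, A.r a x → ∀ c ∈ A.satCore H, A.r a (x * c) → c = 1 := by
  by_contra! hn
  obtain ⟨⟨y, hy, l, hl, hyl⟩, x, hx, c, hc, hxc, hc1⟩ := hn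
  have hN := sat_satCore (A := A) H
  set N := A.satCore H with hNdef
  have hNH : N ≤ H := satCore_le H
  set X : Set G := {z | A.r a z} with hX
  have hXs : A.Sat X := sat_class a
  obtain ⟨q, hq, hq1⟩ := hs.exists_mem_P
  have h1 : A.Sat (X * ((N : Set G) ∩ ({1} : Set G)ᶜ)) := hXs.mul (hN.inter sat_one.compl)
  have h2 : x ∈ X * ((N : Set G) ∩ ({1} : Set G)ᶜ) :=
    ⟨x * c, hxc, c⁻¹, ⟨inv_mem hc, by simpa using hc1⟩, by simp⟩
  obtain ⟨z, hz, d, ⟨hd, hd1⟩, hzd⟩ := h1 _ _ (SRel.trans (SRel.symm hx) (haq q hq hq1)) h2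
  have hd1 : d ≠ 1 := hd1
  have h3 : A.r (1 * q) (d⁻¹ * q) := by
    have : z = d⁻¹ * q := by rw [← hzd]; simp [mul_comm]
    rw [one_mul, ← this]
    exact SRel.trans (SRel.symm (haq q hq hq1)) hz
  have h4 := hs.inv_rel (one_mem _) (hNH (inv_mem hd)) hq hq h3
  rw [inv_one, one_mul, inv_inv] at h4
  rw [one_mul] at h3
  have h5 : ∀ n ∈ N, A.r q (n * q) := by
    intro n hn
    rcases eq_one_or_of_card_le_three (hs.card_eq_three hNH hne hbot).le hd hn hd1 with h | h | h
    · rw [h, one_mul]; exact SRel.refl _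
    · rw [h]; exact h4
    · rw [h]; exact h3
  have h6 : q ∉ Xᶜ * (N : Set G) := by
    rintro ⟨w, hw, n, hn, hwn⟩
    refine hw ?_
    have : w = n⁻¹ * q := by rw [← hwn]; simp [mul_comm]
    rw [this]
    exact SRel.trans (haq q hq hq1) (h5 _ (inv_mem hn))
  have h7 : ∀ w ∈ X, ∀ n ∈ N, w * n ∈ X := by
    intro w hw n hn
    by_contra hwn
    refine h6 ((hXs.compl.mul hN) w q (SRel.trans (SRel.symm hw) (haq q hq hq1))
      ⟨w * n, hwn, n⁻¹, inv_mem hn, by simp⟩)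
  obtain ⟨m, hm, hym⟩ := hs.exists_rel_mul_core htop hne haN hy
  have h8 := h7 _ hym m⁻¹ (inv_mem hm)
  have h9 := h7 _ hym (m⁻¹ * l) (mul_mem (inv_mem hm) hl)
  simp only [mul_inv_cancel_right, ← mul_assoc] at h8 h9
  exact hyl (SRel.trans (SRel.symm h8) h9)

theorem locSchur_of_core_ne (hs : IsSplit H P p)
    (ihU : ∀ (U : Subgroup G) (hU : A.Sat U), U ≠ ⊤ → (A.res U hU).LocSchur)
    (htop : A.satCore H ⊔ A.satHull P = ⊤) (hne : A.satCore H ≠ H) : A.LocSchur := by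
  classical
  by_cases hbot : A.satCore H = ⊥
  · refine locSchur_of_trivial fun x y hx hy => ?_
    obtain ⟨l, hl, h⟩ := hs.exists_rel_mul_core htop hne (x := x) (y := y)
      (by simpa [hbot] using hx) (by simpa [hbot] using hy)
    rw [hbot, Subgroup.mem_bot] at hl
    simpa [hl] using h
  obtain ⟨q₀, hq₀, hq₀1⟩ := hs.exists_mem_P
  have hN := sat_satCore (A := A) H
  have hNH : A.satCore H ≤ H := satCore_le H
  have hPN : ∀ q ∈ P, q ≠ 1 → q ∉ A.satCore H := fun q hq hq1 h => hq1 (hs.eq_one (hNH h) hq)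
  obtain ⟨a', ha', ha'N⟩ := SetLike.exists_of_lt (lt_of_le_of_ne hNH hne)
  obtain ⟨l, hl, ha0⟩ := hs.exists_rel_mul_core htop hne (hPN q₀ hq₀ hq₀1) ha'N
  set N := A.satCore H with hNdef
  obtain ⟨a, rfl⟩ : ∃ a, a = a' * l := ⟨_, rfl⟩
  set a := a' * l with hadef
  have ha : a ∈ H := mul_mem ha' (hNH hl)
  have haN : a ∉ N := fun h => ha'N ((mul_mem_cancel_right hl).1 h)
  have hNtop : N ≠ ⊤ := fun h => haN (h ▸ Subgroup.mem_top _)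
  have haq : ∀ q ∈ P, q ≠ 1 → A.r a q := fun q hq hq1 => by
    have := hs.rel_pow_one ha (one_mem H) hq₀ hq hq₀1 hq1 (by simpa using SRel.symm ha0)
    simpa using this
  rcases hs.core_periodic_or htop hne hbot haN haq with hper | hinj
  · refine locSchur_of_wreath N N hN hN le_rfl hper ?_ (ihU _ _ hNtop) ?_
    · intro u hu v _; exact Or.inl hu
    · refine locSchur_of_trivial fun x y hx hy => ?_
      obtain ⟨x, rfl⟩ := QuotientGroup.mk_surjective x
      obtain ⟨y, rfl⟩ := QuotientGroup.mk_surjective y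
      rw [Ne, QuotientGroup.eq_one_iff] at hx hy
      exact (quo_r hN x y).2 (hs.exists_rel_mul_core htop hne hx hy)
  have hainv : A.r a a⁻¹ := by
    have := hs.inv_rel ha (one_mem H) (one_mem P) hq₀ (by simpa using haq q₀ hq₀ hq₀1)
    simp only [inv_one, mul_one, one_mul] at this
    exact SRel.trans (haq q₀ hq₀ hq₀1) (SRel.symm this)
  have hK : ∀ x, x ∈ Subgroup.zpowers a ⊔ P ↔ ∃ b, (b = 1 ∨ b = a ∨ b = a⁻¹) ∧ ∃ q ∈ P, b * q = x := by
    intro x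
    rw [Subgroup.mem_sup]
    constructor
    · rintro ⟨b, hb, q, hq, rfl⟩
      refine ⟨b, ?_, q, hq, rfl⟩
      have hcard : Nat.card (Subgroup.zpowers a) ≤ 3 := by
        rw [Nat.card_zpowers]; exact orderOf_le_of_pow_eq_one (by norm_num) (hs.pow_H a ha)
      exact eq_one_or_of_card_le_three hcard (Subgroup.mem_zpowers a) hb
        fun h => haN (h ▸ one_mem _)
    · rintro ⟨b, hb, q, hq, rfl⟩
      refine ⟨b, ?_, q, hq, rfl⟩
      rcases hb with rfl | rfl | rfl
      · exact one_mem _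
      · exact Subgroup.mem_zpowers _
      · exact inv_mem (Subgroup.mem_zpowers _)
  have hbN : ∀ b, b = a ∨ b = a⁻¹ → b ∈ H ∧ b ∉ N ∧ A.r a b := by
    rintro b (rfl | rfl)
    · exact ⟨ha, haN, SRel.refl _⟩
    · exact ⟨inv_mem ha, fun h => haN (by simpa using inv_mem h), hainv⟩
  have hKX : ∀ x ∈ Subgroup.zpowers a ⊔ P, x ≠ 1 → A.r a x := by
    intro x hx hx1
    obtain ⟨b, hb, q, hq, rfl⟩ := (hK x).1 hx
    rcases hb with rfl | hb
    · rw [one_mul] at hx1 ⊢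
      exact haq q hq hx1
    · obtain ⟨hbH, hbN, hab⟩ := hbN b hb
      exact SRel.trans hab (hs.rel_mul hbH hbN hq)
  have hmul : ∀ g, ∃ n ∈ N, ∃ k ∈ Subgroup.zpowers a ⊔ P, n * k = g := by
    intro g
    obtain ⟨h, hh, q, hq, rfl⟩ := hs.exists_mul g
    have : ∃ n ∈ N, ∃ b, (b = 1 ∨ b = a ∨ b = a⁻¹) ∧ n * b = h := by
      rcases div_or_mul_mem_of_relIndex_le_three (hs.relIndex_le_three hNH hbot) a ha h hh with
        h1 | h1 | h1 | h1
      · exact absurd h1 haN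
      · exact ⟨h, h1, 1, Or.inl rfl, mul_one h⟩
      · exact ⟨h / a, h1, a, by simp, by simp⟩
      · exact ⟨h * a, h1, a⁻¹, by simp, by simp⟩
    obtain ⟨n, hn, b, hb, rfl⟩ := this
    exact ⟨n, hn, b * q, (hK _).2 ⟨b, hb, q, hq, rfl⟩, (mul_assoc _ _ _).symm⟩
  have hXK : ∀ x, A.r a x → x ∈ Subgroup.zpowers a ⊔ P := by
    intro x hx
    obtain ⟨n, hn, k, hk, rfl⟩ := hmul x
    have hk1 : k ≠ 1 := by
      rintro rfl
      rw [mul_one] at hx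
      exact haN (hN _ _ (SRel.symm hx) hn)
    rw [hinj k (hKX k hk hk1) n hn (by rwa [mul_comm]), one_mul]
    exact hk
  set K := Subgroup.zpowers a ⊔ P with hKdef
  have hKs : A.Sat K := by
    intro x y hxy hx
    by_cases hx1 : x = 1
    · rw [A.one y (hx1 ▸ hxy)]; exact one_mem K
    · exact hXK y (SRel.trans (hKX x hx hx1) hxy)
  have hdisj : ∀ x ∈ N, x ∈ K → x = 1 := by
    intro x hx hxK
    by_contra hx1
    exact haN (hN _ _ (SRel.symm (hKX x hxK hx1)) hx)
  have hKtop : K ≠ ⊤ := by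
    rintro hK
    refine hbot ((Subgroup.eq_bot_iff_forall _).2 fun x hx => hdisj x hx ?_)
    rw [hK]; exact Subgroup.mem_top x
  have hcard := hs.card_eq_three hNH hne hbot
  refine locSchur_of_tensor N K hN hKs hdisj hmul ?_ (ihU _ _ hNtop) (ihU _ _ hKtop)
  intro n hn n' hn' k hk k' hk' hnn hkk
  by_cases hk1 : k = 1
  · have hk1' := A.one k' (hk1 ▸ hkk)
    rw [hk1, hk1', mul_one, mul_one]
    exact hnn
  by_cases hn1 : n = 1
  · have hn1' := A.one n' (hn1 ▸ hnn)
    rw [hn1, hn1', one_mul, one_mul]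
    exact hkk
  by_cases hsing : A.r n n⁻¹
  swap
  · have hn'n : ∀ z, A.r n z → z = n := by
      intro z hz
      rcases eq_one_or_of_card_le_three hcard.le hn (hN _ _ hz hn) hn1 with h | h | h
      · exact absurd (SRel.eq_one (h ▸ hz)) hn1
      · exact h
      · exact absurd (h ▸ hz) hsing
    rw [hn'n n' hnn]
    have h1 : A.Sat ({n} : Set G) := by
      rintro x y hxy rfl
      exact hn'n y hxy
    obtain ⟨u, hu, w, hw, h⟩ := (h1.inv.mul (sat_class (n * k))) k k' hkk
      ⟨n⁻¹, by simp, n * k, SRel.refl _, by simp⟩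
    have hu : u⁻¹ = n := hu
    have : w = n * k' := by rw [← h, ← hu]; simp
    exact this ▸ hw
  have hk'1 : k' ≠ 1 := fun h => hk1 (SRel.eq_one (h ▸ hkk))
  have hn'1 : n' ≠ 1 := fun h => hn1 (SRel.eq_one (h ▸ hnn))
  have hHinv : ∀ m ∈ N, m ≠ 1 → ∀ b, b = a ∨ b = a⁻¹ →
      ∃ h ∈ N, h ≠ 1 ∧ ∀ q ∈ P, q ≠ 1 → A.r (m * b) (h * q) := by
    intro m hm hm1 b hb
    obtain ⟨hbH, hbN, hab⟩ := hbN b hb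
    have hmb : m * b ∉ N := fun h => hbN ((mul_mem_cancel_left hm).1 h)
    obtain ⟨h, hh, q, hq, hq1, h1⟩ := hs.exists_rel_core htop hmb
    refine ⟨h, hh, ?_, fun q' hq' hq'1 =>
      hs.rel_pow_one (mul_mem (hNH hm) hbH) (hNH hh) hq hq' hq1 hq'1 h1⟩
    rintro rfl
    rw [one_mul] at h1
    refine hm1 (hinj b hab m hm ?_)
    rw [mul_comm]
    exact SRel.trans (haq q hq hq1) (SRel.symm h1)
  have hqq : ∀ m ∈ N, m ≠ 1 → ∀ q ∈ P, q ≠ 1 → ∀ r ∈ P, r ≠ 1 → A.r (m * q) (m * r) := by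
    intro m hm hm1 q hq hq1 r hr hr1
    obtain ⟨h, hh, hh1, h1⟩ := hHinv m hm hm1 a (Or.inl rfl)
    have h2 := SRel.trans (SRel.symm (h1 q hq hq1)) (h1 r hr hr1)
    rcases eq_one_or_of_card_le_three hcard.le hh hm hh1 with h | h | h
    · exact absurd h hm1
    · rw [h]; exact h2
    · rw [h]; exact hs.inv_rel (hNH hh) (hNH hh) hq hr h2
  have hninv : A.r (n * q₀) (n⁻¹ * q₀) := by
    by_contra hnot
    have := Fintype.ofFinite P
    have : Fact p.Prime := ⟨hs.prime⟩
    have h1 := hs.sum_P_eq (isClassFn_indicator (R := ZMod p) (sat_class (A := A) (n * q₀)))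
      (hNH hn) (inv_mem (hNH hn)) hsing
    have h2 : ∀ r : P, ({x | A.r (n * q₀) x} : Set G).indicator (1 : G → ZMod p) (n * r) =
        1 - if r = 1 then 1 else 0 := by
      intro r
      by_cases hr : r = 1
      · subst hr
        have : ¬ A.r (n * q₀) n := fun h => hq₀1 ((hs.mul_mem_H (hNH hn) hq₀).1
          (hNH (hN _ _ (SRel.symm h) hn)))
        simp [this]
      · have := hqq n hn hn1 q₀ hq₀ hq₀1 r r.2 fun h => hr (Subtype.ext h)
        simp [this, hr]
    have h3 : ∀ r : P, ({x | A.r (n * q₀) x} : Set G).indicator (1 : G → ZMod p) (n⁻¹ * r) = 0 := by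
      intro r
      have : ¬ A.r (n * q₀) (n⁻¹ * r) := by
        intro h
        by_cases hr : r = 1
        · subst hr
          refine hq₀1 ((hs.mul_mem_H (hNH hn) hq₀).1 (hNH (hN _ _ (SRel.symm h) ?_)))
          simpa using hn
        · exact hnot (SRel.trans h (hqq _ (inv_mem hn) (by simpa using hn1) r r.2
            (fun h => hr (Subtype.ext h)) q₀ hq₀ hq₀1))
      simp [this]
    simp only [h2, h3, Finset.sum_sub_distrib, Finset.sum_const_zero, Finset.sum_ite_eq',
      Finset.mem_univ, if_true, Finset.sum_const, Finset.card_univ, ← Nat.card_eq_fintype_card,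
      hs.card_P, nsmul_eq_mul, mul_one, CharP.cast_eq_zero, zero_sub] at h1
    exact one_ne_zero (neg_eq_zero.1 h1)
  have hP : ∀ m ∈ N, m ≠ 1 → ∀ q ∈ P, q ≠ 1 → A.r (n * q₀) (m * q) := by
    intro m hm hm1 q hq hq1
    refine SRel.trans ?_ (hqq m hm hm1 q₀ hq₀ hq₀1 q hq hq1)
    rcases eq_one_or_of_card_le_three hcard.le hn hm hn1 with h | h | h
    · exact absurd h hm1
    · rw [h]; exact SRel.refl _
    · rw [h]; exact hninv
  have hall : ∀ m ∈ N, m ≠ 1 → ∀ k ∈ K, k ≠ 1 → A.r (n * q₀) (m * k) := by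
    intro m hm hm1 k hk hk1
    obtain ⟨b, hb, q, hq, rfl⟩ := (hK k).1 hk
    rcases hb with rfl | hb
    · rw [one_mul] at hk1 ⊢
      exact hP m hm hm1 q hq hk1
    · obtain ⟨h, hh, hh1, h1⟩ := hHinv m hm hm1 b hb
      obtain ⟨hbH, hbN, hab⟩ := hbN b hb
      rw [← mul_assoc]
      have hmb : m * b ∉ N := fun h => hbN ((mul_mem_cancel_left hm).1 h)
      exact SRel.trans (hP h hh hh1 q₀ hq₀ hq₀1) (SRel.trans (SRel.symm (h1 q₀ hq₀ hq₀1))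
        (hs.rel_mul (mul_mem (hNH hm) hbH) hmb hq))
  exact SRel.trans (SRel.symm (hall n hn hn1 k hk hk1)) (hall n' hn' hn'1 k' hk' hk'1)

end IsSplit

namespace SRel
variable {G : Type*} [CommGroup G] {A : SRel G}

lemma IsClassFn.corr [Fintype G] {R : Type*} [CommSemiring R] {u : G → R} (hu : A.IsClassFn u) :
    A.IsClassFn (fun x => ∑ g, u g * u (g / x)) := by
  have hv : A.IsClassFn fun x => u x⁻¹ := fun x y h => hu _ _ (A.inv x y h)
  simpa using hu.conv hv

/-- A translate of a set with full autocorrelation is the set itself. -/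
lemma div_mem_of_corr_eq [Fintype G] {S : Set G} {c : G}
    (h : ∑ g, S.indicator (1 : G → ℕ) g * S.indicator 1 (g / c) =
      ∑ g, S.indicator (1 : G → ℕ) g * S.indicator 1 (g / 1)) {x : G} (hx : x ∈ S) : x / c ∈ S := by
  classical
  have h1 : ∀ g ∈ Finset.univ, S.indicator (1 : G → ℕ) g * S.indicator 1 (g / c) ≤
      S.indicator (1 : G → ℕ) g * S.indicator 1 (g / 1) := by
    intro g _
    by_cases hg : g ∈ S <;> by_cases hgc : g / c ∈ S <;> simp [hg, hgc]
  have h2 := (Finset.sum_eq_sum_iff_of_le h1).1 h x (Finset.mem_univ x)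
  by_contra hn
  simp [hx, hn] at h2

/-- Elements `a` and `b` are linked by `P` if some basic set meets both cosets `aP` and `bP`
outside `a` and `b`. -/
def Linked (A : SRel G) (P : Subgroup G) (a b : G) : Prop :=
  ∃ q ∈ P, q ≠ 1 ∧ ∃ r ∈ P, r ≠ 1 ∧ A.r (a * q) (b * r)

end SRel

namespace IsSplit
open SRel
variable {G : Type*} [CommGroup G] {H P : Subgroup G} {p : ℕ} {A : SRel G}

lemma linked_refl (hs : IsSplit H P p) (a : G) : A.Linked P a a := by
  obtain ⟨q, hq, hq1⟩ := hs.exists_mem_P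
  exact ⟨q, hq, hq1, q, hq, hq1, SRel.refl _⟩

variable [Finite G]

lemma exists_twist (hs : IsSplit H P p) {a b q r : G} (ha : a ∈ H) (hb : b ∈ H) (hq : q ∈ P)
    (hr : r ∈ P) (hq1 : q ≠ 1) (hr1 : r ≠ 1) (h : A.r (a * q) (b * r)) :
    ∃ k, Nat.Coprime p k ∧ q ^ k = r ∧ ∀ s ∈ P, s ≠ 1 → A.r (a * s) (b * s ^ k) := by
  obtain ⟨k, hk, rfl⟩ := hs.exists_pow hq hr hq1 hr1
  refine ⟨k, hk, rfl, fun s hs' hs1 => ?_⟩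
  obtain ⟨j, hj, rfl⟩ := hs.exists_pow hq hs' hq1 hs1
  rw [pow_right_comm]
  exact hs.pow_rel hj ha hb hq hr h

lemma linked_trans (hs : IsSplit H P p) {a b c : G} (hb : b ∈ H) (hc : c ∈ H) :
    A.Linked P a b → A.Linked P b c → A.Linked P a c := by
  rintro ⟨q, hq, hq1, r, hr, hr1, h⟩ ⟨s, hs', hs1, t, ht, ht1, h'⟩
  obtain ⟨k, hk, -, h2⟩ := hs.exists_twist hb hc hs' ht hs1 ht1 h'
  exact ⟨q, hq, hq1, r ^ k, pow_mem hr k, hs.pow_ne_one hk hr hr1, SRel.trans h (h2 r hr hr1)⟩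

open Classical in
lemma sum_eq_of_linked [Fintype P] (hs : IsSplit H P p) {R : Type*} [AddCommMonoid R] {u : G → R}
    (hu : A.IsClassFn u) {a b : G} (ha : a ∈ H) (hb : b ∈ H) (hab : A.Linked P a b) :
    (∑ q : P, if q = 1 then 0 else u (a * q)) = ∑ q : P, if q = 1 then 0 else u (b * q) := by
  obtain ⟨q, hq, hq1, r, hr, hr1, h⟩ := hab
  obtain ⟨k, hk, -, h2⟩ := hs.exists_twist ha hb hq hr hq1 hr1 h
  have hk' : (Nat.card P).Coprime k := by rwa [hs.card_P]
  rw [← Equiv.sum_comp (powCoprime hk') fun q : P => if q = 1 then 0 else u (b * q)]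
  refine Finset.sum_congr rfl fun s _ => ?_
  have h1 : powCoprime hk' s = 1 ↔ s = 1 :=
    ⟨fun h => (powCoprime hk').injective (h.trans (powCoprime_one hk').symm),
      fun h => h ▸ powCoprime_one hk'⟩
  by_cases hs1 : s = 1
  · simp [hs1]
  · rw [if_neg hs1, if_neg (mt h1.1 hs1)]
    exact hu _ _ (h2 s s.2 fun h => hs1 (Subtype.ext h))

/-- The union of the punctured cosets of `P` linked to `a`. -/
lemma sat_linked (hs : IsSplit H P p) (hH : A.Sat H) (a : G) :
    A.Sat {x | ∃ b ∈ H, A.Linked P a b ∧ ∃ q ∈ P, q ≠ 1 ∧ b * q = x} := by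
  rintro x y hxy ⟨b, hb, hab, q, hq, hq1, rfl⟩
  obtain ⟨c, hc, r, hr, rfl⟩ := hs.exists_mul y
  have hr1 : r ≠ 1 := fun h => hq1 ((hs.mul_mem_H hb hq).1
    (hH _ _ (SRel.symm hxy) ((hs.mul_mem_H hc hr).2 h)))
  exact ⟨c, hc, hs.linked_trans hb hc hab ⟨q, hq, hq1, r, hr, hr1, hxy⟩, r, hr, hr1, rfl⟩

lemma linked_div (hs : IsSplit H P p) (hH : A.Sat H) (hp : p ≠ 2) {a b c : G} (hb : b ∈ H)
    (hc : c ∈ H) (hab : A.Linked P a b) (h1c : A.Linked P 1 c) :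
    A.Linked P a (b / c) := by
  classical
  have := Fintype.ofFinite G
  have := Fintype.ofFinite H
  have := Fintype.ofFinite P
  set W : G → ℕ := ({x | ∃ b ∈ H, A.Linked P a b ∧ ∃ q ∈ P, q ≠ 1 ∧ b * q = x} : Set G).indicator 1
    with hWdef
  have hρ := (isClassFn_indicator (R := ℕ) (hs.sat_linked hH a)).corr
  rw [← hWdef] at hρ
  let w : H → ℕ := ({b : H | A.Linked P a b} : Set H).indicator 1
  have hW : ∀ b : H, ∀ q : P, W (b * q) = w b * if q = 1 then 0 else 1 := by
    intro b q
    have h1 : (∃ b' ∈ H, A.Linked P a b' ∧ ∃ q' ∈ P, q' ≠ 1 ∧ b' * q' = b * (q : G)) ↔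
        A.Linked P a b ∧ q ≠ 1 := by
      constructor
      · rintro ⟨b', hb', hl, q', hq', hq1, h⟩
        obtain ⟨rfl, rfl⟩ := hs.ext hb' b.2 hq' q.2 h
        exact ⟨hl, fun h => hq1 (congrArg Subtype.val h)⟩
      · rintro ⟨hl, hq⟩
        exact ⟨b, b.2, hl, q, q.2, fun h => hq (Subtype.ext h), rfl⟩
    simp only [hWdef, w, Set.indicator_apply, Set.mem_ofPred_eq, h1, Pi.one_apply]
    by_cases h2 : A.Linked P a b <;> by_cases h3 : q = 1 <;> simp [h2, h3]
  have hval : ∀ c : H, ∀ q : P, q ≠ 1 → ∑ g, W g * W (g / (c * q)) =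
      (∑ b, w b * w (b / c)) * (p - 2) := by
    intro c q hq
    rw [hs.sum_eq, Finset.sum_mul]
    refine Finset.sum_congr rfl fun b _ => ?_
    have h1 : ∀ r : P, W (b * r) * W (b * r / (c * q)) =
        w b * w (b / c) * ((if r = 1 then 0 else 1) * if r = q then 0 else 1) := by
      intro r
      have h2 : (b * r / (c * q) : G) = (b / c : H) * (r / q : P) := mul_div_mul_comm _ _ _ _
      rw [h2, hW, hW, mul_mul_mul_comm]
      simp only [div_eq_one]
    simp only [h1]
    rw [← Finset.mul_sum]
    congr 1
    have h2 : ∀ r : P, ((if r = 1 then 0 else 1) * if r = q then 0 else 1) =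
        if r ∈ ({1, q} : Finset P) then 0 else 1 := by
      intro r
      by_cases h3 : r = 1 <;> by_cases h4 : r = q <;> simp [h3, h4]
    simp only [h2]
    rw [← Finset.sum_compl_add_sum ({1, q} : Finset P)]
    rw [Finset.sum_congr rfl (g := fun _ => 1) (by intro x hx; rw [Finset.mem_compl] at hx; simp only [hx, if_false]),
      Finset.sum_congr (s₁ := {1, q}) rfl (g := fun _ => 0) (by intro x hx; simp only [hx, if_true])]
    rw [Finset.sum_const, Finset.sum_const_zero, Finset.card_compl, ← Nat.card_eq_fintype_card,
      hs.card_P, Finset.card_pair (Ne.symm hq)]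
    simp
  obtain ⟨q, hq, hq1, r, hr, hr1, h⟩ := h1c
  have h2 := hρ _ _ h
  beta_reduce at h2
  have h3 := hval 1 ⟨q, hq⟩ fun h => hq1 (congrArg Subtype.val h)
  have h4 := hval ⟨c, hc⟩ ⟨r, hr⟩ fun h => hr1 (congrArg Subtype.val h)
  simp only [OneMemClass.coe_one] at h3
  rw [h3, h4] at h2
  have h5 : 0 < p - 2 := by have := hs.prime.two_le; omega
  have h6 := Nat.eq_of_mul_eq_mul_right h5 h2
  exact div_mem_of_corr_eq (c := (⟨c, hc⟩ : H)) h6.symm (x := ⟨b, hb⟩) hab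

lemma rel_mul_of_linked (hs : IsSplit H P p) (hH : A.Sat H) (hp : p ≠ 2) {x c : G} (hx : x ∉ H)
    (hc : c ∈ H) (h1c : A.Linked P 1 c) : A.r x (x / c) := by
  classical
  have := Fintype.ofFinite G
  have := Fintype.ofFinite H
  have := Fintype.ofFinite P
  set u : G → ℕ := ({y | A.r x y} : Set G).indicator 1 with hudef
  have hu : A.IsClassFn u := isClassFn_indicator (R := ℕ) (sat_class x)
  have hρ := hu.corr
  have hM : ∀ a ∈ H, ∑ q : P, u (a * q) = ∑ q : P, if q = 1 then 0 else u (a * q) := by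
    intro a ha
    refine Finset.sum_congr rfl fun q _ => ?_
    split_ifs with h
    · have : ¬ A.r x a := fun h => hx (hH _ _ (SRel.symm h) ha)
      simp [h, hudef, this]
    · rfl
  have hall : ∀ c : H, ∑ q : P, ∑ g, u g * u (g / (c * q)) =
      ∑ a : H, ∑ r : P, u (a * r) * ∑ q : P, u ((a / c : H) * q) := by
    intro c
    rw [Finset.sum_comm, hs.sum_eq]
    refine Finset.sum_congr rfl fun a _ => Finset.sum_congr rfl fun r _ => ?_
    rw [← Finset.mul_sum, ← Equiv.sum_comp (Equiv.divLeft r) fun q : P => u ((a / c : H) * q)]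
    congr 1
    refine Finset.sum_congr rfl fun q _ => ?_
    congr 1
    exact mul_div_mul_comm _ _ _ _
  have hall1 : ∑ q : P, ∑ g, u g * u (g / (c * q)) = ∑ q : P, ∑ g, u g * u (g / (1 * q)) := by
    have h1 := hall ⟨c, hc⟩
    have h2 := hall 1
    simp only [OneMemClass.coe_one] at h1 h2
    rw [h1, h2]
    refine Finset.sum_congr rfl fun a _ => Finset.sum_congr rfl fun r _ => ?_
    congr 1
    rw [hM _ (Subtype.prop _), hM _ (Subtype.prop _)]
    refine (hs.sum_eq_of_linked hu (Subtype.prop _) (Subtype.prop _) ?_).symm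
    have := hs.linked_div hH hp a.2 hc (hs.linked_refl a) h1c
    simpa using this
  have hpunct := hs.sum_eq_of_linked hρ (one_mem H) hc h1c
  have hsplit : ∀ F : P → ℕ, ∑ q, F q = F 1 + ∑ q : P, if q = 1 then 0 else F q := by
    intro F
    have : ∀ q, F q = (if q = 1 then F 1 else 0) + if q = 1 then 0 else F q := by
      intro q; split_ifs with h <;> simp [h]
    rw [Finset.sum_congr rfl fun q _ => this q, Finset.sum_add_distrib]
    simp
  rw [hsplit, hsplit (fun q : P => ∑ g, u g * u (g / (1 * q))), hpunct] at hall1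
  have hfin := Nat.add_right_cancel hall1
  simp only [OneMemClass.coe_one, mul_one] at hfin
  exact div_mem_of_corr_eq hfin (SRel.refl x)

omit [Finite G] in
lemma ne_top (hs : IsSplit H P p) : H ≠ ⊤ := by
  rintro rfl
  obtain ⟨q, hq, hq1⟩ := hs.exists_mem_P
  exact hq1 (hs.eq_one (Subgroup.mem_top q) hq)

lemma locSchur_of_periodic (hs : IsSplit H P p)
    (ihU : ∀ (U : Subgroup G) (hU : A.Sat U), U ≠ ⊤ → (A.res U hU).LocSchur)
    (ihL : ∀ (L : Subgroup G) (hL : A.Sat L), L ≠ ⊥ → (A.quo L hL).LocSchur)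
    (hH : A.Sat H) {C : Subgroup G} (hC : A.Sat C) (hCH : C ≤ H) (hC1 : C ≠ ⊥)
    (hper : ∀ x, x ∉ H → ∀ c ∈ C, A.r x (x * c)) : A.LocSchur :=
  locSchur_of_wreath C H hC hH hCH hper
    (div_or_mul_mem_of_relIndex_le_three (hs.relIndex_le_three hCH hC1)) (ihU _ _ hs.ne_top)
    (ihL _ _ hC1)

lemma sat_P_of_linked (hs : IsSplit H P p) (hH : A.Sat H)
    (h : ∀ a ∈ H, A.Linked P 1 a → a = 1) : A.Sat P := by
  intro x y hxy hx
  by_cases hx1 : x = 1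
  · rw [A.one y (hx1 ▸ hxy)]; exact one_mem P
  · obtain ⟨b, hb, hl, q, hq, hq1, rfl⟩ := hs.sat_linked hH 1 x y hxy
      ⟨1, one_mem H, hs.linked_refl 1, x, hx, hx1, one_mul x⟩
    rw [h b hb hl, one_mul]
    exact hq

theorem locSchur_or_sat_of_odd (hs : IsSplit H P p) (hp : p ≠ 2)
    (ihU : ∀ (U : Subgroup G) (hU : A.Sat U), U ≠ ⊤ → (A.res U hU).LocSchur)
    (ihL : ∀ (L : Subgroup G) (hL : A.Sat L), L ≠ ⊥ → (A.quo L hL).LocSchur)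
    (hH : A.Sat H) : A.LocSchur ∨ A.Sat P := by
  have hinv : ∀ d ∈ H, A.Linked P 1 d → A.Linked P 1 d⁻¹ := fun d hd h => by
    simpa using hs.linked_div hH hp (one_mem H) hd (hs.linked_refl 1) h
  let C : Subgroup G :=
    { carrier := {c | c ∈ H ∧ A.Linked P 1 c}
      one_mem' := ⟨one_mem H, hs.linked_refl 1⟩
      inv_mem' := fun h => ⟨inv_mem h.1, hinv _ h.1 h.2⟩
      mul_mem' := fun {c d} h h' => ⟨mul_mem h.1 h'.1, by
        simpa using hs.linked_div hH hp h.1 (inv_mem h'.1) h.2 (hinv _ h'.1 h'.2)⟩ }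
  by_cases hC1 : C = ⊥
  · refine Or.inr (hs.sat_P_of_linked hH fun a ha hl => ?_)
    have : a ∈ C := ⟨ha, hl⟩
    rwa [hC1, Subgroup.mem_bot] at this
  · have hCH : C ≤ H := fun c hc => hc.1
    have hC : A.Sat C := by
      intro x y hxy hx
      obtain ⟨q, hq, hq1⟩ := hs.exists_mem_P
      have hT := hs.sat_linked hH 1
      obtain ⟨_, ⟨b, hb, hbl, s, hs', hs1, rfl⟩, _, ⟨d, hd, hdl, t, ht, ht1, rfl⟩, h⟩ :=
        hT.mul hT x y hxy ⟨x * q, ⟨x, hx.1, hx.2, q, hq, hq1, rfl⟩, 1 * q⁻¹,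
          ⟨1, one_mem H, hs.linked_refl 1, q⁻¹, inv_mem hq, by simpa using hq1, rfl⟩, by simp⟩
      have h1 : b * d * (s * t) = y := by rw [← h]; exact mul_mul_mul_comm _ _ _ _
      have h2 := (hs.mul_mem_H (mul_mem hb hd) (mul_mem hs' ht)).1
        (h1 ▸ hH _ _ hxy hx.1)
      rw [h2, mul_one] at h1
      exact h1 ▸ mul_mem (show b ∈ C from ⟨hb, hbl⟩) (show d ∈ C from ⟨hd, hdl⟩)
    refine Or.inl (hs.locSchur_of_periodic ihU ihL hH hC hCH hC1 fun x hx c hc => ?_)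
    have := hs.rel_mul_of_linked hH hp hx (inv_mem hc.1) (hinv _ hc.1 hc.2)
    simpa using this

end IsSplit

namespace IsSplit
open SRel
variable {G : Type*} [CommGroup G] {H P : Subgroup G} [Finite G] {A : SRel G}

lemma three_dvd_ncard (hs : IsSplit H P 2) {q a : G} (hq : q ∈ P) (ha : a ∈ H) (ha1 : a ≠ 1)
    (h : A.r q (a * q)) (x : G) : 3 ∣ {b | b ∈ H ∧ A.r x (b * q)}.ncard := by
  classical
  have := Fintype.ofFinite G
  have : Fact (Nat.Prime 3) := ⟨Nat.prime_three⟩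
  have hcube : ∀ b ∈ H, ∀ r ∈ P, (b * r) ^ 3 = r := fun b hb r hr => by
    rw [mul_pow, hs.pow_H b hb, one_mul, pow_succ, hs.pow_P hr, one_mul]
  have h1 := (isClassFn_indicator (R := ZMod 3) (sat_class (A := A) x)).frobenius _ _ h
  beta_reduce at h1
  rw [Finset.sum_eq_zero (s := Finset.univ) (f := fun z => if z ^ 3 = a * q then _ else _)] at h1
  · rw [← ZMod.natCast_eq_zero_iff, ← h1, ← Finset.sum_filter]
    rw [Set.ncard_eq_toFinset_card' , Finset.card_eq_sum_ones, Nat.cast_sum]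
    symm
    rw [← Finset.sum_filter_add_sum_filter_not _ (fun z => A.r x z)]
    refine Eq.trans (congrArg₂ (· + ·) rfl (Finset.sum_eq_zero fun z hz => ?_)) (Eq.trans (add_zero _) ?_)
    · simp only [Finset.mem_filter] at hz
      simp [hz.2]
    symm
    refine Finset.sum_bij (fun b _ => b * q) ?_ ?_ ?_ ?_
    · intro b hb
      simp only [Set.mem_toFinset, Set.mem_ofPred_eq] at hb
      simp [hcube b hb.1 q hq, hb.2]
    · intro b _ c _ h
      exact mul_right_cancel h
    · intro z hz
      simp only [Finset.mem_filter, Finset.mem_univ, true_and] at hz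
      obtain ⟨b, hb, r, hr, rfl⟩ := hs.exists_mul z
      rw [hcube b hb r hr] at hz
      obtain ⟨rfl, hz⟩ := hz
      exact ⟨b, by simp [hb, hz], rfl⟩
    · intro b hb
      simp only [Set.mem_toFinset, Set.mem_ofPred_eq] at hb
      simp [hb.2]
  · intro z _
    obtain ⟨b, hb, r, hr, rfl⟩ := hs.exists_mul z
    rw [hcube b hb r hr, if_neg]
    intro h
    exact ha1 (hs.ext (one_mem H) ha hr hq (by simpa using h)).1.symm

theorem locSchur_or_sat_of_two (hs : IsSplit H P 2)
    (ihU : ∀ (U : Subgroup G) (hU : A.Sat U), U ≠ ⊤ → (A.res U hU).LocSchur)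
    (ihL : ∀ (L : Subgroup G) (hL : A.Sat L), L ≠ ⊥ → (A.quo L hL).LocSchur)
    (hH : A.Sat H) : A.LocSchur ∨ A.Sat P := by
  classical
  by_cases hP : A.Sat P
  · exact Or.inr hP
  refine Or.inl ?_
  obtain ⟨q, hq, hq1⟩ := hs.exists_mem_P
  have hPq : ∀ r ∈ P, r ≠ 1 → r = q := by
    intro r hr hr1
    have hle : Nat.card P ≤ 3 := by rw [hs.card_P]; norm_num
    rcases eq_one_or_of_card_le_three hle hq hr hq1 with h | h | h
    · exact absurd h hr1
    · exact h
    · rw [h]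
      have := hs.pow_P hq
      rw [pow_two] at this
      exact (eq_inv_of_mul_eq_one_left this).symm
  have hqq : q * q = 1 := by rw [← pow_two]; exact hs.pow_P hq
  have hxq : ∀ x, x ∉ H → ∃ b ∈ H, b * q = x := by
    intro x hx
    obtain ⟨b, hb, r, hr, rfl⟩ := hs.exists_mul x
    refine ⟨b, hb, ?_⟩
    rw [hPq r hr fun h => hx (by simpa [h] using hb)]
  obtain ⟨a, ha, ha1, haq⟩ : ∃ a ∈ H, a ≠ 1 ∧ A.r q (a * q) := by
    by_contra! hn
    refine hP (hs.sat_P_of_linked hH fun a ha hl => ?_)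
    by_contra ha1
    obtain ⟨r, hr, hr1, s, hs', hs1, h⟩ := hl
    rw [hPq r hr hr1, hPq s hs' hs1, one_mul] at h
    exact hn a ha ha1 h
  have h3 := fun x => hs.three_dvd_ncard hq ha ha1 haq x
  set S : Set G := {b | b ∈ H ∧ A.r q (b * q)} with hS
  have hinv : ∀ b ∈ S, b⁻¹ ∈ S := fun b hb => ⟨inv_mem hb.1, by
    have := hs.inv_rel (one_mem H) hb.1 hq hq (by simpa using hb.2)
    simpa using this⟩
  have hodd : ¬ 2 ∣ S.ncard := by
    rw [← ZMod.natCast_eq_zero_iff, Set.ncard_eq_toFinset_card _ S.toFinite]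
    have h1 : (1 : G) ∈ S.toFinite.toFinset := by simp [hS, SRel.refl]
    rw [← Finset.insert_erase h1, Finset.card_insert_of_notMem (by simp)]
    have : ((S.toFinite.toFinset.erase 1).card : ZMod 2) = 0 := by
      rw [Finset.card_eq_sum_ones, Nat.cast_sum]
      refine Finset.sum_involution (fun b _ => b⁻¹) (fun b _ => by decide) ?_ ?_ ?_
      · intro b hb _ h
        have hb' := Finset.mem_erase.1 hb
        have hbS : b ∈ S := by simpa using hb'.2
        refine hb'.1 ?_
        have h3 := hs.pow_H b hbS.1
        have h2 : b * b = 1 := by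
          nth_rewrite 1 [← h]; simp
        rwa [pow_succ, pow_two, h2, one_mul] at h3
      · intro b hb
        simp only [Finset.mem_erase, Set.Finite.mem_toFinset] at hb ⊢
        exact ⟨by simpa using hb.1, hinv b hb.2⟩
      · intro b _; exact inv_inv b
    rw [Nat.cast_add, this]
    simp
  have hSH : S ⊆ H := fun b hb => hb.1
  have hcard : S.ncard ≤ Nat.card H := by
    rw [← SetLike.coe_sort_coe, Nat.card_coe_set_eq]
    exact Set.ncard_le_ncard hSH (Set.toFinite _)
  have hpos : 0 < S.ncard := (Set.ncard_pos S.toFinite).2 ⟨1, by simp [hS, SRel.refl]⟩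
  have hH9 := hs.card_mem (le_refl H)
  simp only [Finset.mem_insert, Finset.mem_singleton] at hH9
  have h3S : 3 ∣ S.ncard := h3 q
  have hS39 : S.ncard = 3 ∨ S.ncard = Nat.card H := by omega
  have hHbot : H ≠ ⊥ := by
    rintro rfl
    exact ha1 (Subgroup.mem_bot.1 ha)
  rcases hS39 with hS3 | hS9
  swap
  · have hSH' : S = H := Set.eq_of_subset_of_ncard_le hSH (by
      rw [hS9, ← SetLike.coe_sort_coe, Nat.card_coe_set_eq]) (Set.toFinite _)
    have hall : ∀ b ∈ H, A.r q (b * q) := fun b hb => by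
      have : b ∈ S := by rw [hSH']; exact hb
      exact this.2
    refine hs.locSchur_of_periodic ihU ihL hH hH le_rfl hHbot fun x hx c hc => ?_
    obtain ⟨b, hb, rfl⟩ := hxq x hx
    rw [mul_right_comm]
    exact SRel.trans (SRel.symm (hall b hb)) (hall _ (mul_mem hb hc))
  have ha3 : Nat.card (Subgroup.zpowers a) = 3 := by
    rw [Nat.card_zpowers]
    exact orderOf_eq_prime (hs.pow_H a ha) ha1
  set C := Subgroup.zpowers a with hC
  have haC : a ∈ C := Subgroup.mem_zpowers a
  have hCH : C ≤ H := by simpa [hC] using ha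
  have hCS : (C : Set G) = S := by
    refine Set.eq_of_subset_of_ncard_le (fun c hc => ?_) (by
      rw [hS3, ← Nat.card_coe_set_eq]; exact ha3.ge) S.toFinite
    have haS : a ∈ S := ⟨ha, haq⟩
    rcases eq_one_or_of_card_le_three ha3.le haC hc ha1 with rfl | rfl | rfl
    · simp [hS, SRel.refl]
    · exact haS
    · exact hinv _ haS
  have hCr : ∀ c, c ∈ C → A.r q (c * q) := fun c hc => by
    have : c ∈ S := hCS ▸ hc
    exact this.2
  have hrC : ∀ b ∈ H, A.r q (b * q) → b ∈ C := fun b hb h => by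
    have : b ∈ S := ⟨hb, h⟩
    rwa [← hCS] at this
  have hCs : A.Sat C := by
    intro x y hxy hx
    obtain ⟨u, hu, v, hv, rfl⟩ := ((sat_class (A := A) q).mul (sat_class q)) x y hxy
      ⟨x * q, hCr x hx, q, SRel.refl q, by simp [mul_assoc, hqq]⟩
    have hqH : q ∉ H := fun h => hq1 (hs.eq_one h hq)
    obtain ⟨b, hb, rfl⟩ := hxq u fun h => hqH (hH _ _ (SRel.symm hu) h)
    obtain ⟨c, hc, rfl⟩ := hxq v fun h => hqH (hH _ _ (SRel.symm hv) h)
    beta_reduce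
    rw [mul_mul_mul_comm, hqq, mul_one]
    exact mul_mem (hrC b hb hu) (hrC c hc hv)
  have hCbot : C ≠ ⊥ := by
    intro h
    rw [h, Subgroup.mem_bot] at haC
    exact ha1 haC
  refine hs.locSchur_of_periodic ihU ihL hH hCs hCH hCbot fun x hx c hc => ?_
  obtain ⟨b, hb, rfl⟩ := hxq x hx
  rw [mul_right_comm]
  by_cases hbC : b ∈ C
  · exact SRel.trans (SRel.symm (hCr b hbC)) (hCr _ (mul_mem hbC hc))
  set k := Nat.card {g : G // g ∈ {y | A.r (b * q) y} ∧ (b * q) / g ∈ (C : Set G)} with hk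
  have hcount : ∀ d ∈ H, A.r (b * q) (d * q) →
      {e | e / d ∈ C ∧ A.r (b * q) (e * q)}.ncard = k := by
    intro d _ hbd
    rw [hk, (sat_class (A := A) (b * q)).count hCs hbd,
      ← Set.ncard_image_of_injective _ (mul_left_injective q), ← Nat.card_coe_set_eq]
    refine Eq.trans (congrArg Nat.card (congrArg Set.Elem ?_)) rfl
    ext g
    simp only [Set.mem_image, Set.mem_ofPred_eq, SetLike.mem_coe]
    constructor
    · rintro ⟨e, ⟨h1, h2⟩, rfl⟩
      exact ⟨h2, by rw [mul_div_mul_right_eq_div]; exact C.div_mem_comm_iff.1 h1⟩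
    · rintro ⟨h1, h2⟩
      refine ⟨g / q, ⟨?_, by simpa using h1⟩, by simp⟩
      rw [C.div_mem_comm_iff]
      rwa [div_div_eq_mul_div]
  have hT := h3 (b * q)
  have hsplit : {e | e ∈ H ∧ A.r (b * q) (e * q)} =
      {e | e / b ∈ C ∧ A.r (b * q) (e * q)} ∪ {e | e / b⁻¹ ∈ C ∧ A.r (b * q) (e * q)} := by
    ext e
    simp only [Set.mem_ofPred_eq, Set.mem_union, div_inv_eq_mul]
    constructor
    · rintro ⟨he, her⟩
      have heC : e ∉ C := fun h => hbC (hrC b hb (SRel.trans (hCr e h) (SRel.symm her)))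
      rcases div_or_mul_mem_of_relIndex_le_three (hs.relIndex_le_three hCH hCbot) b hb e he with
        h | h | h | h
      · exact absurd h hbC
      · exact absurd h heC
      · exact Or.inl ⟨h, her⟩
      · exact Or.inr ⟨h, her⟩
    · rintro (⟨h, h'⟩ | ⟨h, h'⟩)
      · exact ⟨by simpa using mul_mem (hCH h) hb, h'⟩
      · exact ⟨by simpa using mul_mem (hCH h) (inv_mem hb), h'⟩
  have hdisj : Disjoint {e | e / b ∈ C ∧ A.r (b * q) (e * q)}
      {e | e / b⁻¹ ∈ C ∧ A.r (b * q) (e * q)} := by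
    rw [Set.disjoint_left]
    rintro e ⟨h1, -⟩ ⟨h2, -⟩
    have h4 := mul_mem (div_mem h2 h1) (div_mem h2 h1)
    have h5 := hs.pow_H b hb
    refine hbC ?_
    have : e / b⁻¹ / (e / b) * (e / b⁻¹ / (e / b)) = b ^ 3 * b := by
      rw [div_div_div_cancel_left, div_inv_eq_mul]
      simp only [pow_succ, pow_zero, one_mul, mul_assoc]
    rwa [this, h5, one_mul] at h4
  rw [hsplit, Set.ncard_union_eq hdisj (Set.toFinite _) (Set.toFinite _),
    hcount b hb (SRel.refl _)] at hT
  have h2nd : {e | e / b⁻¹ ∈ C ∧ A.r (b * q) (e * q)}.ncard = 0 ∨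
      {e | e / b⁻¹ ∈ C ∧ A.r (b * q) (e * q)}.ncard = k := by
    rcases Set.eq_empty_or_nonempty {e | e / b⁻¹ ∈ C ∧ A.r (b * q) (e * q)} with h | ⟨d, hd, hd'⟩
    · left; rw [h, Set.ncard_empty]
    · right
      have hdH : d ∈ H := by simpa using mul_mem (hCH hd) (inv_mem hb)
      rw [← hcount d hdH hd']
      congr 1
      ext e
      simp only [Set.mem_ofPred_eq]
      refine and_congr_left fun _ => ?_
      refine ⟨fun h => ?_, fun h => ?_⟩
      · simpa using div_mem h hd
      · simpa [div_mul_eq_mul_div, mul_div_assoc] using mul_mem h hd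
  have hsub : {e | e / b ∈ C ∧ A.r (b * q) (e * q)} ⊆ (b * ·) '' (C : Set G) := by
    rintro e ⟨h, -⟩
    exact ⟨_, h, by simp⟩
  have hC3 : ((b * ·) '' (C : Set G)).ncard = 3 := by
    rw [Set.ncard_image_of_injective _ (mul_right_injective b), ← Nat.card_coe_set_eq]
    exact ha3
  have hkle := Set.ncard_le_ncard hsub (Set.toFinite _)
  rw [hC3] at hkle
  have hk1 := hcount b hb (SRel.refl _)
  have hkpos : 0 < k := by
    rw [← hk1]
    refine (Set.ncard_pos (Set.toFinite _)).2 ⟨b, ?_⟩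
    simp [SRel.refl]
  have hk3 : k = 3 := by omega
  have := Set.eq_of_subset_of_ncard_le hsub (by rw [hC3, hk1, hk3]) (Set.toFinite _)
  have hmem : b * c ∈ {e | e / b ∈ C ∧ A.r (b * q) (e * q)} := by
    rw [this]; exact ⟨c, hc, rfl⟩
  exact hmem.2

end IsSplit

namespace SRel
variable {G : Type*} [CommGroup G]

/-- The basic sets of `A` match the punctured coset `aP` with `bP` through the `k`-th power map. -/
def Twist (A : SRel G) (P : Subgroup G) (k : ℕ) (a b : G) : Prop :=
  ∀ q ∈ P, q ≠ 1 → A.r (a * q) (b * q ^ k)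

/-- The structure constants of the relation `r`. -/
noncomputable def structConst {H : Type*} [Group H] (r : H → H → Prop) (a b x : H) : ℕ :=
  Nat.card {g : H // r a g ∧ r b (x / g)}

/-- An algebraic automorphism of an S-ring, presented as a relation between points. -/
structure Matching {H : Type*} [CommGroup H] (B : SRel H) (τ : H → H → Prop) : Prop where
  left : ∀ a, ∃ b, τ a b
  right : ∀ b, ∃ a, τ a b
  rel : ∀ a b a' b', τ a b → τ a' b' → (B.r a a' ↔ B.r b b')
  trans : ∀ a b c, τ a b → B.r b c → τ a c
  one : τ 1 1
  inv : ∀ a b, τ a b → τ a⁻¹ b⁻¹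
  count : ∀ a c b d x y, τ a c → τ b d → τ x y →
    structConst B.r a b x = structConst B.r c d y

/-- Every algebraic automorphism is induced by group endomorphisms. -/
def Rigid {H : Type*} [CommGroup H] (B : SRel H) : Prop :=
  ∀ τ : H → H → Prop, B.Matching τ → ∀ a b, τ a b → ∃ g : H →* H, g a = b ∧ ∀ x, τ x (g x)

end SRel

namespace IsSplit
open SRel
variable {G : Type*} [CommGroup G] {H P : Subgroup G} {p : ℕ} {A : SRel G}

lemma orderOf_eq (hs : IsSplit H P p) {s : P} (h : s ≠ 1) : orderOf s = p := by
  have : Fact p.Prime := ⟨hs.prime⟩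
  refine orderOf_eq_prime ?_ h
  rw [← hs.card_P]; exact pow_card_eq_one'

lemma sum_P_pow [Fintype P] (hs : IsSplit H P p) {R : Type*} [AddCommMonoid R] (F : P → R) {s : P}
    (h : s ≠ 1) : ∑ t, F t = ∑ k ∈ Finset.range p, F (s ^ k) := by
  classical
  have : Fact p.Prime := ⟨hs.prime⟩
  have h1 := IsCyclic.image_range_orderOf (a := s)
    fun x => mem_zpowers_of_prime_card (p := p) hs.card_P h
  rw [hs.orderOf_eq h] at h1
  rw [← h1, Finset.sum_image]
  intro i hi j hj hij
  refine pow_injOn_Iio_orderOf ?_ ?_ hij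
  · simpa [hs.orderOf_eq h] using hi
  · simpa [hs.orderOf_eq h] using hj

variable [Finite G]

lemma rel_of_rel_mul (hs : IsSplit H P p) (hH : A.Sat H) (hP : A.Sat P) {a b q r : G}
    (ha : a ∈ H) (hb : b ∈ H) (hq : q ∈ P) (hr : r ∈ P) (h : A.r (a * q) (b * r)) : A.r a b := by
  obtain ⟨c, hc, s, hs', hcs⟩ := (sat_class (A := A) a).mul hP _ _ h ⟨a, refl a, q, hq, rfl⟩
  have hcH : c ∈ H := hH _ _ hc ha
  obtain ⟨rfl, -⟩ := hs.ext hcH hb hs' hr hcs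
  exact hc

lemma twist_of_rel (hs : IsSplit H P p) {a b q : G} {k : ℕ} (ha : a ∈ H) (hb : b ∈ H)
    (hq : q ∈ P) (hq1 : q ≠ 1) (h : A.r (a * q) (b * q ^ k)) : A.Twist P k a b := by
  intro s hs' hs1
  obtain ⟨j, hj, rfl⟩ := hs.exists_pow hq hs' hq1 hs1
  rw [pow_right_comm]
  exact hs.pow_rel hj ha hb hq (pow_mem hq k) h

lemma rel_of_twist (hs : IsSplit H P p) (hH : A.Sat H) (hP : A.Sat P) {a b : G} {k : ℕ}
    (ha : a ∈ H) (hb : b ∈ H) (h : A.Twist P k a b) : A.r a b := by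
  obtain ⟨q, hq, hq1⟩ := hs.exists_mem_P
  exact hs.rel_of_rel_mul hH hP ha hb hq (pow_mem hq k) (h q hq hq1)

lemma rel_pow_of_twist (hs : IsSplit H P p) (hH : A.Sat H) (hP : A.Sat P) {a b q : G} {k : ℕ}
    (ha : a ∈ H) (hb : b ∈ H) (h : A.Twist P k a b) (hq : q ∈ P) : A.r q (q ^ k) := by
  by_cases hq1 : q = 1
  · simp [hq1, SRel.refl]
  obtain ⟨c, hc, s, hs', hcs⟩ := hH.mul (sat_class (A := A) q) _ _ (h q hq hq1) ⟨a, ha, q, refl q, rfl⟩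
  obtain ⟨-, rfl⟩ := hs.ext hc hb (hP _ _ hs' hq) (pow_mem hq k) hcs
  exact hs'

lemma exists_rel_of_rel (hH : A.Sat H) {q r c : G} (hc : c ∈ H) (h : A.r q r) : ∃ d ∈ H, A.r (c * q) (d * r) := by
  obtain ⟨d, hd, h'⟩ := (quo_r (A := A) hH (c * q) r).1 <| by
    have : ((c * q : G) : G ⧸ H) = (q : G ⧸ H) := by
      rw [mul_comm]
      exact (QuotientGroup.mk_mul_of_mem q hc)
    rw [this]
    exact (quo_r hH q r).2 ⟨1, one_mem H, by simpa using h⟩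
  exact ⟨d, hd, by rwa [mul_comm d]⟩

lemma exists_twist_right (hs : IsSplit H P p) (hH : A.Sat H) (hP : A.Sat P) {a b : G} {k : ℕ}
    (ha : a ∈ H) (hb : b ∈ H) (h : A.Twist P k a b) {c : G} (hc : c ∈ H) :
    ∃ d ∈ H, A.Twist P k c d := by
  obtain ⟨q, hq, hq1⟩ := hs.exists_mem_P
  obtain ⟨d, hd, h'⟩ := exists_rel_of_rel hH hc
    (hs.rel_pow_of_twist hH hP ha hb h hq)
  exact ⟨d, hd, hs.twist_of_rel hc hd hq hq1 h'⟩

lemma exists_twist_left (hs : IsSplit H P p) (hH : A.Sat H) (hP : A.Sat P) {a b : G} {k : ℕ}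
    (ha : a ∈ H) (hb : b ∈ H) (h : A.Twist P k a b) {c : G} (hc : c ∈ H) :
    ∃ d ∈ H, A.Twist P k d c := by
  obtain ⟨q, hq, hq1⟩ := hs.exists_mem_P
  obtain ⟨d, hd, h'⟩ := exists_rel_of_rel hH hc
    (SRel.symm (hs.rel_pow_of_twist hH hP ha hb h hq))
  exact ⟨d, hd, hs.twist_of_rel hd hc hq hq1 (SRel.symm h')⟩

lemma coprime_of_twist (hs : IsSplit H P p) (hH : A.Sat H) (hP : A.Sat P) {a b : G} {k : ℕ}
    (ha : a ∈ H) (hb : b ∈ H) (h : A.Twist P k a b) : p.Coprime k := by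
  rw [hs.prime.coprime_iff_not_dvd]
  rintro ⟨j, rfl⟩
  obtain ⟨q, hq, hq1⟩ := hs.exists_mem_P
  have := hs.rel_pow_of_twist hH hP ha hb h hq
  rw [pow_mul, hs.pow_P hq, one_pow] at this
  exact hq1 (SRel.eq_one this)

lemma twist_rel_iff (hs : IsSplit H P p) (hH : A.Sat H) (hP : A.Sat P) {a b a' b' : G} {k : ℕ}
    (ha : a ∈ H) (hb : b ∈ H) (h : A.Twist P k a b) (h' : A.Twist P k a' b') :
    A.Twist P 1 a a' ↔ A.Twist P 1 b b' := by
  have hk := hs.coprime_of_twist hH hP ha hb h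
  simp only [SRel.Twist, pow_one] at *
  constructor
  · intro h1 q hq hq1
    obtain ⟨r, hr, hr1⟩ := hs.exists_mem_P
    obtain ⟨r, hr, rfl, hr1⟩ : ∃ r ∈ P, r ^ k = q ∧ r ≠ 1 := by
      obtain ⟨m, hm⟩ := (powCoprime (G := P) (n := k) (by rwa [hs.card_P])).surjective ⟨q, hq⟩
      have hm' : (m : G) ^ k = q := congrArg Subtype.val hm
      exact ⟨m, m.2, hm', fun h => hq1 (by rw [← hm', h, one_pow])⟩
    exact SRel.trans (SRel.symm (h r hr hr1)) (SRel.trans (h1 r hr hr1) (h' r hr hr1))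
  · intro h1 q hq hq1
    exact SRel.trans (h q hq hq1) (SRel.trans (h1 _ (pow_mem hq k) (hs.pow_ne_one hk hq hq1))
      (SRel.symm (h' q hq hq1)))

/-- A class function whose Fourier coefficient along `P` is the indicator of a twist class. -/
lemma exists_classFn [Fintype P] (hs : IsSplit H P p) (hH : A.Sat H) (hP : A.Sat P) (χ : P →* ℂ)
    (hχ : ∀ s, χ s = 1 → s = 1) {a : G} (ha : a ∈ H) : ∃ f : G → ℂ, A.IsClassFn f ∧
      ∀ b ∈ H, ∑ q : P, f (b * q) * χ q = ({b | A.Twist P 1 a b} : Set G).indicator 1 b := by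
  classical
  obtain ⟨q₀, hq₀, hq₁⟩ := hs.exists_mem_P
  let cl : G → G → ℂ := fun x => ({y | A.r x y} : Set G).indicator 1
  have hcl : ∀ x, A.IsClassFn (cl x) := fun x => isClassFn_indicator (sat_class x)
  let E : G → ℂ := fun b => ∑ t : P, if t = 1 then 0 else cl (a * q₀) (b * t)
  let f₁ : G → ℂ := fun x => ∑ s : P, if s = 1 then 0 else χ s⁻¹ * cl (a * s) x
  let f₂ : G → ℂ := fun x => if x ∈ H then E x else 0
  have hf₁ : A.IsClassFn f₁ := by
    intro x y h
    refine Finset.sum_congr rfl fun s _ => ?_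
    rw [hcl _ x y h]
  have hE : ∀ b ∈ H, ∀ c ∈ H, A.r b c → E b = E c := by
    intro b hb c hc h
    refine hs.sum_eq_of_linked (hcl (a * q₀)) hb hc ?_
    obtain ⟨d, hd, h'⟩ := (quo_r (A := A) hP (b * q₀) c).1 <| by
      rw [QuotientGroup.mk_mul_of_mem b hq₀]
      exact (quo_r hP b c).2 ⟨1, one_mem P, by simpa using h⟩
    refine ⟨q₀, hq₀, hq₁, d, hd, ?_, h'⟩
    rintro rfl
    rw [mul_one] at h'
    exact hq₁ ((hs.mul_mem_H hb hq₀).1 (hH _ _ (SRel.symm h') hc))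
  have hf₂ : A.IsClassFn f₂ := by
    intro x y h
    simp only [f₂]
    by_cases hx : x ∈ H
    · have hy : y ∈ H := hH x y h hx
      rw [if_pos hx, if_pos hy, hE x hx y hy h]
    · have hy : y ∉ H := fun hy => hx (hH y x (SRel.symm h) hy)
      rw [if_neg hx, if_neg hy]
  have hpC : (p : ℂ) ≠ 0 := Nat.cast_ne_zero.2 hs.prime.ne_zero
  refine ⟨fun x => (p : ℂ)⁻¹ * (f₁ x + f₂ x), fun x y h => by beta_reduce; rw [hf₁ x y h, hf₂ x y h], ?_⟩
  intro b hb
  have htw : ∀ s : P, s ≠ 1 → ∀ k : ℕ, cl (a * s) (b * (s : G) ^ k) =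
      if A.Twist P k a b then 1 else 0 := by
    intro s hs1 k
    have hs1' : (s : G) ≠ 1 := fun h => hs1 (Subtype.ext h)
    simp only [cl, Set.indicator_apply, Set.mem_ofPred_eq, Pi.one_apply]
    congr 1
    exact propext ⟨fun h => hs.twist_of_rel ha hb s.2 hs1' h, fun h => h s s.2 hs1'⟩
  have hcl1 : ∀ s : P, s ≠ 1 → cl (a * s) b = 0 := by
    intro s hs1
    refine Set.indicator_of_notMem (fun h => hs1 ?_) _
    exact Subtype.ext ((hs.mul_mem_H ha s.2).1 (hH _ _ (SRel.symm h) hb))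
  have hEv : E b = ∑ k ∈ Finset.range p, if A.Twist P k a b then 1 else 0 := by
    have hne : (⟨q₀, hq₀⟩ : P) ≠ 1 := fun h => hq₁ (congrArg Subtype.val h)
    rw [← Finset.sum_congr rfl fun k _ => htw ⟨q₀, hq₀⟩ hne k]
    refine Eq.trans ?_ (hs.sum_P_pow (fun t : P => cl (a * q₀) (b * t)) hne)
    refine Finset.sum_congr rfl fun t _ => ?_
    split_ifs with h
    · subst h
      simpa using (hcl1 _ hne).symm
    · rfl
  have h2 : ∑ q : P, f₂ (b * q) * χ q = E b := by
    rw [Finset.sum_eq_single (1 : P)]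
    · simp [f₂, hb]
    · intro q _ hq
      have : b * (q : G) ∉ H := fun h => hq (Subtype.ext ((hs.mul_mem_H hb q.2).1 h))
      simp [f₂, this]
    · simp
  have hin : ∀ k ∈ Finset.range p, (∑ s : P, if s = 1 then 0 else χ (s⁻¹ * s ^ k)) =
      (if k = 1 then (p : ℂ) else 0) - 1 := by
    intro k hk
    let ψ : P →* ℂ := χ.comp ((MonoidHom.id P)⁻¹ * powMonoidHom k)
    have hψ : ∀ s, ψ s = χ (s⁻¹ * s ^ k) := fun s => rfl
    have h3 : (∑ s : P, if s = 1 then 0 else χ (s⁻¹ * s ^ k)) = ∑ s, ψ s - 1 := by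
      rw [eq_sub_iff_add_eq, ← Finset.sum_erase_add _ _ (Finset.mem_univ (1 : P)),
        ← Finset.sum_erase_add (a := (1 : P)) (f := ψ) _ (Finset.mem_univ (1 : P))]
      simp only [↓reduceIte, add_zero, map_one]
      congr 1
      refine Finset.sum_congr rfl fun s hs => ?_
      rw [if_neg (Finset.ne_of_mem_erase hs), hψ]
    rw [h3, sum_hom_units]
    congr 1
    have hiff : ψ = 1 ↔ k = 1 := by
      constructor
      · intro h
        have hne : (⟨q₀, hq₀⟩ : P) ≠ 1 := fun h => hq₁ (congrArg Subtype.val h)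
        have h4 := hχ _ ((hψ _).symm.trans (DFunLike.congr_fun h ⟨q₀, hq₀⟩))
        rw [inv_mul_eq_one] at h4
        have := pow_injOn_Iio_orderOf (x := (⟨q₀, hq₀⟩ : P)) (x₁ := 1) (x₂ := k)
          (by simpa [hs.orderOf_eq hne] using hs.prime.one_lt)
          (by simpa [hs.orderOf_eq hne] using hk) (by simpa using h4)
        exact this.symm
      · rintro rfl
        ext s
        simp [hψ]
    simp only [hiff]
    split_ifs
    · rw [← Nat.card_eq_fintype_card, hs.card_P]
    · simp
  have h1 : ∑ q : P, f₁ (b * q) * χ q =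
      ∑ k ∈ Finset.range p, (if A.Twist P k a b then 1 else 0) *
        ((if k = 1 then (p : ℂ) else 0) - 1) := by
    refine Eq.trans ?_ (Finset.sum_congr rfl fun k hk => congrArg _ (hin k hk))
    simp only [f₁, Finset.sum_mul, Finset.mul_sum]
    rw [Finset.sum_comm, Finset.sum_comm (s := Finset.range p)]
    refine Finset.sum_congr rfl fun s _ => ?_
    by_cases hs1 : s = 1
    · simp [hs1]
    simp only [if_neg hs1]
    rw [hs.sum_P_pow _ hs1]
    refine Finset.sum_congr rfl fun k _ => ?_
    rw [← htw s hs1 k, map_mul]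
    push_cast
    ring
  simp only [mul_assoc, ← Finset.mul_sum, add_mul, Finset.sum_add_distrib]
  rw [h1, h2, hEv, ← Finset.sum_add_distrib]
  rw [Finset.sum_congr rfl (g := fun k => if k = 1 then
    (if A.Twist P 1 a b then (p : ℂ) else 0) else 0)]
  · rw [Finset.sum_ite_eq' (Finset.range p) 1, if_pos (Finset.mem_range.2 hs.prime.one_lt)]
    by_cases h : A.Twist P 1 a b <;> simp [h, hpC]
  · intro k _
    by_cases hk : k = 1
    · subst hk
      by_cases h : A.Twist P 1 a b <;> simp [h]
    · by_cases h : A.Twist P k a b <;> simp [h, hk]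

end IsSplit

namespace IsSplit
open SRel
variable {G : Type*} [CommGroup G] {H P : Subgroup G} {p : ℕ} {A : SRel G}

lemma exists_injective_char (hs : IsSplit H P p) : ∃ χ : P →* ℂ, ∀ s, χ s = 1 → s = 1 := by
  have : Fact p.Prime := ⟨hs.prime⟩
  have : Finite P := Nat.finite_of_card_ne_zero (by rw [hs.card_P]; exact hs.prime.ne_zero)
  obtain ⟨q, hq, hq1⟩ := hs.exists_mem_P
  have hne : (⟨q, hq⟩ : P) ≠ 1 := fun h => hq1 (congrArg Subtype.val h)
  have : NeZero (Monoid.exponent P) := ⟨Monoid.exponent_ne_zero_of_finite⟩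
  obtain ⟨φ, hφ⟩ := CommGroup.exists_apply_ne_one_of_hasEnoughRootsOfUnity P ℂ hne
  refine ⟨(Units.coeHom ℂ).comp φ, fun s h => ?_⟩
  by_contra hs1
  obtain ⟨j, hj⟩ := mem_zpowers_of_prime_card (p := p) (g' := ⟨q, hq⟩) hs.card_P hs1
  have h1 : φ s = 1 := Units.ext h
  exact hφ (by rw [← hj]; simp [h1])

lemma sum_conv [Fintype G] [Fintype H] [Fintype P] (hs : IsSplit H P p) {k : ℕ}
    (hk : p.Coprime k) (χ : P →* ℂ) (f h : G → ℂ) (x : H) :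
    ∑ q : P, (∑ g, f g * h (x * q ^ k / g)) * χ q =
      ∑ c : H, (∑ s : P, f (c * s ^ k) * χ s) *
        ∑ t : P, h ((x / c : H) * t ^ k) * χ t := by
  have hk' : (Nat.card P).Coprime k := by rwa [hs.card_P]
  have h1 : ∀ q : P, ∑ g, f g * h (x * q ^ k / g) =
      ∑ c : H, ∑ s : P, f (c * s ^ k) * h ((x / c : H) * ((q / s : P) : G) ^ k) := by
    intro q
    rw [hs.sum_eq]
    refine Finset.sum_congr rfl fun c _ => ?_
    rw [← Equiv.sum_comp (powCoprime hk')]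
    refine Finset.sum_congr rfl fun s _ => ?_
    have h2 : ((powCoprime hk' s : P) : G) = s ^ k := rfl
    rw [h2]
    congr 2
    push_cast
    rw [div_pow, mul_div_mul_comm]
  simp only [h1, Finset.sum_mul, Finset.mul_sum]
  rw [Finset.sum_comm]
  refine Finset.sum_congr rfl fun c _ => ?_
  rw [Finset.sum_comm]
  conv_rhs => rw [Finset.sum_comm]
  refine Finset.sum_congr rfl fun s _ => ?_
  rw [← Equiv.sum_comp (Equiv.mulRight s)]
  refine Finset.sum_congr rfl fun t _ => ?_
  rw [Equiv.coe_mulRight, mul_div_cancel_right, map_mul]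
  ring

variable [Finite G]

lemma structConst_twist (hs : IsSplit H P p) (hH : A.Sat H) (hP : A.Sat P) {k : ℕ}
    {a a' b b' x x' : H} (ha : A.Twist P k a a') (hb : A.Twist P k b b')
    (hx : A.Twist P k x x') :
    structConst (fun a b : H => A.Twist P 1 a b) a b x =
      structConst (fun a b : H => A.Twist P 1 a b) a' b' x' := by
  classical
  have := Fintype.ofFinite G
  have := Fintype.ofFinite H
  have := Fintype.ofFinite P
  have hk := hs.coprime_of_twist hH hP a.2 a'.2 ha
  obtain ⟨χ, hχ⟩ := hs.exists_injective_char
  obtain ⟨f, hf, hfa⟩ := hs.exists_classFn hH hP χ hχ a.2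
  obtain ⟨h, hh, hhb⟩ := hs.exists_classFn hH hP χ hχ b.2
  have htr : ∀ (f : G → ℂ) (a a' : H), A.Twist P k a a' → A.IsClassFn f →
      (∀ b ∈ H, ∑ q : P, f (b * q) * χ q =
        ({b | A.Twist P 1 a b} : Set G).indicator 1 b) →
      ∀ b ∈ H, ∑ q : P, f (b * q ^ k) * χ q =
        ({b | A.Twist P 1 a' b} : Set G).indicator 1 b := by
    intro f a a' ha hf hfa b hb
    obtain ⟨c, hc, hcb⟩ := hs.exists_twist_left hH hP a.2 a'.2 ha hb
    have h1 := hs.twist_rel_iff hH hP a.2 a'.2 ha hcb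
    have h2 : ({b | A.Twist P 1 a' b} : Set G).indicator (1 : G → ℂ) b =
        ({b | A.Twist P 1 a b} : Set G).indicator 1 c := by
      simp only [Set.indicator_apply, Set.mem_ofPred_eq, h1, Pi.one_apply]
    rw [h2, ← hfa c hc]
    refine Finset.sum_congr rfl fun q _ => ?_
    congr 1
    by_cases hq : q = 1
    · subst hq
      simpa using (hf _ _ (hs.rel_of_twist hH hP hc hb hcb)).symm
    · exact (hf _ _ (hcb q q.2 fun h => hq (Subtype.ext h))).symm
  have key : ∀ {a b x : H}, (structConst (fun a b : H => A.Twist P 1 a b) a b x : ℂ) =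
      ∑ c : H, ({b | A.Twist P 1 a b} : Set G).indicator 1 (c : G) *
        ({y | A.Twist P 1 b y} : Set G).indicator 1 ((x / c : H) : G) := by
    intro a b x
    rw [structConst, count_eq_sum (fun g : H => A.Twist P 1 a g) (fun g : H => A.Twist P 1 b g) x]
    refine Finset.sum_congr rfl fun c _ => ?_
    simp only [Set.indicator_apply, Set.mem_ofPred_eq, Pi.one_apply]
  have h1 := hs.sum_conv (k := 1) (by simp) χ f h x
  have h2 := hs.sum_conv hk χ f h x'
  have h3 : ∑ q : P, (∑ g, f g * h (x * (q : G) ^ 1 / g)) * χ q =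
      ∑ q : P, (∑ g, f g * h (x' * (q : G) ^ k / g)) * χ q := by
    refine Finset.sum_congr rfl fun q _ => ?_
    congr 1
    by_cases hq : q = 1
    · subst hq
      simpa using hf.conv hh _ _ (hs.rel_of_twist hH hP x.2 x'.2 hx)
    · rw [pow_one]
      exact hf.conv hh _ _ (hx q q.2 fun h => hq (Subtype.ext h))
  rw [h1, h2] at h3
  simp only [pow_one] at h3
  simp only [hfa _ (Subtype.prop _), hhb _ (Subtype.prop _), htr f a a' ha hf hfa _ (Subtype.prop _),
    htr h b b' hb hh hhb _ (Subtype.prop _)] at h3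
  exact_mod_cast key.trans (h3.trans key.symm)

/-- The S-ring on `H` whose basic sets are the twist classes. -/
def twistRel (hs : IsSplit H P p) (hH : A.Sat H) (hP : A.Sat P) : SRel H where
  r a b := A.Twist P 1 a b
  equiv := ⟨fun a q _ _ => by simpa using SRel.refl (A := A) _,
    fun h q hq hq1 => by simpa using SRel.symm (h q hq hq1),
    fun h h' q hq hq1 => SRel.trans (h q hq hq1) (by simpa using h' q hq hq1)⟩
  one a h := Subtype.ext (A.one _ (hs.rel_of_twist hH hP (one_mem H) a.2 h))
  inv a b h q hq hq1 := by
    simpa using hs.inv_rel a.2 b.2 hq hq (by simpa using h q hq hq1)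
  count a b x y h := by
    refine hs.structConst_twist hH hP (k := 1) ?_ ?_ h <;>
    exact fun q _ _ => by simpa using SRel.refl (A := A) _

lemma matching_twist (hs : IsSplit H P p) (hH : A.Sat H) (hP : A.Sat P) {k : ℕ} {a b : H}
    (h : A.Twist P k a b) : (hs.twistRel hH hP).Matching (fun a b : H => A.Twist P k a b) where
  left c := by
    obtain ⟨d, hd, h'⟩ := hs.exists_twist_right hH hP a.2 b.2 h c.2
    exact ⟨⟨d, hd⟩, h'⟩
  right c := by
    obtain ⟨d, hd, h'⟩ := hs.exists_twist_left hH hP a.2 b.2 h c.2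
    exact ⟨⟨d, hd⟩, h'⟩
  rel c d c' d' h h' := hs.twist_rel_iff hH hP c.2 d.2 h h'
  trans c d e h h' q hq hq1 := by
    have hk := hs.coprime_of_twist hH hP c.2 d.2 h
    exact SRel.trans (h q hq hq1)
      (by simpa using h' _ (pow_mem hq k) (hs.pow_ne_one hk hq hq1))
  one q hq _ := by simpa using hs.rel_pow_of_twist hH hP a.2 b.2 h hq
  inv c d h q hq hq1 := by
    simpa using hs.inv_rel c.2 d.2 hq (pow_mem hq k) (h q hq hq1)
  count c c' d d' x x' hc hd hx := hs.structConst_twist hH hP hc hd hx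

/-- When both factors are unions of basic sets, local schurity follows from rigidity of the
S-rings over `H`. -/
theorem locSchur_of_sat (hs : IsSplit H P p) (hH : A.Sat H) (hP : A.Sat P)
    (hR : ∀ B : SRel H, B.Rigid) : A.LocSchur := by
  have key : ∀ k : ℕ, ∀ a b : H, A.Twist P k a b → ∃ f : G →* G,
      (∀ q ∈ P, f (a * q) = b * q ^ k) ∧ ∀ x, A.r x (f x) := by
    intro k a b h
    obtain ⟨g, hg, hgx⟩ := hR (hs.twistRel hH hP) _ (hs.matching_twist hH hP h) a b h
    let f₀ : G → G := fun x => g (hs.equiv.symm x).1 * (hs.equiv.symm x).2 ^ k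
    have hf₀ : ∀ (c : H) (q : P), f₀ (c * q) = g c * q ^ k := by
      intro c q
      have : hs.equiv.symm (c * q) = (c, q) := (Equiv.symm_apply_eq _).2 rfl
      simp only [f₀, this]
    let f : G →* G := MonoidHom.mk' f₀ fun x y => by
      obtain ⟨c, hc, q, hq, rfl⟩ := hs.exists_mul x
      obtain ⟨d, hd, r, hr, rfl⟩ := hs.exists_mul y
      have h1 := hf₀ ⟨c, hc⟩ ⟨q, hq⟩
      have h2 := hf₀ ⟨d, hd⟩ ⟨r, hr⟩
      have h3 := hf₀ (⟨c, hc⟩ * ⟨d, hd⟩) (⟨q, hq⟩ * ⟨r, hr⟩)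
      simp only [Subgroup.coe_mul, map_mul, mul_pow] at h1 h2 h3
      rw [h1, h2, mul_mul_mul_comm, h3, mul_mul_mul_comm]
    have hf : ∀ c : H, ∀ q ∈ P, f (c * q) = g c * q ^ k := fun c q hq => hf₀ c ⟨q, hq⟩
    refine ⟨f, fun q hq => by rw [hf a q hq, hg], fun x => ?_⟩
    obtain ⟨c, hc, q, hq, rfl⟩ := hs.exists_mul x
    rw [hf ⟨c, hc⟩ q hq]
    by_cases hq1 : q = 1
    · subst hq1
      simpa using hs.rel_of_twist hH hP hc (g ⟨c, hc⟩).2 (hgx ⟨c, hc⟩)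
    · exact hgx ⟨c, hc⟩ q hq hq1
  intro x y hxy
  obtain ⟨a, ha, q, hq, rfl⟩ := hs.exists_mul x
  obtain ⟨b, hb, r, hr, rfl⟩ := hs.exists_mul y
  suffices ∃ k, A.Twist P k a b ∧ q ^ k = r by
    obtain ⟨k, h, rfl⟩ := this
    obtain ⟨f, h1, h2⟩ := key k ⟨a, ha⟩ ⟨b, hb⟩ h
    exact ⟨f, map_one f, h1 q hq, fun g h => by rw [← map_div]; exact h2 _⟩
  by_cases hq1 : q = 1
  · subst hq1
    have hr1 : r = 1 := (hs.mul_mem_H hb hr).1 (hH _ _ hxy (by simpa using ha))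
    subst hr1
    obtain ⟨q, hq, hq1⟩ := hs.exists_mem_P
    obtain ⟨r, hr, h'⟩ := (quo_r (A := A) hP (a * q) b).1 <| by
      rw [QuotientGroup.mk_mul_of_mem a hq]
      exact (quo_r hP a b).2 ⟨1, one_mem P, by simpa using hxy⟩
    have hr1 : r ≠ 1 := by
      rintro rfl
      rw [mul_one] at h'
      exact hq1 ((hs.mul_mem_H ha hq).1 (hH _ _ (SRel.symm h') hb))
    obtain ⟨k, -, -, h⟩ := hs.exists_twist ha hb hq hr hq1 hr1 h'
    exact ⟨k, h, one_pow k⟩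
  · have hr1 : r ≠ 1 := by
      rintro rfl
      rw [mul_one] at hxy
      exact hq1 ((hs.mul_mem_H ha hq).1 (hH _ _ (SRel.symm hxy) hb))
    obtain ⟨k, -, h1, h2⟩ := hs.exists_twist ha hb hq hr hq1 hr1 hxy
    exact ⟨k, h2, h1⟩

end IsSplit

/-- The property `f` holds below `n`. -/
noncomputable def allLt (f : ℕ → Bool) (n : ℕ) : Bool :=
  Nat.rec true (fun k ih => Bool.rec false ih (f k)) n

/-- The property `f` holds for some number below `n`. -/
noncomputable def anyLt (f : ℕ → Bool) (n : ℕ) : Bool :=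
  Nat.rec false (fun k ih => Bool.rec ih true (f k)) n

/-- The `i`-th digit of `l` to base `16`. -/
def digit (l i : ℕ) : ℕ := Nat.mod (Nat.shiftRight l (Nat.mul 4 i)) 16

/-- Exhaustive search over sequences of digits below `9`, of which the first `k` are already chosen
and coded in `l`. The `k`-th digit is restricted by `cand`, and the finished sequences are
tested by `leaf`. -/
noncomputable def searchAll (cand : ℕ → ℕ → ℕ → Bool) (leaf : ℕ → Bool) (n k l : ℕ) : Bool :=
  Nat.rec (fun _ l => leaf l) (fun _ ih k l => allLt (fun x => Bool.rec true
    (ih (Nat.succ k) (Nat.add l (Nat.mul x (Nat.pow 16 k)))) (cand k l x)) 9) n k l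

namespace Plane

/-- Points of the affine plane of order three are coded as `i + 3 * j`. -/
def sub (m n : ℕ) : ℕ :=
  Nat.add (Nat.mod (Nat.add m (Nat.mul 2 n)) 3)
    (Nat.mul 3 (Nat.mod (Nat.add (Nat.div m 3) (Nat.mul 2 (Nat.div n 3))) 3))

/-- The linear map with matrix columns `w₁` and `w₂`. -/
def lin (w₁ w₂ n : ℕ) : ℕ :=
  Nat.add (Nat.mod (Nat.add (Nat.mul n w₁) (Nat.mul (Nat.div n 3) w₂)) 3)
    (Nat.mul 3 (Nat.mod (Nat.add (Nat.mul n (Nat.div w₁ 3))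
      (Nat.mul (Nat.div n 3) (Nat.div w₂ 3))) 3))

noncomputable def cnt (l a b x n : ℕ) : ℕ :=
  Nat.rec 0 (fun g ih => Bool.rec ih (Bool.rec ih (Nat.succ ih)
    (Nat.beq (digit l (sub x g)) b)) (Nat.beq (digit l g) a)) n

noncomputable def compat (c d : ℕ) : Bool :=
  allLt (fun x => allLt (fun y => Bool.rec true
    (allLt (fun a => allLt (fun b => Nat.beq (cnt c a b x 9) (cnt d a b y 9)) 9) 9)
      (Nat.beq (digit c x) (digit d y))) 9) 9

noncomputable def findMap (c d a b : ℕ) : Bool :=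
  anyLt (fun w₁ => Bool.rec false
    (anyLt (fun w₂ => Bool.rec false
      (Bool.rec false (allLt (fun n => Nat.beq (digit c n) (digit d (lin w₁ w₂ n))) 9)
        (Nat.beq (lin w₁ w₂ a) b)) (Nat.beq (digit c 3) (digit d w₂))) 9)
    (Nat.beq (digit c 1) (digit d w₁))) 9

noncomputable def candMatch (c k l x : ℕ) : Bool :=
  and (and (Nat.beq (digit c x) x) (xor (Nat.beq k 0) (not (Nat.beq x 0))))
    (allLt (fun i => and
      (or (not (Nat.beq (sub 0 k) i)) (Nat.beq (digit c (sub 0 (digit l i))) x))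
      (or (Nat.ble k (sub k i))
        (not (Nat.beq (cnt c (digit l i) (digit l (sub k i)) x 9) 0)))) k)

noncomputable def candColor (k l x : ℕ) : Bool :=
  and (and (or (Nat.beq x k) (and (Nat.ble x k) (Nat.beq (digit l x) x)))
    (xor (Nat.beq k 0) (not (Nat.beq x 0))))
    (or (Nat.ble k (sub 0 k)) (allLt (fun j => or (Nat.ble k (sub 0 j))
      (not (xor (Nat.beq x (digit l j))
        (Nat.beq (digit l (sub 0 k)) (digit l (sub 0 j)))))) k))

noncomputable def leafMatch (c d : ℕ) : Bool := or (findMap c d 0 0) (not (compat c d))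

noncomputable def leafColor (c : ℕ) : Bool :=
  or (and (allLt (fun a => allLt (fun b =>
      or (not (Nat.beq (digit c a) (digit c b))) (findMap c c a b)) 9) 9)
    (searchAll (candMatch c) (leafMatch c) 9 0 0)) (not (compat c c))

set_option maxRecDepth 100000 in
theorem search_eq_true : searchAll candColor leafColor 9 0 0 = true := by decide +kernel

end Plane

lemma allLt_iff {f : ℕ → Bool} {n : ℕ} : allLt f n = true ↔ ∀ k < n, f k = true := by
  induction n with
  | zero => simp [allLt]
  | succ n ih =>
    have h : allLt f (n + 1) = Bool.rec false (allLt f n) (f n) := rfl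
    rw [h, Nat.forall_lt_succ_right, ← ih]
    cases f n <;> simp

lemma anyLt_iff {f : ℕ → Bool} {n : ℕ} : anyLt f n = true ↔ ∃ k < n, f k = true := by
  induction n with
  | zero => simp [anyLt]
  | succ n ih =>
    have h : anyLt f (n + 1) = Bool.rec (anyLt f n) true (f n) := rfl
    rw [h, Nat.exists_lt_succ_right, ← ih]
    cases f n <;> simp

lemma natBeq_iff {a b : ℕ} : Nat.beq a b = true ↔ a = b :=
  ⟨Nat.eq_of_beq_eq_true, fun h => h ▸ Nat.beq_refl a⟩

lemma natBeq_eq_false {a b : ℕ} : Nat.beq a b = false ↔ a ≠ b := by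
  rw [← Bool.not_eq_true, natBeq_iff]

lemma rec_true_iff {p q : Bool} : (Bool.rec true q p : Bool) = true ↔ (p = true → q = true) := by
  cases p <;> simp

lemma rec_false_iff {p q : Bool} : (Bool.rec false q p : Bool) = true ↔ (p = true ∧ q = true) := by
  cases p <;> simp

/-- The number with given digits to base `16`. -/
def ofDigits (F : ℕ → ℕ) : ℕ → ℕ
  | 0 => 0
  | k + 1 => ofDigits F k + F k * 16 ^ k

lemma ofDigits_lt {F : ℕ → ℕ} {k : ℕ} (hF : ∀ i < k, F i < 16) : ofDigits F k < 16 ^ k := by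
  induction k with
  | zero => simp [ofDigits]
  | succ k ih =>
    have h1 := ih fun i hi => hF i (by omega)
    have h2 := Nat.mul_le_mul_right (16 ^ k) (Nat.le_of_lt_succ (hF k (by omega)))
    rw [ofDigits, pow_succ]
    omega

lemma digit_ofDigits {F : ℕ → ℕ} {k i : ℕ} (hF : ∀ j < k, F j < 16) (hi : i < k) :
    digit (ofDigits F k) i = F i := by
  have key : ∀ l, digit l i = l / 16 ^ i % 16 := fun l => by
    change (l >>> (4 * i)) % 16 = _
    rw [Nat.shiftRight_eq_div_pow, pow_mul]; norm_num
  rw [key]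
  induction k with
  | zero => omega
  | succ k ih =>
    have h1 := ofDigits_lt (F := F) (k := k) fun j hj => hF j (by omega)
    rw [ofDigits]
    rcases Nat.lt_succ_iff_lt_or_eq.1 hi with hi | rfl
    · obtain ⟨m, rfl⟩ := Nat.exists_eq_add_of_lt hi
      rw [show F (i + m + 1) * 16 ^ (i + m + 1) = 16 ^ i * (16 * (F (i + m + 1) * 16 ^ m)) by ring,
        Nat.add_mul_div_left _ _ (by positivity), Nat.add_mul_mod_self_left]
      exact ih (fun j hj => hF j (by omega)) hi
    · rw [Nat.add_mul_div_right _ _ (by positivity), Nat.div_eq_of_lt h1, zero_add,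
        Nat.mod_eq_of_lt (hF i (by omega))]

lemma leaf_of_searchAll {cand : ℕ → ℕ → ℕ → Bool} {leaf : ℕ → Bool} {F : ℕ → ℕ} {N : ℕ}
    (hF : ∀ i < N, F i < 9) (hcand : ∀ i < N, cand i (ofDigits F i) (F i) = true)
    (h : searchAll cand leaf N 0 0 = true) : leaf (ofDigits F N) = true := by
  have key : ∀ n k, n + k = N → searchAll cand leaf n k (ofDigits F k) = true →
      leaf (ofDigits F N) = true := by
    intro n
    induction n with
    | zero =>
      intro k hk h
      obtain rfl : N = k := by omega
      exact h
    | succ n ih =>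
      intro k hk h
      have h1 : allLt (fun x => Bool.rec true
        (searchAll cand leaf n (k + 1) (ofDigits F k + x * 16 ^ k)) (cand k (ofDigits F k) x)) 9 =
          true := h
      have h2 := allLt_iff.1 h1 (F k) (hF k (by omega))
      rw [hcand k (by omega)] at h2
      exact ih (k + 1) (by omega) h2
  exact key N 0 rfl h

namespace Plane

lemma compat_iff {c d : ℕ} : compat c d = true ↔ ∀ x < 9, ∀ y < 9, digit c x = digit d y →
    ∀ a < 9, ∀ b < 9, cnt c a b x 9 = cnt d a b y 9 := by
  simp only [compat, allLt_iff, rec_true_iff, natBeq_iff]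

lemma findMap_iff {c d a b : ℕ} : findMap c d a b = true ↔ ∃ w₁ < 9, digit c 1 = digit d w₁ ∧
    ∃ w₂ < 9, digit c 3 = digit d w₂ ∧ lin w₁ w₂ a = b ∧
      ∀ n < 9, digit c n = digit d (lin w₁ w₂ n) := by
  simp only [findMap, allLt_iff, anyLt_iff, rec_false_iff, natBeq_iff]

variable {H : Type*} [CommGroup H]

/-- Coordinates on an elementary abelian group of order nine. -/
structure Frame (H : Type*) [CommGroup H] where
  b₁ : H
  b₂ : H
  pow : ∀ x : H, x ^ 3 = 1
  inj : ∀ m < 9, ∀ n < 9, b₁ ^ m * b₂ ^ (m / 3) = b₁ ^ n * b₂ ^ (n / 3) → m = n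
  surj : ∀ x, ∃ n < 9, b₁ ^ n * b₂ ^ (n / 3) = x

namespace Frame
variable (φ : Frame H)

/-- The point with a given code. -/
def pt (n : ℕ) : H := φ.b₁ ^ n * φ.b₂ ^ (n / 3)

include φ in
lemma pow_mod (x : H) (n : ℕ) : x ^ (n % 3) = x ^ n := by
  conv_rhs => rw [← Nat.mod_add_div n 3, pow_add, pow_mul, φ.pow, one_pow, mul_one]

lemma pt_add (a b : ℕ) : φ.pt (a % 3 + 3 * (b % 3)) = φ.b₁ ^ a * φ.b₂ ^ b := by
  rw [pt, show (a % 3 + 3 * (b % 3)) / 3 = b % 3 by omega, φ.pow_mod, pow_add, pow_mul, φ.pow,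
    one_pow, mul_one, φ.pow_mod]

include φ in
lemma inv_eq (x : H) : x⁻¹ = x ^ 2 := by
  rw [inv_eq_iff_mul_eq_one, ← pow_succ', φ.pow]

lemma pt_sub (m n : ℕ) : φ.pt (sub m n) = φ.pt m / φ.pt n := by
  refine (φ.pt_add (m + 2 * n) (m / 3 + 2 * (n / 3))).trans ?_
  rw [div_eq_mul_inv, φ.inv_eq, pt, pt, pow_add, pow_add, mul_pow, ← pow_mul, ← pow_mul,
    mul_comm n, mul_comm (n / 3)]
  exact mul_mul_mul_comm ..

lemma pt_lin (w₁ w₂ n : ℕ) : φ.pt (lin w₁ w₂ n) = φ.pt w₁ ^ n * φ.pt w₂ ^ (n / 3) := by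
  refine (φ.pt_add (n * w₁ + n / 3 * w₂) (n * (w₁ / 3) + n / 3 * (w₂ / 3))).trans ?_
  simp only [pt, pow_add, mul_pow, ← pow_mul, mul_comm n, mul_comm (n / 3)]
  exact mul_mul_mul_comm ..

lemma sub_lt (m n : ℕ) : sub m n < 9 := by
  change (m + 2 * n) % 3 + 3 * ((m / 3 + 2 * (n / 3)) % 3) < 9
  omega

lemma lin_lt (w₁ w₂ n : ℕ) : lin w₁ w₂ n < 9 := by
  change (n * w₁ + n / 3 * w₂) % 3 + 3 * ((n * (w₁ / 3) + n / 3 * (w₂ / 3)) % 3) < 9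
  omega

lemma pt_zero : φ.pt 0 = 1 := by simp [pt]

lemma pt_eq_one {n : ℕ} (hn : n < 9) : φ.pt n = 1 ↔ n = 0 :=
  ⟨fun h => φ.inj n hn 0 (by omega) (h.trans φ.pt_zero.symm), fun h => h ▸ φ.pt_zero⟩

lemma exists_hom (x y : H) : ∃ g : H →* H, ∀ n < 9, g (φ.pt n) = x ^ n * y ^ (n / 3) := by
  choose idx hlt hidx using φ.surj
  have h1 : ∀ n < 9, idx (φ.pt n) = n := fun n hn => φ.inj _ (hlt _) _ hn (hidx _)
  have h2 : ∀ u v, x ^ idx (u * v) * y ^ (idx (u * v) / 3) =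
      (x ^ idx u * y ^ (idx u / 3)) * (x ^ idx v * y ^ (idx v / 3)) := by
    intro u v
    have h3 : u * v = φ.pt ((idx u + idx v) % 3 + 3 * ((idx u / 3 + idx v / 3) % 3)) := by
      rw [pt_add]
      conv_lhs => rw [← hidx u, ← hidx v, mul_mul_mul_comm, ← pow_add, ← pow_add]
    rw [h3, h1 _ (by omega), show ∀ a b, (a % 3 + 3 * (b % 3)) / 3 = b % 3 by omega, φ.pow_mod,
      pow_add, pow_mul, φ.pow, one_pow, mul_one, φ.pow_mod, pow_add, pow_add]
    exact mul_mul_mul_comm ..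
  exact ⟨MonoidHom.mk' (fun u => x ^ idx u * y ^ (idx u / 3)) h2, fun n hn => by simp [h1 n hn]⟩

/-- The least code of a point related to the `n`-th one. -/
noncomputable def col (τ : H → H → Prop) (n : ℕ) : ℕ := sInf {m | τ (φ.pt m) (φ.pt n)}

lemma cnt_eq_card (l a b x n : ℕ) : cnt l a b x n =
    ((Finset.range n).filter fun g => digit l g = a ∧ digit l (sub x g) = b).card := by
  induction n with
  | zero => rfl
  | succ n ih =>
    have h : cnt l a b x (n + 1) = Bool.rec (cnt l a b x n)
      (Bool.rec (cnt l a b x n) (cnt l a b x n + 1) (Nat.beq (digit l (sub x n)) b))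
        (Nat.beq (digit l n) a) := rfl
    rw [h, Finset.range_add_one, Finset.filter_insert]
    rcases hA : Nat.beq (digit l n) a
    · simp [Nat.ne_of_beq_eq_false hA, ih]
    · rcases hB : Nat.beq (digit l (sub x n)) b
      · simp [Nat.ne_of_beq_eq_false hB, ih]
      · simp [Nat.eq_of_beq_eq_true hA, Nat.eq_of_beq_eq_true hB, ih]

lemma cnt_eq {l : ℕ} {p q : H → Prop} {a b : ℕ} (hp : ∀ n < 9, digit l n = a ↔ p (φ.pt n))
    (hq : ∀ n < 9, digit l n = b ↔ q (φ.pt n)) (x : ℕ) :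
    cnt l a b x 9 = Nat.card {g : H // p g ∧ q (φ.pt x / g)} := by
  classical
  rw [cnt_eq_card, ← Fintype.card_coe, ← Nat.card_eq_fintype_card]
  refine Nat.card_congr (Equiv.ofBijective (fun n => ⟨φ.pt n.1, ?_⟩) ⟨?_, ?_⟩)
  · obtain ⟨n, hn⟩ := n
    simp only [Finset.mem_filter, Finset.mem_range] at hn
    rw [← φ.pt_sub, ← hp n hn.1, ← hq _ (sub_lt _ _)]
    exact hn.2
  · rintro ⟨m, hm⟩ ⟨n, hn⟩ h
    simp only [Finset.mem_filter, Finset.mem_range] at hm hn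
    exact Subtype.ext (φ.inj m hm.1 n hn.1 (congrArg Subtype.val h))
  · rintro ⟨g, hg⟩
    obtain ⟨n, hn, rfl⟩ := φ.surj g
    change p (φ.pt n) ∧ q (φ.pt x / φ.pt n) at hg
    rw [← φ.pt_sub, ← hp n hn, ← hq _ (sub_lt _ _)] at hg
    exact ⟨⟨n, by simpa using ⟨hn, hg⟩⟩, rfl⟩

variable {φ} {B : SRel H} {τ : H → H → Prop}

lemma _root_.SRel.Matching.rel_left (hτ : B.Matching τ) {a a' b : H} (h : τ a b) (h' : B.r a a') :
    τ a' b := by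
  obtain ⟨c, hc⟩ := hτ.left a'
  exact hτ.trans _ _ _ hc (SRel.symm ((hτ.rel _ _ _ _ h hc).1 h'))

lemma _root_.SRel.matching_self [Finite H] (B : SRel H) : B.Matching B.r where
  left a := ⟨a, SRel.refl a⟩
  right a := ⟨a, SRel.refl a⟩
  rel a b a' b' h h' := by rw [SRel.r_iff_left h, SRel.r_iff_right h']
  trans a b c h h' := SRel.trans h h'
  one := SRel.refl 1
  inv a b h := B.inv a b h
  count a a' b b' x x' ha hb hx := by
    simp only [SRel.structConst, SRel.r_iff_left ha, SRel.r_iff_left hb]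
    exact B.count _ _ _ _ hx

lemma col_spec (hτ : B.Matching τ) (n : ℕ) :
    φ.col τ n < 9 ∧ τ (φ.pt (φ.col τ n)) (φ.pt n) := by
  obtain ⟨a, ha⟩ := hτ.right (φ.pt n)
  obtain ⟨m, hm, rfl⟩ := φ.surj a
  exact ⟨(Nat.sInf_le (s := {m | τ (φ.pt m) (φ.pt n)}) ha).trans_lt hm,
    Nat.sInf_mem (s := {m | τ (φ.pt m) (φ.pt n)}) ⟨m, ha⟩⟩

variable [Finite H]

lemma col_eq_iff (hτ : B.Matching τ) {x y : ℕ} :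
    φ.col B.r x = φ.col τ y ↔ τ (φ.pt x) (φ.pt y) := by
  constructor
  · intro h
    have h1 := (col_spec (φ := φ) hτ y).2
    rw [← h] at h1
    exact hτ.rel_left h1 (col_spec B.matching_self x).2
  · intro h
    unfold col
    congr 1
    ext m
    exact ⟨fun h' => hτ.rel_left h (SRel.symm h'),
      fun h' => (hτ.rel _ _ _ _ h' h).2 (SRel.refl _)⟩

lemma col_eq_zero (hτ : B.Matching τ) {y : ℕ} (hy : y < 9) : φ.col τ y = 0 ↔ y = 0 := by
  have h0 : φ.col B.r 0 = 0 := Nat.eq_zero_of_le_zero (Nat.sInf_le (SRel.refl (A := B) _))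
  rw [eq_comm, ← φ.pt_eq_one hy]
  conv_lhs => rw [← h0]
  rw [col_eq_iff hτ, φ.pt_zero]
  refine ⟨fun h => B.one _ ((hτ.rel _ _ _ _ hτ.one h).1 (SRel.refl _)), fun h => ?_⟩
  rw [h]; exact hτ.one

lemma col_col (hτ : B.Matching τ) (n : ℕ) : φ.col B.r (φ.col τ n) = φ.col τ n :=
  (col_eq_iff hτ).2 (col_spec hτ n).2

omit [Finite H] in
lemma col_le (B : SRel H) (n : ℕ) : φ.col B.r n ≤ n := Nat.sInf_le (SRel.refl (A := B) _)

variable (φ) in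
/-- The code of the colouring attached to a matching. -/
noncomputable def code (τ : H → H → Prop) : ℕ → ℕ := ofDigits (φ.col τ)

omit [Finite H] in
lemma digit_code (hτ : B.Matching τ) {i k : ℕ} (hi : i < k) :
    digit (φ.code τ k) i = φ.col τ i :=
  digit_ofDigits (fun j _ => (col_spec hτ j).1.trans (by norm_num)) hi

lemma cnt_code (hτ : B.Matching τ) {a b a' b' : ℕ} {u v : H} (x : ℕ) (ha : τ (φ.pt a) u)
    (hb : τ (φ.pt b) v) (ha' : φ.col B.r a = a') (hb' : φ.col B.r b = b') :
    cnt (φ.code τ 9) a' b' x 9 = SRel.structConst B.r u v (φ.pt x) := by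
  have key : ∀ a a' u, τ (φ.pt a) u → φ.col B.r a = a' → ∀ n < 9,
      digit (φ.code τ 9) n = a' ↔ B.r u (φ.pt n) := by
    intro a a' u h ha' n hn
    rw [digit_code hτ hn, ← ha', eq_comm, col_eq_iff hτ]
    exact ⟨fun h' => (hτ.rel _ _ _ _ h h').1 (SRel.refl _), fun h' => hτ.trans _ _ _ h h'⟩
  exact φ.cnt_eq (key a a' u ha ha') (key b b' v hb hb') x

lemma compat_code (hτ : B.Matching τ) : compat (φ.code B.r 9) (φ.code τ 9) = true := by
  refine compat_iff.2 fun x hx y hy h a ha b hb => ?_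
  rw [digit_code hτ hy, digit_code B.matching_self hx] at h
  have h1 := (col_eq_iff hτ).1 h
  by_cases hab : φ.col B.r a = a ∧ φ.col B.r b = b
  · obtain ⟨u, hu⟩ := hτ.left (φ.pt a)
    obtain ⟨v, hv⟩ := hτ.left (φ.pt b)
    rw [cnt_code hτ y hu hv hab.1 hab.2,
      cnt_code B.matching_self x (SRel.refl (φ.pt a)) (SRel.refl (φ.pt b)) hab.1 hab.2]
    exact hτ.count _ _ _ _ _ _ hu hv h1
  · have key : ∀ σ, B.Matching σ → ∀ x, cnt (φ.code σ 9) a b x 9 = 0 := by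
      intro σ hσ x
      rw [cnt_eq_card, Finset.card_eq_zero, Finset.filter_eq_empty_iff]
      rintro n hn ⟨h1, h2⟩
      rw [digit_code hσ (Finset.mem_range.1 hn)] at h1
      rw [digit_code hσ (sub_lt _ _)] at h2
      exact hab ⟨by rw [← h1, col_col hσ], by rw [← h2, col_col hσ]⟩
    rw [key _ hτ, key _ B.matching_self]

lemma candMatch_code (hτ : B.Matching τ) {k : ℕ} (hk : k < 9) :
    candMatch (φ.code B.r 9) k (φ.code τ k) (φ.col τ k) = true := by
  have hlt : ∀ n, φ.col τ n < 9 := fun n => (col_spec hτ n).1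
  simp only [candMatch, Bool.and_eq_true, allLt_iff, natBeq_iff]
  refine ⟨⟨?_, ?_⟩, fun i hi => ⟨?_, ?_⟩⟩
  · rw [digit_code B.matching_self (hlt k), col_col hτ]
  · have := col_eq_zero (φ := φ) hτ hk
    by_cases h : k = 0
    · rw [this.2 h, h]; rfl
    · have h' := mt this.1 h
      rw [natBeq_eq_false.2 h, natBeq_eq_false.2 h']; rfl
  · rw [digit_code hτ hi, digit_code B.matching_self (sub_lt _ _)]
    rcases h : Nat.beq (sub 0 k) i
    · rfl
    have h1 := Nat.eq_of_beq_eq_true h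
    have h2 : φ.col B.r (sub 0 (φ.col τ i)) = φ.col τ k := by
      rw [col_eq_iff hτ]
      have h3 := hτ.inv _ _ (col_spec (φ := φ) hτ i).2
      have h4 := φ.pt_sub 0 k
      rw [h1, φ.pt_zero, one_div] at h4
      rwa [φ.pt_sub, φ.pt_zero, one_div, ← inv_inv (φ.pt k), ← h4]
    simp [h2]
  · rcases h : Nat.ble k (sub k i)
    · have hj : sub k i < k := by
        by_contra h'
        rw [Nat.ble_eq_true_of_le (not_lt.1 h')] at h
        exact absurd h (by simp)
      rw [digit_code hτ hi, digit_code hτ hj]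
      rw [cnt_code B.matching_self _ (SRel.refl _) (SRel.refl _) (col_col hτ i) (col_col hτ _),
        hτ.count _ _ _ _ _ _ (col_spec hτ i).2 (col_spec hτ _).2 (col_spec hτ k).2]
      have : Nonempty {g : H // B.r (φ.pt i) g ∧ B.r (φ.pt (sub k i)) (φ.pt k / g)} :=
        ⟨⟨φ.pt i, SRel.refl _, by rw [φ.pt_sub]; exact SRel.refl _⟩⟩
      have h5 : SRel.structConst B.r (φ.pt i) (φ.pt (sub k i)) (φ.pt k) ≠ 0 := Nat.card_pos.ne'
      rw [natBeq_eq_false.2 h5]; rfl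
    · rfl

lemma candColor_code (B : SRel H) {k : ℕ} (hk : k < 9) :
    candColor k (φ.code B.r k) (φ.col B.r k) = true := by
  have hB := B.matching_self
  simp only [candColor, Bool.and_eq_true, Bool.or_eq_true, allLt_iff, natBeq_iff]
  refine ⟨⟨?_, ?_⟩, ?_⟩
  · by_cases h : φ.col B.r k = k
    · exact .inl h
    · have h1 := col_le (φ := φ) B k
      refine .inr ⟨Nat.ble_eq_true_of_le h1, ?_⟩
      rw [digit_code hB (lt_of_le_of_ne h1 h), col_col hB]
  · have := col_eq_zero (φ := φ) hB hk
    by_cases h : k = 0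
    · rw [this.2 h, h]; rfl
    · have h' := mt this.1 h
      rw [natBeq_eq_false.2 h, natBeq_eq_false.2 h']; rfl
  · by_cases h : k ≤ sub 0 k
    · exact .inl (Nat.ble_eq_true_of_le h)
    refine .inr fun j hj => ?_
    by_cases h' : k ≤ sub 0 j
    · exact .inl (Nat.ble_eq_true_of_le h')
    right
    rw [digit_code hB hj, digit_code hB (not_le.1 h), digit_code hB (not_le.1 h')]
    have h1 : φ.col B.r k = φ.col B.r j ↔ φ.col B.r (sub 0 k) = φ.col B.r (sub 0 j) := by
      rw [col_eq_iff hB, col_eq_iff hB, φ.pt_sub, φ.pt_sub, φ.pt_zero, one_div, one_div,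
        SRel.inv_iff]
    rcases h2 : Nat.beq (φ.col B.r k) (φ.col B.r j)
    · have h3 := Nat.ne_of_beq_eq_false h2
      rw [natBeq_eq_false.2 (mt h1.2 h3)]; rfl
    · have h3 := Nat.eq_of_beq_eq_true h2
      rw [h1.1 h3, Nat.beq_refl]; rfl

lemma exists_hom_of_findMap (hτ : B.Matching τ) {a b : ℕ} (ha : a < 9)
    (h : findMap (φ.code B.r 9) (φ.code τ 9) a b = true) :
    ∃ g : H →* H, g (φ.pt a) = φ.pt b ∧ ∀ x, τ x (g x) := by
  obtain ⟨w₁, -, -, w₂, -, -, h1, h2⟩ := findMap_iff.1 h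
  obtain ⟨g, hg⟩ := φ.exists_hom (φ.pt w₁) (φ.pt w₂)
  have hg' : ∀ n < 9, g (φ.pt n) = φ.pt (lin w₁ w₂ n) := fun n hn => by
    rw [hg n hn, φ.pt_lin]
  refine ⟨g, by rw [hg' a ha, h1], fun x => ?_⟩
  obtain ⟨n, hn, rfl⟩ := φ.surj x
  have h3 : φ.pt n = φ.b₁ ^ n * φ.b₂ ^ (n / 3) := rfl
  rw [← h3, hg' n hn, ← col_eq_iff hτ, ← digit_code B.matching_self hn,
    ← digit_code hτ (lin_lt w₁ w₂ n)]
  exact h2 n hn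

variable (φ) in
include φ in
theorem rigid (B : SRel H) : B.Rigid := by
  have hB := B.matching_self
  have h1 := leaf_of_searchAll (F := φ.col B.r) (fun i _ => (col_spec hB i).1)
    (fun i hi => candColor_code B hi) search_eq_true
  change leafColor (φ.code B.r 9) = true at h1
  rw [leafColor, compat_code hB, Bool.not_true, Bool.or_false, Bool.and_eq_true] at h1
  obtain ⟨h1, h2⟩ := h1
  intro τ hτ a b hab
  have h3 := leaf_of_searchAll (F := φ.col τ) (fun i _ => (col_spec hτ i).1)
    (fun i hi => candMatch_code hτ hi) h2
  change leafMatch (φ.code B.r 9) (φ.code τ 9) = true at h3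
  rw [leafMatch, compat_code hτ, Bool.not_true, Bool.or_false] at h3
  obtain ⟨g, -, hg⟩ := exists_hom_of_findMap hτ (by norm_num) h3
  have h4 : B.r (g a) b := (hτ.rel _ _ _ _ (hg a) hab).1 (SRel.refl a)
  obtain ⟨m, hm, hm'⟩ := φ.surj (g a)
  obtain ⟨n, hn, rfl⟩ := φ.surj b
  rw [← hm'] at h4
  have h5 := allLt_iff.1 (allLt_iff.1 h1 m hm) n hn
  rw [digit_code hB hm, digit_code hB hn, (col_eq_iff hB).2 h4, Nat.beq_refl, Bool.not_true,
    Bool.false_or] at h5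
  obtain ⟨f, hf, hf'⟩ := exists_hom_of_findMap hB hm h5
  exact ⟨f.comp g, by rw [MonoidHom.comp_apply, ← hm']; exact hf,
    fun x => hτ.trans _ _ _ (hg x) (hf' _)⟩

end Frame
end Plane

lemma eq_and_eq_of_mul_pow_eq {G : Type*} [CommGroup G] {K : Subgroup G} {b : G} (hb : b ∉ K)
    (h3 : b ^ 3 = 1) {x y : G} {i j : ℕ} (hx : x ∈ K) (hy : y ∈ K) (hi : i < 3) (hj : j < 3)
    (h : x * b ^ i = y * b ^ j) : i = j ∧ x = y := by
  have key : i = j := by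
    have h1 : ∀ i j : ℕ, ∀ x ∈ K, ∀ y ∈ K, i < j → j < 3 → x * b ^ i ≠ y * b ^ j := by
      intro i j x hx y hy hij hj h
      obtain ⟨k, rfl⟩ := Nat.exists_eq_add_of_lt hij
      rw [show i + k + 1 = (k + 1) + i by ring, pow_add, ← mul_assoc, mul_left_inj] at h
      have h2 : b ^ (k + 1) ∈ K := by
        have := mul_mem (inv_mem hy) hx
        rwa [h, inv_mul_cancel_left] at this
      obtain rfl | rfl : k = 0 ∨ k = 1 := by omega
      · exact hb (by simpa using h2)
      · have h4 := pow_mem h2 2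
        rw [← pow_mul, show (1 + 1) * 2 = 3 + 1 by rfl, pow_succ, h3, one_mul] at h4
        exact hb h4
    rcases lt_trichotomy i j with hij | hij | hij
    · exact absurd h (h1 i j x hx y hy hij hj)
    · exact hij
    · exact absurd h.symm (h1 j i y hy x hx hij hi)
  subst key
  exact ⟨rfl, mul_right_cancel h⟩

lemma Plane.exists_frame {H : Type*} [CommGroup H] (h3 : ∀ x : H, x ^ 3 = 1)
    (hc : Nat.card H = 9) : Nonempty (Plane.Frame H) := by
  have : Finite H := Nat.finite_of_card_ne_zero (by omega)
  have : Nontrivial H := Finite.one_lt_card_iff_nontrivial.1 (by omega)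
  obtain ⟨b₁, hb₁⟩ := exists_ne (1 : H)
  have h1 : Nat.card (Subgroup.zpowers b₁) = 3 := by
    rw [Nat.card_zpowers, orderOf_eq_prime (p := 3) (h3 b₁) hb₁]
  obtain ⟨b₂, hb₂⟩ : ∃ b₂, b₂ ∉ Subgroup.zpowers b₁ := by
    by_contra! h
    rw [(Subgroup.eq_top_iff' _).2 h, Subgroup.card_top] at h1
    omega
  have hmod : ∀ n : ℕ, b₁ ^ (n % 3) = b₁ ^ n := fun n => by
    conv_rhs => rw [← Nat.mod_add_div n 3, pow_add, pow_mul, h3, one_pow, mul_one]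
  have inj : ∀ m < 9, ∀ n < 9, b₁ ^ m * b₂ ^ (m / 3) = b₁ ^ n * b₂ ^ (n / 3) → m = n := by
    intro m hm n hn h
    obtain ⟨h5, h6⟩ := eq_and_eq_of_mul_pow_eq hb₂ (h3 b₂) (Subgroup.npow_mem_zpowers b₁ m)
      (Subgroup.npow_mem_zpowers b₁ n) (by omega) (by omega) h
    have h7 := eq_and_eq_of_mul_pow_eq (K := ⊥) (b := b₁) (by simpa using hb₁) (h3 b₁)
      (one_mem _) (one_mem _) (i := m % 3) (j := n % 3) (by omega) (by omega)
      (by rw [hmod, hmod, h6])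
    omega
  have hbij := Function.Injective.bijective_of_nat_card_le
    (f := fun n : Fin 9 => b₁ ^ (n : ℕ) * b₂ ^ ((n : ℕ) / 3))
    (fun m n h => Fin.ext (inj m m.2 n n.2 h)) (by simp [hc])
  exact ⟨⟨b₁, b₂, h3, inj, fun x => let ⟨n, hn⟩ := hbij.2 x; ⟨n, n.2, hn⟩⟩⟩

namespace SRel

lemma rigid_of_card_eq_three {H : Type*} [CommGroup H] (hc : Nat.card H = 3) (B : SRel H) :
    B.Rigid := by
  have : Finite H := Nat.finite_of_card_ne_zero (by omega)
  have : Nontrivial H := Finite.one_lt_card_iff_nontrivial.1 (by omega)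
  have h3 : ∀ x : H, x ^ 3 = 1 := fun x => by rw [← hc]; exact pow_card_eq_one'
  have hall : ∀ c x : H, c ≠ 1 → x = 1 ∨ x = c ∨ x = c⁻¹ := by
    intro c x hcc
    obtain ⟨n, rfl⟩ := mem_zpowers_of_prime_card (p := 3) (g := c) (g' := x) hc hcc
    change c ^ n = 1 ∨ c ^ n = c ∨ c ^ n = c⁻¹
    have h4 : c ^ n = c ^ (n % 3) := by
      conv_lhs => rw [← Int.emod_add_mul_ediv n 3, zpow_add, zpow_mul,
        show c ^ (3 : ℤ) = 1 from mod_cast h3 c, one_zpow, mul_one]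
    obtain h | h | h : n % 3 = 0 ∨ n % 3 = 1 ∨ n % 3 = 2 := by omega
    · exact .inl (by rw [h4, h, zpow_zero])
    · exact .inr (.inl (by rw [h4, h, zpow_one]))
    · refine .inr (.inr ?_)
      rw [h4, h, eq_inv_iff_mul_eq_one, ← zpow_add_one]
      exact mod_cast h3 c
  intro τ hτ a b hab
  have hone : ∀ c d, τ c d → c = 1 → d = 1 := by
    rintro c d h rfl
    exact B.one _ ((hτ.rel _ _ _ _ hτ.one h).1 (SRel.refl 1))
  have hone' : ∀ c d, τ c d → d = 1 → c = 1 := by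
    rintro c d h rfl
    exact B.one _ ((hτ.rel _ _ _ _ hτ.one h).2 (SRel.refl 1))
  have key : ∀ c d, c ≠ 1 → τ c d → ∃ g : H →* H, g c = d ∧ ∀ x, τ x (g x) := by
    intro c d hcc hcd
    rcases hall c d hcc with h | rfl | rfl
    · exact absurd (hone' c d hcd h) hcc
    · refine ⟨MonoidHom.id H, rfl, fun x => ?_⟩
      rcases hall d x hcc with rfl | rfl | rfl
      exacts [hτ.one, hcd, hτ.inv _ _ hcd]
    · refine ⟨invMonoidHom, rfl, fun x => ?_⟩
      rcases hall c x hcc with rfl | rfl | rfl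
      · simpa using hτ.one
      · exact hcd
      · exact hτ.inv _ _ hcd
  by_cases ha : a = 1
  · obtain ⟨c, hcc⟩ := exists_ne (1 : H)
    obtain ⟨d, hd⟩ := hτ.left c
    obtain ⟨g, -, hg⟩ := key c d hcc hd
    exact ⟨g, by rw [ha, hone a b hab ha, map_one], hg⟩
  · exact key a b ha hab

lemma rigid_of_card_dvd_nine {H : Type*} [CommGroup H] (h3 : ∀ x : H, x ^ 3 = 1)
    (hc : Nat.card H ∣ 9) (B : SRel H) : B.Rigid := by
  have : Finite H := Nat.finite_of_card_ne_zero (by rintro h; rw [h] at hc; omega)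
  obtain ⟨k, hk, hck⟩ := (Nat.dvd_prime_pow Nat.prime_three (m := 2)).1 hc
  interval_cases k
  · have := (Nat.card_eq_one_iff_unique.1 hck).1
    intro τ hτ a b _
    refine ⟨MonoidHom.id H, Subsingleton.elim _ _, fun x => ?_⟩
    rw [Subsingleton.elim x 1]
    exact hτ.one
  · exact rigid_of_card_eq_three hck B
  · obtain ⟨φ⟩ := Plane.exists_frame h3 hck
    exact φ.rigid B

lemma locSchur_of_hom {G : Type*} [CommGroup G] {A : SRel G}
    (h : ∀ a b, A.r a b → ∃ g : G →* G, g a = b ∧ ∀ x, A.r x (g x)) : A.LocSchur := by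
  intro x y hxy
  obtain ⟨g, hg, hg'⟩ := h x y hxy
  exact ⟨g, map_one g, hg, fun u v => by rw [← map_div]; exact hg' _⟩

theorem locSchur_of_exponent {p : ℕ} (hp : p.Prime) (hp3 : p ≠ 3) {G : Type*} [CommGroup G]
    [Finite G] (hc : Nat.card G ∣ 9 * p) (hexp : ∀ g : G, g ^ (3 * p) = 1) (A : SRel G) :
    A.LocSchur := by
  induction hn : Nat.card G using Nat.strong_induction_on generalizing G with
  | _ n ih =>
  subst hn
  have ihU : ∀ (U : Subgroup G) (hU : A.Sat U), U ≠ ⊤ → (A.res U hU).LocSchur := by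
    intro U hU hne
    refine ih _ ?_ ((Subgroup.card_subgroup_dvd_card U).trans hc)
      (fun g => Subtype.ext (hexp g)) _ rfl
    exact lt_of_le_of_ne (Subgroup.card_le_card_group U)
      fun h => hne ((Subgroup.card_eq_iff_eq_top U).1 h)
  have ihL : ∀ (L : Subgroup G) (hL : A.Sat L), L ≠ ⊥ → (A.quo L hL).LocSchur := by
    intro L hL hne
    refine ih _ ?_ ((Subgroup.card_quotient_dvd_card L).trans hc) ?_ _ rfl
    · rw [L.card_eq_card_quotient_mul_card_subgroup]
      exact lt_mul_of_one_lt_right Nat.card_pos (L.one_lt_card_iff_ne_bot.2 hne)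
    · intro g
      obtain ⟨x, rfl⟩ := QuotientGroup.mk_surjective g
      rw [← QuotientGroup.mk_pow, hexp, QuotientGroup.mk_one]
  have hcop : Nat.Coprime 3 p := (Nat.coprime_primes Nat.prime_three hp).2 hp3.symm
  let H : Subgroup G := (powMonoidHom 3).ker
  let P : Subgroup G := (powMonoidHom p).ker
  have hH : ∀ h ∈ H, h ^ 3 = 1 := fun h hh => hh
  have hP : ∀ h ∈ P, h ^ p = 1 := fun h hh => hh
  have hker : ∀ m q : ℕ, q.Prime → q.Coprime m →
      (Nat.card (powMonoidHom m : G →* G).ker).Coprime q := by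
    intro m q hq hqm
    rw [Nat.coprime_comm, hq.coprime_iff_not_dvd]
    intro h
    have : Fact q.Prime := ⟨hq⟩
    obtain ⟨x, hx⟩ := exists_prime_orderOf_dvd_card' q h
    have h1 : orderOf x ∣ m := orderOf_dvd_of_pow_eq_one (Subtype.ext x.2)
    rw [hx] at h1
    exact hq.one_lt.ne' (Nat.eq_one_of_dvd_coprimes hqm dvd_rfl h1)
  have hcH : Nat.card H ∣ 9 :=
    (hker 3 p hp hcop.symm).dvd_of_dvd_mul_right ((Subgroup.card_subgroup_dvd_card H).trans hc)
  have hcP : Nat.card P ∣ p :=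
    (Nat.Coprime.pow_right 2 (hker p 3 Nat.prime_three hcop)).dvd_of_dvd_mul_left
      ((Subgroup.card_subgroup_dvd_card P).trans hc)
  have hmul : ∀ g, ∃ h ∈ H, ∃ q ∈ P, h * q = g := by
    intro g
    have hb := Nat.gcd_eq_gcd_ab 3 p
    rw [hcop] at hb
    refine ⟨(g ^ p) ^ (Nat.gcdB 3 p), zpow_mem ?_ _, (g ^ 3) ^ (Nat.gcdA 3 p), zpow_mem ?_ _, ?_⟩
    · change (g ^ p) ^ 3 = 1
      rw [← pow_mul, mul_comm, hexp]
    · change (g ^ 3) ^ p = 1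
      rw [← pow_mul, hexp]
    · rw [← zpow_natCast g p, ← zpow_natCast g 3, ← zpow_mul, ← zpow_mul, ← zpow_add, add_comm,
        ← hb, Nat.cast_one, zpow_one]
  rcases (Nat.dvd_prime hp).1 hcP with h1 | h1
  · have hPbot : P = ⊥ := Subgroup.card_eq_one.1 h1
    have hall : ∀ g, g ∈ H := by
      intro g
      obtain ⟨h, hh, q, hq, rfl⟩ := hmul g
      rw [hPbot, Subgroup.mem_bot] at hq
      rwa [hq, mul_one]
    have hcG : Nat.card G ∣ 9 := by
      rwa [(Subgroup.eq_top_iff' H).2 hall, Subgroup.card_top] at hcH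
    exact locSchur_of_hom fun a b h =>
      rigid_of_card_dvd_nine (fun g => hH g (hall g)) hcG A A.r A.matching_self a b h
  have hs : IsSplit H P p := ⟨hp, hp3, h1, hH, hcH, hmul⟩
  by_cases htop : A.satCore H ⊔ A.satHull P = ⊤
  swap
  · exact IsSplit.locSchur_of_ne_top hs ihU ihL htop
  by_cases hcore : A.satCore H = H
  swap
  · exact hs.locSchur_of_core_ne ihU htop hcore
  have hHs : A.Sat H := by
    rw [← hcore]; exact sat_satCore H
  have h2 : A.LocSchur ∨ A.Sat P := by
    by_cases hp2 : p = 2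
    · subst hp2
      exact hs.locSchur_or_sat_of_two ihU ihL hHs
    · exact hs.locSchur_or_sat_of_odd hp2 ihU ihL hHs
  refine h2.elim id fun hPs => hs.locSchur_of_sat hHs hPs fun B => ?_
  exact rigid_of_card_dvd_nine (fun x => Subtype.ext (hH x x.2)) hcH B

end SRel

/-- The property `f` holds for all members of `l`. -/
noncomputable def allIn {α : Type} (f : α → Bool) (l : List α) : Bool :=
  List.rec true (fun x _ ih => Bool.rec false ih (f x)) l

/-- The property `f` holds for some member of `l`. -/
noncomputable def anyIn {α : Type} (f : α → Bool) (l : List α) : Bool :=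
  List.rec false (fun x _ ih => Bool.rec ih true (f x)) l

/-- The members of `l` with property `f`. -/
noncomputable def keep {α : Type} (f : α → Bool) (l : List α) : List α :=
  List.rec [] (fun x _ ih => Bool.rec ih (List.cons x ih) (f x)) l

/-- Lazy conjunction. -/
noncomputable def both (p q : Bool) : Bool := Bool.rec false q p

/-- Lazy implication. -/
noncomputable def implies (p q : Bool) : Bool := Bool.rec true q p

namespace Space

/-- Points of the affine space of order three are coded as `i + 8 * j + 64 * k`. -/
def pts : List ℕ := [0, 1, 2, 8, 9, 10, 16, 17, 18, 64, 65, 66, 72, 73, 74, 80, 81, 82, 128, 129,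
  130, 136, 137, 138, 144, 145, 146]

/-- Representatives of the nonzero points up to sign. -/
def half : List ℕ := [1, 8, 64, 9, 10, 65, 66, 72, 73, 74, 80, 81, 82]

/-- Reduction of the coordinates modulo three. -/
def red (n : ℕ) : ℕ :=
  Nat.add (Nat.mod (Nat.mod n 8) 3) (Nat.add (Nat.mul 8 (Nat.mod (Nat.mod (Nat.div n 8) 8) 3))
    (Nat.mul 64 (Nat.mod (Nat.div n 64) 3)))

def neg (n : ℕ) : ℕ := red (Nat.mul 2 n)

/-- A set of points is coded by the sum of the powers of `256` with these exponents. -/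
def unit (n : ℕ) : ℕ := Nat.pow 256 n

/-- The `n`-th digit to base `256`. -/
def dig (N n : ℕ) : ℕ := Nat.mod (Nat.shiftRight N (Nat.mul 8 n)) 256

noncomputable def has (X n : ℕ) : Bool := Nat.beq (dig X n) 1

/-- The digits of `conv X Y` are the coefficients of the convolution of the sets coded by `X`
and `Y`. -/
def conv (X Y : ℕ) : ℕ := Nat.shiftRight (Nat.mul (Nat.mul X Y)
  ((1 + 256 ^ 3) * (1 + 256 ^ 24) * (1 + 256 ^ 192))) 1752

/-- The digits of `N` at the points of the set coded by `p.1` coincide with the one at `p.2`. -/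
noncomputable def isConst (N : ℕ) (p : ℕ × ℕ) : Bool :=
  Nat.beq (Nat.land N (Nat.mul p.1 255)) (Nat.mul p.1 (dig N p.2))

/-- The products of `X` with the members of `l` are constant on the members of `l`. -/
noncomputable def closed (X : ℕ) (l : List (ℕ × ℕ)) : Bool :=
  allIn (fun D => allIn (isConst (conv X D.1)) l) l

noncomputable def compat (l : List (ℕ × ℕ)) : Bool := allIn (fun D => closed D.1 l) l

/-- If `X` contains the code `e` and `Y` contains a point with code at least `e`, then the size
of `X` does not exceed the size of `Y`. -/
noncomputable def sizeLe (X Y : ℕ) : Bool :=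
  Bool.rec (allIn (fun e => Bool.rec true (Bool.rec true false (Nat.ble (unit e) Y)) (has X e))
    [1, 8, 64]) true (Nat.ble (Nat.mod X 255) (Nat.mod Y 255))

/-- The linear map taking the basis points to `w₁`, `w₂` and `w₃`. -/
def lin (w₁ w₂ w₃ n : ℕ) : ℕ :=
  red (Nat.add (red (Nat.add (red (Nat.mul (Nat.mod n 8) w₁))
    (Nat.mul (Nat.mod (Nat.div n 8) 8) w₂))) (Nat.mul (Nat.div n 64) w₃))

/-- A linear map preserving the colouring `C` and taking `a` to `b` exists. -/
noncomputable def findMap (C a b : ℕ) : Bool :=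
  anyIn (fun w₁ => Bool.rec false (anyIn (fun w₂ => Bool.rec false
    (Bool.rec false (anyIn (fun w₃ => Bool.rec false
      (allIn (fun n => Nat.beq (dig C n) (dig C (lin w₁ w₂ w₃ n))) half)
      (Nat.beq (lin w₁ w₂ w₃ a) b))
      (keep (fun w => Nat.beq (dig C 64) (dig C w)) pts))
    (allIn (fun n => Nat.beq (dig C n) (dig C (lin w₁ w₂ 0 n))) [9, 10]))
    (Bool.rec (Nat.beq (lin w₁ w₂ 0 a) b) true (Nat.ble 64 a)))
    (keep (fun w => Nat.beq (dig C 8) (dig C w)) pts))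
  (Bool.rec (Nat.beq (lin w₁ 0 0 a) b) true (Nat.ble 8 a)))
  (keep (fun w => Nat.beq (dig C 1) (dig C w)) pts)

/-- The colouring which marks the points of every set with its representative. -/
noncomputable def colouring (l : List (ℕ × ℕ)) : ℕ :=
  List.rec 0 (fun D _ ih => Nat.add (Nat.mul D.2 D.1) ih) l

noncomputable def homogeneous (l : List (ℕ × ℕ)) (C : ℕ) : Bool :=
  allIn (fun D => Bool.rec false
    (allIn (fun b => Bool.rec true (findMap C D.2 b) (has D.1 b)) pts)
    (Nat.beq (Nat.land C (Nat.mul D.1 255)) (Nat.mul D.1 D.2))) l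

noncomputable def leaf (l : List (ℕ × ℕ)) : Bool :=
  Bool.rec (not (compat l)) true (homogeneous l (colouring l))

/-- All choices of one point from each pair of opposite points of `D`, where `d` is chosen. -/
noncomputable def orient (D d : ℕ) (f : ℕ → Bool) (l : List ℕ) (X : ℕ) : Bool :=
  List.rec (fun X => f X) (fun z _ ih X => Bool.rec (ih X)
    (Bool.rec false (Bool.rec (ih (Nat.add X (unit (neg z)))) true (Nat.beq z d))
      (ih (Nat.add X (unit z)))) (has D z)) l X

/-- All ways to refine a list of symmetric classes. -/
noncomputable def refine (todo acc : List (ℕ × ℕ)) : Bool :=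
  List.rec (fun acc => leaf acc) (fun D _ ih acc => both
    (implies (closed D.1 (List.cons D acc)) (ih (List.cons D acc)))
    (orient D.1 D.2 (fun X => implies
      (closed X (List.cons (X, D.2) (List.cons (Nat.sub D.1 X, neg D.2) acc)))
      (ih (List.cons (X, D.2) (List.cons (Nat.sub D.1 X, neg D.2) acc)))) half 0)) todo acc

/-- All symmetric sets which contain `b` and otherwise only points satisfying `cand`. -/
noncomputable def choose (cand : ℕ → Bool) (b : ℕ) (f : ℕ → Bool) (l : List ℕ) (X : ℕ) : Bool :=
  List.rec (fun X => f X) (fun z _ ih X => Bool.rec (ih X)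
    (Bool.rec false (Bool.rec (ih X) true (Nat.beq z b))
      (ih (Nat.add X (Nat.add (unit z) (unit (neg z)))))) (cand z)) l X

noncomputable def firstIn (R : ℕ) (f : ℕ → Bool) (dflt : Bool) (l : List ℕ) : Bool :=
  List.rec dflt (fun z _ ih => Bool.rec ih (f z) (has R z)) l

noncomputable def products (X : ℕ) (Ns : List ℕ) (l : List (ℕ × ℕ)) : List ℕ :=
  List.rec Ns (fun D _ ih => List.cons (conv X D.1) ih) l

/-- Exhaustive search for the partitions into symmetric classes. -/
noncomputable def search (n : ℕ) (acc : List (ℕ × ℕ)) (Ns : List ℕ) (R : ℕ) : Bool :=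
  Nat.rec (fun _ _ _ => false) (fun _ ih acc Ns R => firstIn R
    (fun b => choose (fun z => both (has R z)
        (allIn (fun N => Nat.beq (dig N z) (dig N b)) Ns)) b
      (fun X => implies (allIn (fun D => both (sizeLe X D.1) (sizeLe D.1 X)) acc)
        (implies (closed X (List.cons (X, b) acc))
          (ih (List.cons (X, b) acc) (products X Ns (List.cons (X, b) acc)) (Nat.sub R X))))
      half 0)
    (both (Nat.beq R 0) (refine acc [])) half) n acc Ns R

def full : ℕ := (half.map fun z => unit z + unit (neg z)).sum

set_option maxRecDepth 100000 in
theorem search_eq_true : search 14 [] [] full = true := by decide +kernel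

end Space

lemma allIn_iff {α : Type} {f : α → Bool} {l : List α} :
    allIn f l = true ↔ ∀ x ∈ l, f x = true := by
  induction l with
  | nil => simp [allIn]
  | cons x l ih =>
    have h : allIn f (x :: l) = Bool.rec false (allIn f l) (f x) := rfl
    rw [h, rec_false_iff, List.forall_mem_cons, ih]

lemma anyIn_iff {α : Type} {f : α → Bool} {l : List α} :
    anyIn f l = true ↔ ∃ x ∈ l, f x = true := by
  induction l with
  | nil => simp [anyIn]
  | cons x l ih =>
    have h : anyIn f (x :: l) = Bool.rec (anyIn f l) true (f x) := rfl
    rw [h, List.exists_mem_cons_iff, ← ih]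
    cases f x <;> simp

lemma mem_keep {α : Type} {f : α → Bool} {l : List α} {x : α} :
    x ∈ keep f l ↔ x ∈ l ∧ f x = true := by
  induction l with
  | nil => simp [keep]
  | cons y l ih =>
    have h : keep f (y :: l) = Bool.rec (keep f l) (y :: keep f l) (f y) := rfl
    rw [h]
    rcases hy : f y
    · simp only [List.mem_cons, ih]
      constructor
      · rintro ⟨h1, h2⟩
        exact ⟨.inr h1, h2⟩
      · rintro ⟨rfl | h1, h2⟩
        · simp [hy] at h2
        · exact ⟨h1, h2⟩
    · simp only [List.mem_cons, ih]
      constructor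
      · rintro (rfl | h1)
        · exact ⟨.inl rfl, hy⟩
        · exact ⟨.inr h1.1, h1.2⟩
      · rintro ⟨rfl | h1, h2⟩
        · exact .inl rfl
        · exact .inr ⟨h1, h2⟩

lemma rec_or_iff {p q : Bool} : (Bool.rec q true p : Bool) = true ↔ (p = true ∨ q = true) := by
  cases p <;> simp

lemma natBle_iff {a b : ℕ} : Nat.ble a b = true ↔ a ≤ b :=
  ⟨Nat.le_of_ble_eq_true, Nat.ble_eq_true_of_le⟩

namespace Space

lemma dig_eq (N n : ℕ) : dig N n = N / 256 ^ n % 256 := by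
  change (N >>> (8 * n)) % 256 = _
  rw [Nat.shiftRight_eq_div_pow, pow_mul]; norm_num

lemma eq_of_dig {M N : ℕ} (h : ∀ n, dig M n = dig N n) : M = N := by
  have key : ∀ N i, Nat.testBit N i = (dig N (i / 8)).testBit (i % 8) := by
    intro N i
    have h1 : dig N (i / 8) = (N >>> (8 * (i / 8))) % 2 ^ 8 := rfl
    rw [h1, Nat.testBit_mod_two_pow, Nat.testBit_shiftRight, Nat.div_add_mod,
      decide_eq_true (Nat.mod_lt i (by norm_num)), Bool.true_and]
  exact Nat.eq_of_testBit_eq fun i => by rw [key M, key N, h]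

lemma dig_land (M N n : ℕ) : dig (Nat.land M N) n = Nat.land (dig M n) (dig N n) := by
  change ((M &&& N) >>> (8 * n)) % 2 ^ 8 = ((M >>> (8 * n)) % 2 ^ 8) &&& ((N >>> (8 * n)) % 2 ^ 8)
  rw [Nat.shiftRight_and_distrib, Nat.and_mod_two_pow]

lemma sum_lt {c : ℕ → ℕ} {s : Finset ℕ} (hc : ∀ q ∈ s, c q < 256) {n : ℕ} (hs : ∀ q ∈ s, q < n) :
    ∑ q ∈ s, c q * 256 ^ q < 256 ^ n := by
  induction s using Finset.induction_on_max generalizing n with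
  | empty => simp
  | insert a s ha ih =>
    have h1 := ih (fun q hq => hc q (Finset.mem_insert_of_mem hq)) ha
    have h2 := Nat.mul_le_mul_right (256 ^ a)
      (Nat.le_of_lt_succ (hc a (Finset.mem_insert_self a s)))
    have h3 : 256 ^ (a + 1) ≤ 256 ^ n :=
      Nat.pow_le_pow_right (by norm_num) (hs a (Finset.mem_insert_self a s))
    rw [Finset.sum_insert fun h => lt_irrefl _ (ha a h)]
    rw [pow_succ] at h3
    omega

lemma dig_sum {c : ℕ → ℕ} {s : Finset ℕ} (hc : ∀ q ∈ s, c q < 256) (n : ℕ) :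
    dig (∑ q ∈ s, c q * 256 ^ q) n = if n ∈ s then c n else 0 := by
  rw [dig_eq]
  induction s using Finset.induction_on_max with
  | empty => simp
  | insert a s ha ih =>
    have hs : ∀ q ∈ s, c q < 256 := fun q hq => hc q (Finset.mem_insert_of_mem hq)
    have h1 := sum_lt hs ha
    rw [Finset.sum_insert fun h => lt_irrefl _ (ha a h)]
    rcases lt_trichotomy n a with h | rfl | h
    · obtain ⟨m, rfl⟩ := Nat.exists_eq_add_of_lt h
      rw [show c (n + m + 1) * 256 ^ (n + m + 1) =
        256 ^ n * (256 * (c (n + m + 1) * 256 ^ m)) by ring,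
        Nat.mul_add_div (by positivity), Nat.mul_add_mod, ih hs]
      simp [Finset.mem_insert, h.ne]
    · rw [Nat.add_div_of_dvd_right (Dvd.intro_left _ rfl), Nat.mul_div_cancel _ (by positivity),
        Nat.div_eq_of_lt h1, add_zero, Nat.mod_eq_of_lt (hc n (Finset.mem_insert_self n s)),
        if_pos (Finset.mem_insert_self n s)]
    · have h2 : n ∉ insert a s := fun h' => by
        rcases Finset.mem_insert.1 h' with rfl | h'
        · exact lt_irrefl _ h
        · exact lt_irrefl _ (h.trans (ha n h'))
      have h3 := sum_lt hc (n := n) fun q hq => by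
        rcases Finset.mem_insert.1 hq with rfl | hq
        · exact h
        · exact (ha q hq).trans h
      rw [Finset.sum_insert fun h => lt_irrefl _ (ha a h)] at h3
      rw [Nat.div_eq_of_lt h3, if_neg h2]

lemma land_eq_iff {s : Finset ℕ} {N c : ℕ} (hc : c < 256) :
    Nat.land N ((∑ n ∈ s, 256 ^ n) * 255) = (∑ n ∈ s, 256 ^ n) * c ↔ ∀ n ∈ s, dig N n = c := by
  have h1 : ∀ c < 256, ∀ n, dig ((∑ n ∈ s, 256 ^ n) * c) n = if n ∈ s then c else 0 := by
    intro c hc n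
    rw [mul_comm, Finset.mul_sum]
    exact dig_sum (c := fun _ => c) (fun _ _ => hc) n
  have h2 : ∀ n, Nat.land (dig N n) 255 = dig N n := fun n => by
    have h := Nat.and_two_pow_sub_one_eq_mod (dig N n) 8
    have h' : dig N n < 256 := Nat.mod_lt _ (by norm_num)
    rw [Nat.mod_eq_of_lt h'] at h
    exact h
  constructor
  · intro h n hn
    have h3 := congrArg (dig · n) h
    simp only [dig_land] at h3
    rwa [h1 _ hc, h1 _ (by norm_num), if_pos hn, if_pos hn, h2] at h3
  · refine fun h => eq_of_dig fun n => ?_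
    rw [dig_land, h1 _ hc, h1 _ (by norm_num)]
    split_ifs with hn
    · rw [h2, h n hn]
    · exact Nat.and_zero _

lemma dig_sum_pow {ι : Type*} {s : Finset ι} {f : ι → ℕ}
    (hf : ∀ q, (s.filter fun i => f i = q).card < 256) (n : ℕ) :
    dig (∑ i ∈ s, 256 ^ f i) n = (s.filter fun i => f i = n).card := by
  classical
  rw [Finset.sum_comp (fun q => 256 ^ q) f]
  simp only [smul_eq_mul]
  rw [dig_sum (c := fun q => (s.filter fun i => f i = q).card) fun q _ => hf q]
  split_ifs with h
  · rfl
  · rw [eq_comm, Finset.card_eq_zero, Finset.filter_eq_empty_iff]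
    exact fun i hi h' => h (Finset.mem_image.2 ⟨i, hi, h'⟩)

end Space

namespace Space

lemma mem_pts {n : ℕ} : n ∈ pts ↔ n % 8 < 3 ∧ n / 8 % 8 < 3 ∧ n / 64 < 3 := by
  constructor
  · have : ∀ n ∈ pts, n % 8 < 3 ∧ n / 8 % 8 < 3 ∧ n / 64 < 3 := by decide
    exact this n
  · have : ∀ i < 3, ∀ j < 3, ∀ k < 3, i + 8 * j + 64 * k ∈ pts := by decide
    rintro ⟨h1, h2, h3⟩
    convert this _ h1 _ h2 _ h3 using 1
    omega

lemma red_digits (n : ℕ) :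
    red n % 8 = n % 8 % 3 ∧ red n / 8 % 8 = n / 8 % 8 % 3 ∧ red n / 64 = n / 64 % 3 := by
  have h : ∀ a < 3, ∀ b < 3, ∀ c < 3, (a + (8 * b + 64 * c)) % 8 = a ∧
      (a + (8 * b + 64 * c)) / 8 % 8 = b ∧ (a + (8 * b + 64 * c)) / 64 = c := by
    intro a ha b hb c hc
    omega
  exact h _ (Nat.mod_lt _ (by norm_num)) _ (Nat.mod_lt _ (by norm_num)) _
    (Nat.mod_lt _ (by norm_num))

lemma red_mem (n : ℕ) : red n ∈ pts := by
  obtain ⟨h1, h2, h3⟩ := red_digits n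
  rw [mem_pts, h1, h2, h3]
  exact ⟨Nat.mod_lt _ (by norm_num), Nat.mod_lt _ (by norm_num), Nat.mod_lt _ (by norm_num)⟩

lemma add_digits {m n : ℕ} (h₁ : m % 8 + n % 8 < 8) (h₂ : m / 8 % 8 + n / 8 % 8 < 8) :
    (m + n) % 8 = m % 8 + n % 8 ∧ (m + n) / 8 % 8 = m / 8 % 8 + n / 8 % 8 ∧
      (m + n) / 64 = m / 64 + n / 64 := by
  omega

lemma eq_digits (n : ℕ) : n = n % 8 + 8 * (n / 8 % 8) + 64 * (n / 64) := by omega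

lemma add_carry_iff {x y z t₁ t₂ t₃ : ℕ} (hx : x ∈ pts) (hy : y ∈ pts) (hz : z ∈ pts)
    (h₁ : t₁ < 2) (h₂ : t₂ < 2) :
    x + y + (3 * t₁ + 24 * t₂ + 192 * t₃) = 219 + z ↔ x % 8 + y % 8 + 3 * t₁ = 3 + z % 8 ∧
      x / 8 % 8 + y / 8 % 8 + 3 * t₂ = 3 + z / 8 % 8 ∧ x / 64 + y / 64 + 3 * t₃ = 3 + z / 64 := by
  rw [mem_pts] at hx hy hz
  have ex := eq_digits x
  have ey := eq_digits y
  have ez := eq_digits z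
  generalize x % 8 = x₁ at *
  generalize x / 8 % 8 = x₂ at *
  generalize x / 64 = x₃ at *
  generalize y % 8 = y₁ at *
  generalize y / 8 % 8 = y₂ at *
  generalize y / 64 = y₃ at *
  generalize z % 8 = z₁ at *
  generalize z / 8 % 8 = z₂ at *
  generalize z / 64 = z₃ at *
  have key : ∀ a b c a' b' c' : ℕ, a < 8 → b < 8 → a' < 8 → b' < 8 →
      (a + 8 * b + 64 * c = a' + 8 * b' + 64 * c' ↔ a = a' ∧ b = b' ∧ c = c') := by omega
  rw [← key _ _ _ _ _ _ (by linarith) (by linarith) (by linarith) (by linarith), ex, ey, ez]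
  constructor <;> intro h <;> linarith

/-- Coordinates on an elementary abelian group of order `27`. -/
structure Frame (G : Type*) [CommGroup G] where
  b₁ : G
  b₂ : G
  b₃ : G
  pow : ∀ x : G, x ^ 3 = 1
  inj : ∀ m ∈ pts, ∀ n ∈ pts, b₁ ^ (m % 8) * b₂ ^ (m / 8 % 8) * b₃ ^ (m / 64) =
    b₁ ^ (n % 8) * b₂ ^ (n / 8 % 8) * b₃ ^ (n / 64) → m = n
  surj : ∀ x, ∃ n ∈ pts, b₁ ^ (n % 8) * b₂ ^ (n / 8 % 8) * b₃ ^ (n / 64) = x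

namespace Frame
variable {G : Type*} [CommGroup G] (φ : Frame G)

/-- The point with a given code. -/
def pt (n : ℕ) : G := φ.b₁ ^ (n % 8) * φ.b₂ ^ (n / 8 % 8) * φ.b₃ ^ (n / 64)

include φ in
lemma pow_mod (x : G) (n : ℕ) : x ^ (n % 3) = x ^ n := by
  conv_rhs => rw [← Nat.mod_add_div n 3, pow_add, pow_mul, φ.pow, one_pow, mul_one]

include φ in
lemma pow_eq_pow (x : G) {m n : ℕ} (h : m % 3 = n % 3) : x ^ m = x ^ n := by
  rw [← φ.pow_mod x m, h, φ.pow_mod]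

lemma pt_congr {m n : ℕ} (h₁ : m % 8 % 3 = n % 8 % 3) (h₂ : m / 8 % 8 % 3 = n / 8 % 8 % 3)
    (h₃ : m / 64 % 3 = n / 64 % 3) : φ.pt m = φ.pt n := by
  rw [pt, pt, φ.pow_eq_pow _ h₁, φ.pow_eq_pow _ h₂, φ.pow_eq_pow _ h₃]

lemma pt_red (n : ℕ) : φ.pt (red n) = φ.pt n := by
  obtain ⟨h1, h2, h3⟩ := red_digits n
  apply pt_congr
  · rw [h1, Nat.mod_mod]
  · rw [h2, Nat.mod_mod]
  · rw [h3, Nat.mod_mod]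

lemma pt_zero : φ.pt 0 = 1 := by simp [pt]

lemma pt_add {m n : ℕ} (h₁ : m % 8 + n % 8 < 8) (h₂ : m / 8 % 8 + n / 8 % 8 < 8) :
    φ.pt (m + n) = φ.pt m * φ.pt n := by
  obtain ⟨e1, e2, e3⟩ := add_digits h₁ h₂
  rw [pt, e1, e2, e3, pow_add, pow_add, pow_add, pt, pt]
  rw [mul_mul_mul_comm (φ.b₁ ^ (m % 8)), mul_mul_mul_comm]

lemma pt_mul {k w : ℕ} (hk : k < 3) (hw : w ∈ pts) : φ.pt (k * w) = φ.pt w ^ k := by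
  rw [mem_pts] at hw
  interval_cases k
  · simp [pt_zero]
  · simp
  · rw [two_mul, φ.pt_add (by omega) (by omega), pow_two]

lemma pt_neg {n : ℕ} (hn : n ∈ pts) : φ.pt (neg n) = (φ.pt n)⁻¹ := by
  refine (φ.pt_red _).trans ((φ.pt_mul (k := 2) (by norm_num) hn).trans ?_)
  rw [eq_inv_iff_mul_eq_one, ← pow_succ, φ.pow]

lemma pt_red_add_mul {u w k : ℕ} (hu : u ∈ pts) (hw : w ∈ pts) (hk : k < 3) :
    φ.pt (red (u + k * w)) = φ.pt u * φ.pt w ^ k := by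
  rw [pt_red, ← φ.pt_mul hk hw]
  rw [mem_pts] at hu hw
  apply φ.pt_add <;> interval_cases k <;> omega

lemma pt_lin {w₁ w₂ w₃ n : ℕ} (h₁ : w₁ ∈ pts) (h₂ : w₂ ∈ pts) (h₃ : w₃ ∈ pts) (hn : n ∈ pts) :
    φ.pt (lin w₁ w₂ w₃ n) =
      φ.pt w₁ ^ (n % 8) * φ.pt w₂ ^ (n / 8 % 8) * φ.pt w₃ ^ (n / 64) := by
  rw [mem_pts] at hn
  refine (φ.pt_red_add_mul (red_mem _) h₃ hn.2.2).trans ?_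
  congr 1
  refine (φ.pt_red_add_mul (red_mem _) h₂ hn.2.1).trans ?_
  congr 1
  exact (φ.pt_red _).trans (φ.pt_mul hn.1 h₁)

lemma pt_inj {m n : ℕ} (hm : m ∈ pts) (hn : n ∈ pts) (h : φ.pt m = φ.pt n) : m = n :=
  φ.inj m hm n hn h

lemma pt_eq_one {n : ℕ} (hn : n ∈ pts) : φ.pt n = 1 ↔ n = 0 :=
  ⟨fun h => φ.pt_inj hn (by decide) (h.trans φ.pt_zero.symm), fun h => h ▸ φ.pt_zero⟩

lemma exists_hom (x y z : G) : ∃ g : G →* G, ∀ n ∈ pts,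
    g (φ.pt n) = x ^ (n % 8) * y ^ (n / 8 % 8) * z ^ (n / 64) := by
  choose idx hlt hidx using φ.surj
  have h1 : ∀ n ∈ pts, idx (φ.pt n) = n := fun n hn => φ.inj _ (hlt _) _ hn (hidx _)
  have h2 : ∀ u v, x ^ (idx (u * v) % 8) * y ^ (idx (u * v) / 8 % 8) * z ^ (idx (u * v) / 64) =
      (x ^ (idx u % 8) * y ^ (idx u / 8 % 8) * z ^ (idx u / 64)) *
      (x ^ (idx v % 8) * y ^ (idx v / 8 % 8) * z ^ (idx v / 64)) := by
    intro u v
    have hu := mem_pts.1 (hlt u)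
    have hv := mem_pts.1 (hlt v)
    have a1 : idx u % 8 + idx v % 8 < 8 := by linarith [hu.1, hv.1]
    have a2 : idx u / 8 % 8 + idx v / 8 % 8 < 8 := by linarith [hu.2.1, hv.2.1]
    have h3 : idx (u * v) = red (idx u + idx v) := by
      rw [← h1 _ (red_mem _), pt_red, φ.pt_add a1 a2]
      exact congrArg idx (congrArg₂ (· * ·) (hidx u).symm (hidx v).symm)
    obtain ⟨d1, d2, d3⟩ := red_digits (idx u + idx v)
    obtain ⟨c1, c2, c3⟩ := add_digits a1 a2
    have e1 : (idx u % 8 + idx v % 8) % 3 = idx (u * v) % 8 % 3 := by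
      rw [h3, d1, c1, Nat.mod_mod]
    have e2 : (idx u / 8 % 8 + idx v / 8 % 8) % 3 = idx (u * v) / 8 % 8 % 3 := by
      rw [h3, d2, c2, Nat.mod_mod]
    have e3 : (idx u / 64 + idx v / 64) % 3 = idx (u * v) / 64 % 3 := by
      rw [h3, d3, c3, Nat.mod_mod]
    rw [← φ.pow_eq_pow x e1, ← φ.pow_eq_pow y e2, ← φ.pow_eq_pow z e3, pow_add, pow_add, pow_add,
      mul_mul_mul_comm (x ^ (idx u % 8)), mul_mul_mul_comm]
  exact ⟨MonoidHom.mk' (fun u =>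
    x ^ (idx u % 8) * y ^ (idx u / 8 % 8) * z ^ (idx u / 64)) h2, fun n hn => by simp [h1 n hn]⟩

open Classical in
/-- The codes of the points of a set. -/
noncomputable def support (S : Set G) : Finset ℕ := pts.toFinset.filter fun n => φ.pt n ∈ S

/-- The code of a set. -/
noncomputable def code (S : Set G) : ℕ := ∑ n ∈ φ.support S, 256 ^ n

variable {φ}

lemma mem_support {S : Set G} {n : ℕ} : n ∈ φ.support S ↔ n ∈ pts ∧ φ.pt n ∈ S := by
  simp [support]

lemma dig_code (S : Set G) (n : ℕ) : dig (φ.code S) n = if n ∈ φ.support S then 1 else 0 := by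
  have := dig_sum (c := fun _ => 1) (s := φ.support S) (fun _ _ => by norm_num) n
  simpa [code] using this

lemma has_code {S : Set G} {n : ℕ} : has (φ.code S) n = true ↔ n ∈ pts ∧ φ.pt n ∈ S := by
  rw [has, natBeq_iff, dig_code, ← mem_support]
  split_ifs with h <;> simp [h]

lemma exists_of_unit_le_code {S : Set G} {e : ℕ} (h : unit e ≤ φ.code S) :
    ∃ n ∈ pts, e ≤ n ∧ φ.pt n ∈ S := by
  by_contra! h'
  refine absurd h (not_le.2 (Nat.geomSum_lt (by norm_num) fun n hn => ?_))
  rw [mem_support] at hn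
  by_contra h2
  exact h' n hn.1 (not_lt.1 h2) hn.2

lemma card_support (S : Set G) : (φ.support S).card = S.ncard := by
  classical
  rw [← Set.ncard_coe_finset]
  refine Set.ncard_congr (fun n _ => φ.pt n) (fun n hn => (mem_support.1 hn).2) ?_ ?_
  · exact fun m n hm hn h => φ.pt_inj (mem_support.1 hm).1 (mem_support.1 hn).1 h
  · intro x hx
    obtain ⟨n, hn, rfl⟩ := φ.surj x
    exact ⟨n, mem_support.2 ⟨hn, hx⟩, rfl⟩

lemma code_mod (S : Set G) : φ.code S % 255 = S.ncard := by
  rw [code, Finset.sum_nat_mod, ← card_support (φ := φ)]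
  have h : ∀ n, 256 ^ n % 255 = 1 := fun n => by rw [Nat.pow_mod]; norm_num
  simp only [h, Finset.sum_const, smul_eq_mul, mul_one]
  refine Nat.mod_eq_of_lt ((Finset.card_le_card
    (show φ.support S ⊆ pts.toFinset from fun n hn => ?_)).trans_lt (b := 27) ?_)
  · exact List.mem_toFinset.2 (mem_support.1 hn).1
  · decide

lemma code_diff {S T : Set G} (h : T ⊆ S) : φ.code S - φ.code T = φ.code (S \ T) := by
  have h1 : φ.support (S \ T) = φ.support S \ φ.support T := by
    ext n
    simp only [mem_support, Finset.mem_sdiff, Set.mem_sdiff]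
    tauto
  have h2 : φ.support T ⊆ φ.support S := fun n hn => by
    rw [mem_support] at hn ⊢
    exact ⟨hn.1, h hn.2⟩
  rw [code, code, code, h1, ← Finset.sum_sdiff h2]
  omega

open Classical in
lemma code_eq_sum_half {S : Set G} (h1 : (1 : G) ∉ S) : φ.code S = (half.map fun z =>
    (if φ.pt z ∈ S then unit z else 0) + if φ.pt (neg z) ∈ S then unit (neg z) else 0).sum := by
  have key : ∀ F : ℕ → ℕ, F 0 = 0 →
      ∑ n ∈ pts.toFinset, F n = (half.map fun z => F z + F (neg z)).sum := by
    intro F hF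
    have h2 : ((0 :: half) ++ half.map neg).Perm pts := by decide
    rw [List.sum_toFinset _ (by decide), ← (h2.map F).sum_eq]
    simp only [List.map_append, List.map_cons, List.map_map, List.sum_append, List.sum_cons, hF,
      zero_add, List.sum_map_add]
    rfl
  rw [code, support, Finset.sum_filter]
  exact key _ (if_neg (by rwa [pt_zero]))

lemma eq_empty_of_code {S : Set G} (h : φ.code S = 0) : S = ∅ := by
  refine Set.eq_empty_iff_forall_notMem.2 fun x hx => ?_
  obtain ⟨n, hn, rfl⟩ := φ.surj x
  have h1 := (has_code (φ := φ)).2 ⟨hn, hx⟩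
  rw [h] at h1
  simp [has, dig_eq] at h1

lemma full_eq_code : full = φ.code {x | x ≠ 1} := by
  classical
  rw [code_eq_sum_half (by simp), full]
  congr 1
  refine List.map_congr_left fun z hz => ?_
  have h1 : ∀ z ∈ half, z ≠ 0 ∧ neg z ≠ 0 ∧ z ∈ pts := by decide
  obtain ⟨h1, h2, h3⟩ := h1 z hz
  rw [if_pos, if_pos]
  · exact mt (φ.pt_eq_one (red_mem _)).1 h2
  · exact mt (φ.pt_eq_one h3).1 h1

lemma conv_code (S T : Set G) {z : ℕ} (hz : z ∈ pts) : dig (conv (φ.code S) (φ.code T)) z =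
    Nat.card {g : G // g ∈ S ∧ φ.pt z / g ∈ T} := by
  classical
  set A := ((φ.support S ×ˢ φ.support T) ×ˢ
    (Finset.range 2 ×ˢ (Finset.range 2 ×ˢ Finset.range 2))) with hA
  set f : (ℕ × ℕ) × ℕ × ℕ × ℕ → ℕ := fun i =>
    i.1.1 + i.1.2 + (3 * i.2.1 + 24 * i.2.2.1 + 192 * i.2.2.2) with hf
  have h1 : φ.code S * φ.code T * ((1 + 256 ^ 3) * (1 + 256 ^ 24) * (1 + 256 ^ 192)) =
      ∑ i ∈ A, 256 ^ f i := by
    have h2 : (1 + 256 ^ 3) * (1 + 256 ^ 24) * (1 + 256 ^ 192) =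
        ∑ t ∈ Finset.range 2 ×ˢ (Finset.range 2 ×ˢ Finset.range 2),
          256 ^ (3 * t.1 + 24 * t.2.1 + 192 * t.2.2) := by
      simp only [Finset.sum_product, Finset.sum_range_succ, Finset.sum_range_zero]
      norm_num
    rw [h2, code, code, Finset.sum_mul_sum, ← Finset.sum_product', Finset.sum_mul_sum,
      ← Finset.sum_product']
    refine Finset.sum_congr rfl fun i _ => ?_
    rw [← pow_add, ← pow_add]
  have h2 : ∀ z, dig (conv (φ.code S) (φ.code T)) z =
      dig (φ.code S * φ.code T * ((1 + 256 ^ 3) * (1 + 256 ^ 24) * (1 + 256 ^ 192))) (219 + z) := by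
    intro z
    change ((_ >>> 1752) >>> (8 * z)) % 256 = (_ >>> (8 * (219 + z))) % 256
    rw [← Nat.shiftRight_add]
    congr 2
    ring
  have h3 : ∀ q, (A.filter fun i => f i = q).card < 256 := by
    intro q
    have h4 : (pts.toFinset ×ˢ
        (Finset.range 2 ×ˢ (Finset.range 2 ×ˢ Finset.range 2))).card < 256 := by
      simp only [Finset.card_product, Finset.card_range]
      decide
    refine (Finset.card_le_card_of_injOn (fun i => (i.1.1, i.2)) ?_ ?_).trans_lt h4
    · rintro ⟨⟨x, y⟩, t⟩ hi
      simp only [hA, Finset.coe_filter, Finset.mem_product, Set.mem_ofPred_eq] at hi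
      simp only [Finset.coe_product, Set.mem_prod, Finset.mem_coe, List.mem_toFinset]
      exact ⟨(mem_support.1 hi.1.1.1).1, hi.1.2⟩
    · rintro ⟨⟨x, y⟩, t⟩ hi ⟨⟨x', y'⟩, t'⟩ hi' h
      simp only [Prod.mk.injEq] at h
      obtain ⟨rfl, rfl⟩ := h
      simp only [hA, hf, Finset.coe_filter, Set.mem_ofPred_eq] at hi hi'
      have : y = y' := by omega
      rw [this]
  rw [h2, h1, dig_sum_pow h3, ← Fintype.card_coe, ← Nat.card_eq_fintype_card]
  have hpt : ∀ x y t₁ t₂ t₃, x ∈ φ.support S → y ∈ φ.support T → t₁ < 2 → t₂ < 2 → t₃ < 2 →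
      x + y + (3 * t₁ + 24 * t₂ + 192 * t₃) = 219 + z → φ.pt z / φ.pt x = φ.pt y := by
    intro x y t₁ t₂ t₃ hx hy ht₁ ht₂ ht₃ h
    have hx' := (mem_support.1 hx).1
    have hy' := (mem_support.1 hy).1
    obtain ⟨e1, e2, e3⟩ := (add_carry_iff hx' hy' hz ht₁ ht₂).1 h
    rw [mem_pts] at hx' hy'
    have a1 : x % 8 + y % 8 < 8 := by linarith [hx'.1, hy'.1]
    have a2 : x / 8 % 8 + y / 8 % 8 < 8 := by linarith [hx'.2.1, hy'.2.1]
    obtain ⟨d1, d2, d3⟩ := add_digits a1 a2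
    rw [div_eq_iff_eq_mul', ← φ.pt_add a1 a2]
    apply φ.pt_congr
    · rw [d1, ← Nat.add_mod_left 3 (z % 8), ← e1, Nat.add_mul_mod_self_left]
    · rw [d2, ← Nat.add_mod_left 3 (z / 8 % 8), ← e2, Nat.add_mul_mod_self_left]
    · rw [d3, ← Nat.add_mod_left 3 (z / 64), ← e3, Nat.add_mul_mod_self_left]
  refine Nat.card_congr (Equiv.ofBijective (fun i => ⟨φ.pt i.1.1.1, ?_⟩) ⟨?_, ?_⟩)
  · obtain ⟨⟨⟨x, y⟩, t₁, t₂, t₃⟩, hi⟩ := i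
    simp only [hA, hf, Finset.mem_filter, Finset.mem_product, Finset.mem_range] at hi
    obtain ⟨⟨⟨hx, hy⟩, ht₁, ht₂, ht₃⟩, h⟩ := hi
    exact ⟨(mem_support.1 hx).2,
      by rw [hpt x y t₁ t₂ t₃ hx hy ht₁ ht₂ ht₃ h]; exact (mem_support.1 hy).2⟩
  · rintro ⟨⟨⟨x, y⟩, t₁, t₂, t₃⟩, hi⟩ ⟨⟨⟨x', y'⟩, t₁', t₂', t₃'⟩, hi'⟩ h
    simp only [hA, hf, Finset.mem_filter, Finset.mem_product, Finset.mem_range] at hi hi'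
    obtain ⟨⟨⟨hx, hy⟩, ht₁, ht₂, ht₃⟩, hi⟩ := hi
    obtain ⟨⟨⟨hx', hy'⟩, ht₁', ht₂', ht₃'⟩, hi'⟩ := hi'
    have h4 : φ.pt x = φ.pt x' := congrArg Subtype.val h
    have h5 := φ.pt_inj (mem_support.1 hx).1 (mem_support.1 hx').1 h4
    have h6 := hpt _ _ _ _ _ hx hy ht₁ ht₂ ht₃ hi
    rw [h4, hpt _ _ _ _ _ hx' hy' ht₁' ht₂' ht₃' hi'] at h6
    have h7 := φ.pt_inj (mem_support.1 hy').1 (mem_support.1 hy).1 h6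
    have h8 : t₁ = t₁' ∧ t₂ = t₂' ∧ t₃ = t₃' := by
      subst h5 h7
      clear * - hi hi' ht₁ ht₂ ht₃ ht₁' ht₂' ht₃'
      omega
    simp [h5, h7.symm, h8]
  · rintro ⟨g, hg, hg'⟩
    obtain ⟨x, hx, rfl⟩ := φ.surj g
    obtain ⟨y, hy, hxy⟩ := φ.surj (φ.pt z / φ.pt x)
    change φ.pt y = _ at hxy
    change φ.pt x ∈ S at hg
    change φ.pt z / φ.pt x ∈ T at hg'
    have hx' := mem_pts.1 hx
    have hy' := mem_pts.1 hy
    have a1 : x % 8 + y % 8 < 8 := by linarith [hx'.1, hy'.1]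
    have a2 : x / 8 % 8 + y / 8 % 8 < 8 := by linarith [hx'.2.1, hy'.2.1]
    have h4 : z = red (x + y) := by
      refine φ.pt_inj hz (red_mem _) ?_
      rw [pt_red, φ.pt_add a1 a2, hxy, mul_div_cancel]
    have key : ∀ a b c, a < 3 → b < 3 → c = (a + b) % 3 → ∃ t < 2, a + b + 3 * t = 3 + c := by
      intro a b c ha hb hc
      exact ⟨if a + b < 3 then 1 else 0, by split_ifs <;> omega, by split_ifs <;> omega⟩
    obtain ⟨c1, c2, c3⟩ := add_digits a1 a2
    obtain ⟨d1, d2, d3⟩ := red_digits (x + y)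
    rw [← h4] at d1 d2 d3
    obtain ⟨t₁, ht₁, e1⟩ := key _ _ _ hx'.1 hy'.1 (d1.trans (by rw [c1]))
    obtain ⟨t₂, ht₂, e2⟩ := key _ _ _ hx'.2.1 hy'.2.1 (d2.trans (by rw [c2]))
    obtain ⟨t₃, ht₃, e3⟩ := key _ _ _ hx'.2.2 hy'.2.2 (d3.trans (by rw [c3]))
    refine ⟨⟨((x, y), t₁, t₂, t₃), ?_⟩, rfl⟩
    simp only [hA, hf, Finset.mem_filter, Finset.mem_product, Finset.mem_range, mem_support]
    exact ⟨⟨⟨⟨hx, hg⟩, hy, hxy ▸ hg'⟩, ht₁, ht₂, ht₃⟩,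
      (add_carry_iff hx hy hz ht₁ ht₂).2 ⟨e1, e2, e3⟩⟩

end Frame
end Space

namespace Space

lemma leaf_iff (l : List (ℕ × ℕ)) :
    leaf l = true ↔ (compat l = true → homogeneous l (colouring l) = true) := by
  unfold leaf
  rw [rec_or_iff]
  cases compat l <;> simp

lemma homogeneous_iff (l : List (ℕ × ℕ)) (C : ℕ) : homogeneous l C = true ↔
    ∀ D ∈ l, Nat.land C (Nat.mul D.1 255) = Nat.mul D.1 D.2 ∧
      ∀ b ∈ pts, has D.1 b = true → findMap C D.2 b = true := by
  simp only [homogeneous, allIn_iff, rec_false_iff, rec_true_iff, natBeq_iff]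

lemma exists_of_findMap {C a b : ℕ} (h : findMap C a b = true) :
    ∃ w₁ ∈ pts, ∃ w₂ ∈ pts, ∃ w₃ ∈ pts, lin w₁ w₂ w₃ a = b ∧
      ∀ n ∈ half, dig C n = dig C (lin w₁ w₂ w₃ n) := by
  simp only [findMap, allIn_iff, anyIn_iff, mem_keep, rec_false_iff, natBeq_iff] at h
  obtain ⟨w₁, h₁, -, w₂, h₂, -, -, w₃, h₃, h, h'⟩ := h
  exact ⟨w₁, h₁.1, w₂, h₂.1, w₃, h₃.1, h, h'⟩

lemma closed_iff (X : ℕ) (l : List (ℕ × ℕ)) :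
    closed X l = true ↔ ∀ D ∈ l, ∀ E ∈ l, isConst (conv X D.1) E = true := by
  simp only [closed, allIn_iff]

lemma compat_iff (l : List (ℕ × ℕ)) : compat l = true ↔ ∀ D ∈ l, closed D.1 l = true := by
  simp only [compat, allIn_iff]

lemma isConst_iff (N : ℕ) (p : ℕ × ℕ) :
    isConst N p = true ↔ Nat.land N (Nat.mul p.1 255) = Nat.mul p.1 (dig N p.2) := by
  simp only [isConst, natBeq_iff]

lemma dig_lt (N n : ℕ) : dig N n < 256 := Nat.mod_lt _ (by norm_num)

namespace Frame
variable {G : Type*} [CommGroup G] {φ : Frame G}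

lemma land_code_iff {S : Set G} {N c : ℕ} (hc : c < 256) :
    Nat.land N (Nat.mul (φ.code S) 255) = Nat.mul (φ.code S) c ↔
      ∀ n ∈ pts, φ.pt n ∈ S → dig N n = c := by
  refine (land_eq_iff (s := φ.support S) hc).trans ?_
  simp only [mem_support, and_imp]

variable (φ) in
/-- The digits of `N` are constant on the classes of `R`. -/
def IsInv (R : G → G → Prop) (N : ℕ) : Prop :=
  ∀ m ∈ pts, ∀ n ∈ pts, R (φ.pt m) (φ.pt n) → dig N m = dig N n

variable (φ) in
/-- The code of a class of `R` together with the code of a representative. -/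
def IsCls (R : G → G → Prop) (D : ℕ × ℕ) : Prop :=
  D.2 ∈ pts ∧ D.2 ≠ 0 ∧ D.1 = φ.code {y | R (φ.pt D.2) y}

variable (φ) in
/-- Products of the classes of `R` are constant on the classes of `R`. -/
def IsRing (R : G → G → Prop) : Prop :=
  ∀ a b, φ.IsInv R (conv (φ.code {y | R a y}) (φ.code {y | R b y}))

variable {R : G → G → Prop}

lemma IsCls.isInv {D E : ℕ × ℕ} (hR : φ.IsRing R) (hD : φ.IsCls R D) (hE : φ.IsCls R E) :
    φ.IsInv R (conv D.1 E.1) := by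
  rw [hD.2.2, hE.2.2]
  exact hR _ _

lemma IsCls.isConst {D : ℕ × ℕ} {N : ℕ} (hD : φ.IsCls R D) (hN : φ.IsInv R N) :
    isConst N D = true := by
  rw [isConst_iff, hD.2.2, land_code_iff (dig_lt _ _)]
  exact fun n hn h => (hN _ hD.1 _ hn h).symm

lemma IsCls.closed {D : ℕ × ℕ} {l : List (ℕ × ℕ)} (hR : φ.IsRing R) (hD : φ.IsCls R D)
    (hl : ∀ E ∈ l, φ.IsCls R E) : closed D.1 l = true := by
  rw [closed_iff]
  exact fun E hE F hF => (hl F hF).isConst (hD.isInv hR (hl E hE))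

lemma compat_of_isCls {l : List (ℕ × ℕ)} (hR : φ.IsRing R) (hl : ∀ E ∈ l, φ.IsCls R E) :
    compat l = true := by
  rw [compat_iff]
  exact fun D hD => (hl D hD).closed hR hl

lemma isRing_of_count (h : ∀ a b x y, R x y → Nat.card {g // R a g ∧ R b (x / g)} =
    Nat.card {g // R a g ∧ R b (y / g)}) : φ.IsRing R := by
  intro a b m hm n hn hmn
  rw [conv_code _ _ hm, conv_code _ _ hn]
  exact h a b _ _ hmn

lemma isRing (A : SRel G) : φ.IsRing A.r := isRing_of_count A.count

lemma dvd_code {S : Set G} (h : (1 : G) ∉ S) : 256 ∣ φ.code S := by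
  refine Finset.dvd_sum fun n hn => dvd_pow_self _ ?_
  rintro rfl
  exact h (φ.pt_zero ▸ (mem_support.1 hn).2)

lemma IsCls.dvd {A : SRel G} {D : ℕ × ℕ} (hD : φ.IsCls A.r D) : 256 ∣ D.1 := by
  rw [hD.2.2]
  exact dvd_code fun h => hD.2.1 ((φ.pt_eq_one hD.1).1 (SRel.eq_one h))

lemma dvd_colouring {A : SRel G} : ∀ {l : List (ℕ × ℕ)}, (∀ D ∈ l, φ.IsCls A.r D) →
    256 ∣ colouring l
  | [], _ => dvd_zero _
  | D :: l, h => by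
    change 256 ∣ D.2 * D.1 + colouring l
    exact dvd_add (Dvd.dvd.mul_left (h D (by simp)).dvd _)
      (dvd_colouring fun E hE => h E (by simp [hE]))

lemma exists_map {A : SRel G} {C a b : ℕ} (ha : a ∈ pts) (h0 : dig C 0 = 0)
    (hC : ∀ n ∈ pts, n ≠ 0 → dig C n ∈ pts ∧ dig C n ≠ 0 ∧ A.r (φ.pt (dig C n)) (φ.pt n))
    (h : findMap C a b = true) :
    ∃ g : G →* G, g (φ.pt a) = φ.pt b ∧ ∀ x, A.r x (g x) := by
  obtain ⟨w₁, h₁, w₂, h₂, w₃, h₃, hab, h⟩ := exists_of_findMap h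
  obtain ⟨g, hg⟩ := φ.exists_hom (φ.pt w₁) (φ.pt w₂) (φ.pt w₃)
  have hg' : ∀ n ∈ pts, g (φ.pt n) = φ.pt (lin w₁ w₂ w₃ n) := fun n hn => by
    rw [hg n hn, φ.pt_lin h₁ h₂ h₃ hn]
  have hhalf : ∀ n ∈ half, A.r (φ.pt n) (g (φ.pt n)) := by
    intro n hn
    have h1 : ∀ z ∈ half, z ≠ 0 ∧ z ∈ pts := by decide
    obtain ⟨hn0, hnp⟩ := h1 n hn
    obtain ⟨e1, e2, e3⟩ := hC n hnp hn0
    have h4 : lin w₁ w₂ w₃ n ≠ 0 := fun h5 => e2 (by rw [h n hn, h5, h0])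
    obtain ⟨-, -, e4⟩ := hC (lin w₁ w₂ w₃ n) (red_mem _) h4
    rw [hg' n hnp]
    rw [← h n hn] at e4
    exact SRel.trans (SRel.symm e3) e4
  refine ⟨g, by rw [hg' a ha, hab], fun x => ?_⟩
  obtain ⟨n, hn, rfl⟩ := φ.surj x
  change A.r (φ.pt n) (g (φ.pt n))
  have h2 : ∀ n ∈ pts, n = 0 ∨ n ∈ half ∨ ∃ m ∈ half, m ∈ pts ∧ n = neg m := by decide
  obtain rfl | hn | ⟨m, hm, hmp, rfl⟩ := h2 n hn
  · rw [pt_zero, map_one]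
    exact SRel.refl _
  · exact hhalf n hn
  · rw [pt_neg _ hmp, map_inv]
    exact A.inv _ _ (hhalf m hm)

lemma locSchur_of_leaf [Finite G] {A : SRel G} {l : List (ℕ × ℕ)} (h : leaf l = true)
    (hl : ∀ D ∈ l, φ.IsCls A.r D) (hc : ∀ x ≠ 1, ∃ D ∈ l, A.r (φ.pt D.2) x) : A.LocSchur := by
  have h1 := (homogeneous_iff _ _).1 ((leaf_iff l).1 h (compat_of_isCls (isRing A) hl))
  have h0 : dig (colouring l) 0 = 0 := by
    rw [dig_eq, pow_zero, Nat.div_one]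
    exact Nat.mod_eq_zero_of_dvd (dvd_colouring hl)
  have hlt : ∀ n ∈ pts, n < 256 := by decide
  have hC : ∀ n ∈ pts, n ≠ 0 → dig (colouring l) n ∈ pts ∧ dig (colouring l) n ≠ 0 ∧
      A.r (φ.pt (dig (colouring l) n)) (φ.pt n) := by
    intro n hn h2
    obtain ⟨D, hD, h3⟩ := hc (φ.pt n) (mt (φ.pt_eq_one hn).1 h2)
    have h4 := (h1 D hD).1
    rw [(hl D hD).2.2, land_code_iff (hlt _ (hl D hD).1)] at h4
    rw [h4 n hn h3]
    exact ⟨(hl D hD).1, (hl D hD).2.1, h3⟩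
  have key : ∀ D ∈ l, ∀ v, A.r (φ.pt D.2) v →
      ∃ g : G →* G, g (φ.pt D.2) = v ∧ ∀ x, A.r x (g x) := by
    intro D hD v hv
    obtain ⟨b, hb, rfl⟩ := φ.surj v
    refine exists_map (hl D hD).1 h0 hC ((h1 D hD).2 b hb ?_)
    rw [(hl D hD).2.2, has_code]
    exact ⟨hb, hv⟩
  refine SRel.locSchur_of_hom fun u v huv => ?_
  by_cases hu : u = 1
  · subst hu
    exact ⟨MonoidHom.id G, (A.one v huv).symm, fun x => SRel.refl x⟩
  obtain ⟨D, hD, hDu⟩ := hc u hu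
  obtain ⟨g, hgu, hg⟩ := key D hD u hDu
  obtain ⟨g', hgv, hg'⟩ := key D hD v (SRel.trans hDu huv)
  have hinj : Function.Injective g := by
    rw [injective_iff_map_eq_one]
    intro x hx
    exact SRel.eq_one (hx ▸ hg x)
  have hbij : Function.Bijective g := Finite.injective_iff_bijective.1 hinj
  let e : G ≃* G := MulEquiv.ofBijective g hbij
  refine ⟨g'.comp e.symm.toMonoidHom, ?_, fun x => ?_⟩
  · have : e.symm u = φ.pt D.2 := by
      rw [MulEquiv.symm_apply_eq]
      exact hgu.symm
    simp [this, hgv]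
  · have h5 := hg (e.symm x)
    have h6 : g (e.symm x) = x := e.apply_symm_apply x
    rw [h6] at h5
    exact SRel.trans (SRel.symm h5) (hg' _)

end Frame
end Space

namespace SRel
variable {G : Type*} [CommGroup G] (A : SRel G)

/-- Two elements lie in the same class up to inversion. -/
def sr (x y : G) : Prop := A.r x y ∨ A.r x y⁻¹

variable {A}

lemma sr_equiv : Equivalence A.sr where
  refl x := Or.inl (refl x)
  symm := by
    rintro x y (h | h)
    · exact Or.inl (symm h)
    · exact Or.inr (by simpa using symm (A.inv _ _ h))
  trans := by
    rintro x y z (h | h) (h' | h')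
    · exact Or.inl (trans h h')
    · exact Or.inr (trans h h')
    · exact Or.inr (trans h (A.inv _ _ h'))
    · exact Or.inl (trans h (by simpa using A.inv _ _ h'))

lemma sr_inv (x : G) : A.sr x x⁻¹ := Or.inr (by simpa using refl x)

lemma eq_one_of_sr {x : G} (h : A.sr x 1) : x = 1 := by
  rcases h with h | h
  · exact eq_one h
  · exact eq_one (by simpa using h)

lemma sat_sr (a : G) : A.Sat {x | A.sr a x} := fun _ _ h hx => sr_equiv.trans hx (Or.inl h)

lemma sr_count [Finite G] (a b x y : G) (h : A.sr x y) :
    Nat.card {g // A.sr a g ∧ A.sr b (x / g)} = Nat.card {g // A.sr a g ∧ A.sr b (y / g)} := by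
  rcases h with h | h
  · exact (sat_sr a).count (sat_sr b) h
  · refine ((sat_sr a).count (sat_sr b) h).trans
      (Nat.card_congr ((Equiv.inv G).subtypeEquiv fun g => ?_))
    have h1 : ∀ a x, A.sr a x⁻¹ ↔ A.sr a x := fun a x =>
      ⟨fun h => sr_equiv.trans h (sr_equiv.symm (sr_inv x)), fun h => sr_equiv.trans h (sr_inv x)⟩
    rw [Equiv.inv_apply, ← h1 b (y / g⁻¹), Set.mem_ofPred_eq, Set.mem_ofPred_eq, h1,
      show (y / g⁻¹)⁻¹ = y⁻¹ / g by rw [inv_div, div_eq_mul_inv, div_eq_mul_inv, mul_comm]]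

end SRel

namespace Space

lemma both_iff {p q : Bool} : both p q = true ↔ p = true ∧ q = true := by
  cases p <;> simp [both]

lemma implies_iff {p q : Bool} : implies p q = true ↔ (p = true → q = true) := by
  cases p <;> simp [implies]

lemma refine_cons (D : ℕ × ℕ) (todo acc : List (ℕ × ℕ)) : refine (D :: todo) acc = both
    (implies (closed D.1 (List.cons D acc)) (refine todo (List.cons D acc)))
    (orient D.1 D.2 (fun X => implies
      (closed X (List.cons (X, D.2) (List.cons (Nat.sub D.1 X, neg D.2) acc)))
      (refine todo (List.cons (X, D.2) (List.cons (Nat.sub D.1 X, neg D.2) acc)))) half 0) := rfl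

lemma orient_cons (D d : ℕ) (f : ℕ → Bool) (z : ℕ) (l : List ℕ) (X : ℕ) :
    orient D d f (z :: l) X = Bool.rec (orient D d f l X)
      (Bool.rec false (Bool.rec (orient D d f l (Nat.add X (unit (neg z)))) true (Nat.beq z d))
      (orient D d f l (Nat.add X (unit z)))) (has D z) := rfl

lemma choose_cons (cand : ℕ → Bool) (b : ℕ) (f : ℕ → Bool) (z : ℕ) (l : List ℕ) (X : ℕ) :
    choose cand b f (z :: l) X = Bool.rec (choose cand b f l X)
      (Bool.rec false (Bool.rec (choose cand b f l X) true (Nat.beq z b))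
      (choose cand b f l (Nat.add X (Nat.add (unit z) (unit (neg z)))))) (cand z) := rfl

lemma firstIn_cons (R : ℕ) (f : ℕ → Bool) (dflt : Bool) (z : ℕ) (l : List ℕ) :
    firstIn R f dflt (z :: l) = Bool.rec (firstIn R f dflt l) (f z) (has R z) := rfl

lemma search_succ (n : ℕ) (acc : List (ℕ × ℕ)) (Ns : List ℕ) (R : ℕ) :
    search (n + 1) acc Ns R = firstIn R
    (fun b => choose (fun z => both (has R z)
        (allIn (fun N => Nat.beq (dig N z) (dig N b)) Ns)) b
      (fun X => implies (allIn (fun D => both (sizeLe X D.1) (sizeLe D.1 X)) acc)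
        (implies (closed X (List.cons (X, b) acc))
          (search n (List.cons (X, b) acc) (products X Ns (List.cons (X, b) acc)) (Nat.sub R X))))
      half 0)
    (both (Nat.beq R 0) (refine acc [])) half := rfl

lemma sizeLe_iff (X Y : ℕ) : sizeLe X Y = true ↔ X % 255 ≤ Y % 255 ∨
    ∀ e ∈ [1, 8, 64], has X e = true → ¬ unit e ≤ Y := by
  unfold sizeLe
  rw [rec_or_iff, natBle_iff, allIn_iff]
  refine or_congr Iff.rfl (forall₂_congr fun e _ => ?_)
  rw [rec_true_iff, rec_true_iff, natBle_iff]
  simp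

lemma mem_products {X N : ℕ} {Ns : List ℕ} {l : List (ℕ × ℕ)} :
    N ∈ products X Ns l ↔ N ∈ Ns ∨ ∃ D ∈ l, N = conv X D.1 := by
  induction l with
  | nil => simp [products]
  | cons D l ih =>
    have h : products X Ns (D :: l) = conv X D.1 :: products X Ns l := rfl
    rw [h, List.mem_cons, ih]
    simp only [List.mem_cons, exists_eq_or_imp]
    exact or_left_comm

lemma firstIn_eq_true {R : ℕ} {f : ℕ → Bool} {dflt : Bool} {l : List ℕ}
    (h : firstIn R f dflt l = true) : dflt = true ∨ ∃ z ∈ l, has R z = true ∧ f z = true := by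
  induction l with
  | nil => exact Or.inl h
  | cons z l ih =>
    rw [firstIn_cons] at h
    cases hz : has R z with
    | false =>
      rw [hz] at h
      refine (ih h).imp_right ?_
      rintro ⟨w, hw, h'⟩
      exact ⟨w, List.mem_cons_of_mem _ hw, h'⟩
    | true =>
      rw [hz] at h
      exact Or.inr ⟨z, List.mem_cons_self, hz, h⟩

lemma orient_eq_true {p : ℕ → Prop} [DecidablePred p] {D d : ℕ} {f : ℕ → Bool} (hd : p d)
    {l : List ℕ} {X : ℕ} (h : orient D d f l X = true) :
    f (X + (l.map fun z => if has D z = true then if p z then unit z else unit (neg z)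
      else 0).sum) = true := by
  induction l generalizing X with
  | nil => exact h
  | cons z l ih =>
    rw [orient_cons] at h
    rw [List.map_cons, List.sum_cons, ← add_assoc]
    cases hz : has D z with
    | false =>
      rw [hz] at h
      simpa using ih h
    | true =>
      rw [hz] at h
      rw [if_pos rfl]
      obtain ⟨h1, h2⟩ := rec_false_iff.1 h
      split_ifs with hp
      · exact ih h1
      · rw [rec_or_iff, natBeq_iff] at h2
        exact ih (h2.resolve_left fun h3 => hp (h3 ▸ hd))

lemma choose_eq_true {p : ℕ → Prop} [DecidablePred p] {cand : ℕ → Bool} {b : ℕ} {f : ℕ → Bool}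
    (hb : p b) {l : List ℕ} (hp : ∀ z ∈ l, p z → cand z = true) {X : ℕ}
    (h : choose cand b f l X = true) :
    f (X + (l.map fun z => if p z then unit z + unit (neg z) else 0).sum) = true := by
  induction l generalizing X with
  | nil => exact h
  | cons z l ih =>
    have ih' := fun {X} => ih (X := X) fun w hw => hp w (List.mem_cons_of_mem _ hw)
    rw [choose_cons] at h
    rw [List.map_cons, List.sum_cons, ← add_assoc]
    cases hz : cand z with
    | false =>
      rw [hz] at h
      have hpz : ¬ p z := fun h1 => by
        rw [hp z List.mem_cons_self h1] at hz
        exact Bool.noConfusion hz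
      rw [if_neg hpz]
      exact ih' h
    | true =>
      rw [hz] at h
      obtain ⟨h1, h2⟩ := rec_false_iff.1 h
      split_ifs with hpz
      · exact ih' h1
      · rw [rec_or_iff, natBeq_iff] at h2
        exact ih' (h2.resolve_left fun h3 => hpz (h3 ▸ hb))

namespace Frame
variable {G : Type*} [CommGroup G] {φ : Frame G} {A : SRel G}

lemma half_subset {z : ℕ} (hz : z ∈ half) : z ∈ pts := by
  revert z
  decide

lemma neg_ne_zero {z : ℕ} (hz : z ∈ pts) (h : z ≠ 0) : neg z ≠ 0 := by
  revert z
  decide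

lemma locSchur_of_refine [Finite G] : ∀ {todo acc : List (ℕ × ℕ)}, refine todo acc = true →
    (∀ D ∈ todo, φ.IsCls A.sr D) → (∀ D ∈ acc, φ.IsCls A.r D) →
    (∀ x ≠ 1, (∃ D ∈ todo, A.sr (φ.pt D.2) x) ∨ ∃ D ∈ acc, A.r (φ.pt D.2) x) → A.LocSchur
  | [], acc, h, _, hacc, hc =>
    locSchur_of_leaf (l := acc) h hacc fun x hx => (hc x hx).resolve_left (by simp)
  | D :: todo, acc, h, htodo, hacc, hc => by
    classical
    rw [refine_cons, both_iff, implies_iff] at h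
    obtain ⟨h1, h2⟩ := h
    obtain ⟨hd, hd0, hD⟩ := htodo D List.mem_cons_self
    have htodo' : ∀ D ∈ todo, φ.IsCls A.sr D := fun E hE => htodo E (List.mem_cons_of_mem _ hE)
    by_cases hs : A.r (φ.pt D.2) (φ.pt D.2)⁻¹
    · have h3 : ∀ x, A.sr (φ.pt D.2) x ↔ A.r (φ.pt D.2) x := by
        refine fun x => ⟨?_, Or.inl⟩
        rintro (h | h)
        · exact h
        · exact SRel.trans hs (by simpa using A.inv _ _ h)
      have h4 : ∀ E ∈ D :: acc, φ.IsCls A.r E := by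
        rintro E hE
        rcases List.mem_cons.1 hE with rfl | hE
        · exact ⟨hd, hd0, by simp only [hD, h3]⟩
        · exact hacc E hE
      refine locSchur_of_refine (h1 ((h4 D List.mem_cons_self).closed (isRing A) h4)) htodo' h4 ?_
      intro x hx
      rcases hc x hx with ⟨E, hE, hEx⟩ | ⟨E, hE, hEx⟩
      · rcases List.mem_cons.1 hE with rfl | hE
        · exact Or.inr ⟨E, List.mem_cons_self, (h3 x).1 hEx⟩
        · exact Or.inl ⟨E, hE, hEx⟩
      · exact Or.inr ⟨E, List.mem_cons_of_mem _ hE, hEx⟩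
    · set S : Set G := {y | A.r (φ.pt D.2) y} with hS
      have hSs : S ⊆ {y | A.sr (φ.pt D.2) y} := fun y hy => Or.inl hy
      have hdj : ∀ y, y ∈ S → y⁻¹ ∉ S := fun y hy hy' =>
        hs (SRel.trans hy (by simpa using A.inv _ _ (SRel.symm hy')))
      have h3 := orient_eq_true (p := fun z => φ.pt z ∈ S) (SRel.refl _) h2
      have h4 : (half.map fun z => if has D.1 z = true then
          if φ.pt z ∈ S then unit z else unit (neg z) else 0).sum = φ.code S := by
        rw [code_eq_sum_half]
        · refine congrArg List.sum (List.map_congr_left fun z hz => ?_)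
          have hzp := half_subset hz
          simp only [hD, has_code, φ.pt_neg hzp]
          by_cases hz1 : φ.pt z ∈ S
          · rw [if_pos ⟨hzp, hSs hz1⟩, if_pos hz1, if_neg (hdj _ hz1), if_pos hz1, add_zero]
          · by_cases hz2 : (φ.pt z)⁻¹ ∈ S
            · rw [if_pos ⟨hzp, Or.inr hz2⟩, if_neg hz1, if_pos hz2, if_neg hz1, zero_add]
            · rw [if_neg, if_neg hz1, if_neg hz2]
              rintro ⟨-, h5 | h5⟩
              exacts [hz1 h5, hz2 h5]
        · exact fun h5 => hd0 ((φ.pt_eq_one hd).1 (SRel.eq_one h5))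
      rw [h4, zero_add, implies_iff] at h3
      have h5 : φ.IsCls A.r (φ.code S, D.2) := ⟨hd, hd0, rfl⟩
      have h6 : φ.IsCls A.r (Nat.sub D.1 (φ.code S), neg D.2) := by
        refine ⟨red_mem _, neg_ne_zero hd hd0, ?_⟩
        rw [hD]
        refine (code_diff hSs).trans (congrArg _ ?_)
        ext y
        rw [φ.pt_neg hd]
        have h7 : A.r (φ.pt D.2)⁻¹ y ↔ y⁻¹ ∈ S := by
          rw [← SRel.inv_iff, inv_inv]
          rfl
        change _ ↔ A.r _ _
        rw [h7]
        constructor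
        · rintro ⟨h8 | h8, h9⟩
          exacts [absurd h8 h9, h8]
        · exact fun h8 => ⟨Or.inr h8, fun h9 => hdj _ h9 h8⟩
      have h7 : ∀ E ∈ (φ.code S, D.2) :: (Nat.sub D.1 (φ.code S), neg D.2) :: acc,
          φ.IsCls A.r E := by
        intro E hE
        rcases List.mem_cons.1 hE with rfl | hE
        · exact h5
        · rcases List.mem_cons.1 hE with rfl | hE
          · exact h6
          · exact hacc E hE
      have h8 := h5.closed (isRing A) h7
      dsimp only at h8
      refine locSchur_of_refine (h3 h8) htodo' h7 ?_
      intro x hx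
      rcases hc x hx with ⟨E, hE, hEx⟩ | ⟨E, hE, hEx⟩
      · rcases List.mem_cons.1 hE with rfl | hE
        · rcases hEx with hEx | hEx
          · exact Or.inr ⟨_, List.mem_cons_self, hEx⟩
          · refine Or.inr ⟨_, List.mem_cons_of_mem _ List.mem_cons_self, ?_⟩
            rw [φ.pt_neg hd]
            simpa using A.inv _ _ hEx
        · exact Or.inl ⟨E, hE, hEx⟩
      · exact Or.inr ⟨E, by simp [hE], hEx⟩

lemma sizeLe_of_isCls {X Y : ℕ × ℕ} (hφ : ∀ e ∈ [1, 8, 64], ∀ n ∈ pts, e ≤ n →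
      {y | A.sr (φ.pt e) y}.ncard ≤ {y | A.sr (φ.pt n) y}.ncard)
    (hX : φ.IsCls A.sr X) (hY : φ.IsCls A.sr Y) : sizeLe X.1 Y.1 = true := by
  rw [sizeLe_iff, or_iff_not_imp_left]
  intro h e he he1 he2
  apply h
  have h1 : ∀ a b, A.sr a b → {y | A.sr a y} = {y | A.sr b y} := fun a b hab =>
    Set.ext fun y => ⟨SRel.sr_equiv.trans (SRel.sr_equiv.symm hab), SRel.sr_equiv.trans hab⟩
  rw [hX.2.2] at he1
  rw [hY.2.2] at he2
  obtain ⟨n, hn, hen, hn'⟩ := exists_of_unit_le_code he2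
  rw [hX.2.2, hY.2.2, code_mod, code_mod, h1 _ _ (has_code.1 he1).2, h1 _ _ hn']
  exact hφ e he n hn hen

lemma locSchur_of_search [Finite G] (hφ : ∀ e ∈ [1, 8, 64], ∀ n ∈ pts, e ≤ n →
      {y | A.sr (φ.pt e) y}.ncard ≤ {y | A.sr (φ.pt n) y}.ncard) (n : ℕ) :
    ∀ {acc : List (ℕ × ℕ)} {Ns : List ℕ} {U : Set G}, search n acc Ns (φ.code U) = true →
      (∀ x y, A.sr x y → x ∈ U → y ∈ U) → 1 ∉ U → (∀ D ∈ acc, φ.IsCls A.sr D) →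
      (∀ N ∈ Ns, φ.IsInv A.sr N) → (∀ x ≠ 1, x ∈ U ∨ ∃ D ∈ acc, A.sr (φ.pt D.2) x) →
      A.LocSchur := by
  classical
  have hring : φ.IsRing A.sr := isRing_of_count SRel.sr_count
  induction n with
  | zero => exact fun h => absurd h Bool.false_ne_true
  | succ n ih =>
    intro acc Ns U h hU h1 hacc hNs hc
    rw [search_succ] at h
    rcases firstIn_eq_true h with h | ⟨b, hb, hbU, h⟩
    · rw [both_iff, natBeq_iff] at h
      have hU0 := eq_empty_of_code h.1
      subst hU0
      exact locSchur_of_refine h.2 hacc (by simp) fun x hx => Or.inl ((hc x hx).resolve_left id)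
    · have hbp := half_subset hb
      have hbU' : φ.pt b ∈ U := (has_code.1 hbU).2
      set S : Set G := {y | A.sr (φ.pt b) y} with hS
      have hSU : S ⊆ U := fun y hy => hU _ _ hy hbU'
      have hcls : φ.IsCls A.sr (φ.code S, b) := by
        refine ⟨hbp, ?_, rfl⟩
        rintro rfl
        exact h1 (φ.pt_zero ▸ hbU')
      have h2 := choose_eq_true (p := fun z => φ.pt z ∈ S) (SRel.sr_equiv.refl _) (by
        intro z hz hzS
        rw [both_iff, allIn_iff, has_code]
        refine ⟨⟨half_subset hz, hSU hzS⟩, fun N hN => ?_⟩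
        rw [natBeq_iff]
        exact (hNs N hN b hbp z (half_subset hz) hzS).symm) h
      have h3 : (half.map fun z => if φ.pt z ∈ S then unit z + unit (neg z) else 0).sum =
          φ.code S := by
        rw [code_eq_sum_half fun h => h1 (hSU h)]
        refine congrArg List.sum (List.map_congr_left fun z hz => ?_)
        have h4 : (φ.pt z)⁻¹ ∈ S ↔ φ.pt z ∈ S :=
          ⟨fun h => SRel.sr_equiv.trans h (SRel.sr_equiv.symm (SRel.sr_inv _)),
            fun h => SRel.sr_equiv.trans h (SRel.sr_inv _)⟩
        rw [φ.pt_neg (half_subset hz)]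
        simp only [h4]
        split_ifs <;> simp
      have hacc' : ∀ D ∈ (φ.code S, b) :: acc, φ.IsCls A.sr D := by
        intro D hD
        rcases List.mem_cons.1 hD with rfl | hD
        exacts [hcls, hacc D hD]
      rw [h3, zero_add, implies_iff, implies_iff, allIn_iff] at h2
      have h5 : ∀ D ∈ acc, both (sizeLe (φ.code S) D.1) (sizeLe D.1 (φ.code S)) = true := by
        intro D hD
        have h6 := sizeLe_of_isCls hφ hcls (hacc D hD)
        have h7 := sizeLe_of_isCls hφ (hacc D hD) hcls
        dsimp only at h6 h7
        rw [both_iff]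
        exact ⟨h6, h7⟩
      have h6 := hcls.closed hring hacc'
      dsimp only at h6
      have h4 := h2 h5 h6
      change search n _ _ (φ.code U - φ.code S) = true at h4
      rw [code_diff hSU] at h4
      refine ih h4 ?_ (fun h => h1 h.1) hacc' ?_ ?_
      · exact fun x y hxy hx => ⟨hU x y hxy hx.1, fun hy =>
          hx.2 (SRel.sr_equiv.trans hy (SRel.sr_equiv.symm hxy))⟩
      · intro N hN
        rcases mem_products.1 hN with hN | ⟨D, hD, rfl⟩
        · exact hNs N hN
        · have h7 := hcls.isInv hring (hacc' D hD)
          dsimp only at h7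
          exact h7
      · intro x hx
        rcases hc x hx with h5 | ⟨D, hD, hDx⟩
        · by_cases hxS : x ∈ S
          · exact Or.inr ⟨_, List.mem_cons_self, hxS⟩
          · exact Or.inl ⟨h5, hxS⟩
        · exact Or.inr ⟨D, List.mem_cons_of_mem _ hD, hDx⟩

lemma locSchur [Finite G] (hφ : ∀ e ∈ [1, 8, 64], ∀ n ∈ pts, e ≤ n →
      {y | A.sr (φ.pt e) y}.ncard ≤ {y | A.sr (φ.pt n) y}.ncard) : A.LocSchur := by
  have h := search_eq_true
  rw [full_eq_code (φ := φ)] at h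
  refine locSchur_of_search hφ 14 h ?_ (by simp) (by simp) (by simp) (by simp)
  rintro x y hxy hx rfl
  exact hx (SRel.eq_one_of_sr hxy)

end Frame
end Space

namespace Space
variable {G : Type*} [CommGroup G]

lemma exists_min_notMem [Finite G] {K : Subgroup G} (hK : Nat.card K < Nat.card G) (sz : G → ℕ) :
    ∃ b ∉ K, ∀ x ∉ K, sz b ≤ sz x := by
  have h1 : ((K : Set G)ᶜ).Nonempty := by
    rw [Set.nonempty_compl]
    intro h
    rw [Subgroup.coe_eq_univ.1 h, Subgroup.card_top] at hK
    exact lt_irrefl _ hK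
  obtain ⟨b, hb, h⟩ := Set.exists_min_image ((K : Set G)ᶜ) sz (Set.toFinite _) h1
  exact ⟨b, hb, h⟩

lemma card_sup_zpowers_le [Finite G] (h3 : ∀ x : G, x ^ 3 = 1) (K : Subgroup G) (b : G) :
    Nat.card (K ⊔ Subgroup.zpowers b : Subgroup G) ≤ 3 * Nat.card K := by
  have h1 : Nat.card (Subgroup.zpowers b) ≤ 3 := by
    rw [Nat.card_zpowers]
    exact orderOf_le_of_pow_eq_one (by norm_num) (h3 b)
  calc Nat.card (K ⊔ Subgroup.zpowers b : Subgroup G)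
      = Nat.card ((K : Set G) * (Subgroup.zpowers b : Set G) : Set G) := by
        rw [← Subgroup.mul_normal]
        rfl
    _ ≤ Nat.card K * Nat.card (Subgroup.zpowers b) := by
        simpa using Set.natCard_mul_le (s := (K : Set G)) (t := (Subgroup.zpowers b : Set G))
    _ ≤ 3 * Nat.card K := by
        rw [mul_comm]
        exact Nat.mul_le_mul_right _ h1

lemma exists_frame [Finite G] (hc : Nat.card G = 27) (h3 : ∀ x : G, x ^ 3 = 1) (sz : G → ℕ) :
    ∃ φ : Frame G, ∀ e ∈ [1, 8, 64], ∀ n ∈ pts, e ≤ n → sz (φ.pt e) ≤ sz (φ.pt n) := by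
  have c0 : Nat.card (⊥ : Subgroup G) = 1 := Subgroup.card_bot
  obtain ⟨b₁, hb₁, hm₁⟩ := exists_min_notMem (K := ⊥) (by omega) sz
  have c1 := card_sup_zpowers_le h3 ⊥ b₁
  obtain ⟨b₂, hb₂, hm₂⟩ := exists_min_notMem (K := ⊥ ⊔ Subgroup.zpowers b₁) (by omega) sz
  have c2 := card_sup_zpowers_le h3 (⊥ ⊔ Subgroup.zpowers b₁) b₂
  obtain ⟨b₃, hb₃, hm₃⟩ :=
    exists_min_notMem (K := ⊥ ⊔ Subgroup.zpowers b₁ ⊔ Subgroup.zpowers b₂) (by omega) sz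
  have k1 : ∀ i, b₁ ^ i ∈ ⊥ ⊔ Subgroup.zpowers b₁ := fun i =>
    Subgroup.mem_sup_right (Subgroup.npow_mem_zpowers b₁ i)
  have k2 : ∀ i j, b₁ ^ i * b₂ ^ j ∈ ⊥ ⊔ Subgroup.zpowers b₁ ⊔ Subgroup.zpowers b₂ := fun i j =>
    mul_mem (Subgroup.mem_sup_left (k1 i))
      (Subgroup.mem_sup_right (Subgroup.npow_mem_zpowers b₂ j))
  have i1 : ∀ i < 3, b₁ ^ i = 1 → i = 0 := fun i hi h =>
    (eq_and_eq_of_mul_pow_eq hb₁ (h3 b₁) (one_mem _) (one_mem _) hi (j := 0) (by norm_num)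
      (by simpa using h)).1
  have i2 : ∀ i j, j < 3 → b₁ ^ i * b₂ ^ j ∈ ⊥ ⊔ Subgroup.zpowers b₁ → j = 0 :=
    fun i j hj h => (eq_and_eq_of_mul_pow_eq hb₂ (h3 b₂) (k1 i) h hj (j := 0) (by norm_num)
      (by simp)).1
  have i3 : ∀ i j k, k < 3 → b₁ ^ i * b₂ ^ j * b₃ ^ k ∈
      ⊥ ⊔ Subgroup.zpowers b₁ ⊔ Subgroup.zpowers b₂ → k = 0 :=
    fun i j k hk h => (eq_and_eq_of_mul_pow_eq hb₃ (h3 b₃) (k2 i j) h hk (j := 0) (by norm_num)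
      (by simp)).1
  have inj : ∀ m ∈ pts, ∀ n ∈ pts, b₁ ^ (m % 8) * b₂ ^ (m / 8 % 8) * b₃ ^ (m / 64) =
      b₁ ^ (n % 8) * b₂ ^ (n / 8 % 8) * b₃ ^ (n / 64) → m = n := by
    intro m hm n hn h
    rw [mem_pts] at hm hn
    obtain ⟨e3, h⟩ := eq_and_eq_of_mul_pow_eq hb₃ (h3 b₃) (k2 _ _) (k2 _ _) hm.2.2 hn.2.2 h
    obtain ⟨e2, h⟩ := eq_and_eq_of_mul_pow_eq hb₂ (h3 b₂) (k1 _) (k1 _) hm.2.1 hn.2.1 h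
    obtain ⟨e1, -⟩ := eq_and_eq_of_mul_pow_eq hb₁ (h3 b₁) (one_mem _) (one_mem _) hm.1 hn.1
      (by rw [h])
    rw [eq_digits m, eq_digits n, e1, e2, e3]
  have hbij := Function.Injective.bijective_of_nat_card_le
    (f := fun n : {n // n ∈ pts.toFinset} =>
      b₁ ^ ((n : ℕ) % 8) * b₂ ^ ((n : ℕ) / 8 % 8) * b₃ ^ ((n : ℕ) / 64))
    (fun m n h => Subtype.ext (inj m (List.mem_toFinset.1 m.2) n (List.mem_toFinset.1 n.2) h)) (by
      rw [hc, Nat.card_eq_fintype_card, Fintype.card_coe]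
      decide)
  refine ⟨⟨b₁, b₂, b₃, h3, inj, fun x => ?_⟩, fun e he n hn hen => ?_⟩
  · obtain ⟨n, hn⟩ := hbij.2 x
    exact ⟨n, List.mem_toFinset.1 n.2, hn⟩
  · have hn' := mem_pts.1 hn
    simp only [List.mem_cons, List.not_mem_nil, or_false] at he
    rcases he with rfl | rfl | rfl
    · rw [show Frame.pt _ 1 = b₁ by simp [Frame.pt]]
      refine hm₁ _ fun h => ?_
      rw [Subgroup.mem_bot, Frame.pt_eq_one _ hn] at h
      omega
    · rw [show Frame.pt _ 8 = b₂ by simp [Frame.pt]]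
      refine hm₂ _ fun h => ?_
      have e3 := i3 _ _ _ hn'.2.2 (Subgroup.mem_sup_left h)
      simp only [Frame.pt, e3, pow_zero, mul_one] at h
      have e2 := i2 _ _ hn'.2.1 h
      have := eq_digits n
      omega
    · rw [show Frame.pt _ 64 = b₃ by simp [Frame.pt]]
      refine hm₃ _ fun h => ?_
      have e3 := i3 _ _ _ hn'.2.2 h
      omega

end Space

theorem SRel.locSchur_of_card_eq_twentySeven {G : Type*} [CommGroup G] (hc : Nat.card G = 27)
    (h3 : ∀ x : G, x ^ 3 = 1) (A : SRel G) : A.LocSchur := by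
  have : Finite G := Nat.finite_of_card_ne_zero (by omega)
  obtain ⟨φ, hφ⟩ := Space.exists_frame hc h3 fun x => {y | A.sr x y}.ncard
  exact φ.locSchur hφ

lemma SchurRing.isSchurian_of_C3xC3xCp (p : ℕ) [Fact p.Prime]
    (A : SchurRing (Multiplicative (ZMod 3 × ZMod 3 × ZMod p))) : A.IsSchurian := by
  have hc : Nat.card (Multiplicative (ZMod 3 × ZMod 3 × ZMod p)) = 9 * p := by
    rw [Nat.card_congr Multiplicative.toAdd, Nat.card_prod, Nat.card_prod, Nat.card_zmod,
      Nat.card_zmod]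
    ring
  have hexp : ∀ g : Multiplicative (ZMod 3 × ZMod 3 × ZMod p), ∀ n, 3 ∣ n → p ∣ n → g ^ n = 1 := by
    intro g n h3 hp
    apply Multiplicative.toAdd.injective
    rw [toAdd_pow, toAdd_one]
    have e3 := (ZMod.natCast_eq_zero_iff n 3).2 h3
    have ep := (ZMod.natCast_eq_zero_iff n p).2 hp
    ext <;> simp [e3, ep]
  refine A.isSchurian_of_locSchur ?_
  by_cases hp3 : p = 3
  · subst hp3
    exact SRel.locSchur_of_card_eq_twentySeven hc
      (fun x => hexp x 3 dvd_rfl dvd_rfl) _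
  · exact SRel.locSchur_of_exponent Fact.out hp3 hc.dvd
      (fun g => hexp g _ (dvd_mul_right _ _) (dvd_mul_left _ _)) _

theorem schur_ring_over_C3xC3xCp_is_schurian (p : ℕ) [Fact p.Prime] :
    (∀ A : SchurRing (Multiplicative (ZMod 3 × ZMod 3 × ZMod p)), A.IsSchurian) ∧
    IsSchurGroup (Multiplicative (ZMod 3 × ZMod 3 × ZMod p)) := by
  exact ⟨SchurRing.isSchurian_of_C3xC3xCp p, SchurRing.isSchurian_of_C3xC3xCp p⟩
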